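/- For every ε > 0 and A > 0 there exists a constant C(ε,A) such that for every integer t ≥ 2 and every two pairs of integers (n,m), (n',m') with 1 ≤ m ≤ n, 1 ≤ m' ≤ n', (n)_m = (n')_{m'} = t, and exp((log(n+n'))^{2/3+ε}) ≤ m, m' ≤ (n+n')^{2/3}, one has |n − n'| ≤ C(ε,A)·(m + m')/(log(m + m'))^A. -/

import Mathlib

namespace PowerSums

open Finset

/-- Elementary symmetric sums of a finite family. -/
noncomputable def elemSum {σ R : Type*} [Fintype σ] [CommRing R] (T : σ → R) (j : ℕ) : R :=
  ∑ A ∈ powersetCard j (univ : Finset σ), ∏ c ∈ A, T c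

lemma elemSum_zero {σ R : Type*} [Fintype σ] [CommRing R] (T : σ → R) : elemSum T 0 = 1 := by
  simp [elemSum]

lemma newton {σ R : Type*} [Fintype σ] [CommRing R] (T : σ → R) (j : ℕ) :
    (j : R) * elemSum T j = (-1) ^ (j + 1) *
      ∑ a ∈ antidiagonal j with a.1 < j, (-1) ^ a.1 * elemSum T a.1 * ∑ c, T c ^ a.2 := by
  have h := congrArg (MvPolynomial.aeval T) (MvPolynomial.mul_esymm_eq_sum σ R j)
  simpa [MvPolynomial.esymm, MvPolynomial.psum, elemSum] using h

lemma newton_range {σ R : Type*} [Fintype σ] [CommRing R] (T : σ → R) (j : ℕ) :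
    ((j + 1 : ℕ) : R) * elemSum T (j + 1) =
      ∑ i ∈ range (j + 1), (-1) ^ i * elemSum T (j - i) * ∑ c, T c ^ (i + 1) := by
  rw [newton, sum_filter, Finset.Nat.sum_antidiagonal_eq_sum_range_succ_mk, sum_range_succ]
  simp only [lt_irrefl, if_false, add_zero]
  rw [← sum_range_reflect, mul_sum]
  refine sum_congr rfl fun i hi => ?_
  have hi' := mem_range.1 hi
  have h1 : j + 1 - 1 - i < j + 1 := by omega
  have h2 : j + 1 - (j + 1 - 1 - i) = i + 1 := by omega
  have h3 : j + 1 - 1 - i = j - i := by omega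
  rw [if_pos h1, h2, h3, ← mul_assoc, ← mul_assoc, ← pow_add]
  have h4 : j + 1 + 1 + (j - i) = i + 2 * (j - i + 1) := by omega
  rw [h4, pow_add, pow_mul]
  simp

/-- In a ring where `1, …, k` are units, equal power sums force equal elementary sums. -/
lemma elemSum_eq_of_power_sums_eq {σ τ R : Type*} [Fintype σ] [Fintype τ] [CommRing R]
    (T : σ → R) (T' : τ → R) (k : ℕ) (hunit : ∀ j, 1 ≤ j → j ≤ k → IsUnit (j : R))
    (h : ∀ j, 1 ≤ j → j ≤ k → ∑ c, T c ^ j = ∑ c, T' c ^ j) :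
    ∀ j ≤ k, elemSum T j = elemSum T' j := by
  intro j
  induction j using Nat.strong_induction_on with
  | _ j ih =>
    intro hj
    rcases j with _ | j
    · simp [elemSum_zero]
    · have hu := hunit (j + 1) (by omega) hj
      apply hu.mul_left_cancel
      rw [newton_range, newton_range]
      refine sum_congr rfl fun i hi => ?_
      have hi' := mem_range.1 hi
      rw [ih (j - i) (by omega) (by omega), h (i + 1) (by omega) (by omega)]

lemma prod_sub_eq_elemSum {R : Type*} [CommRing R] {k : ℕ} (T : Fin k → R) (y : R) :
    ∏ i, (y - T i) = ∑ j ∈ range (k + 1), (-1) ^ j * (elemSum T j * y ^ (k - j)) := by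
  have h := Multiset.prod_X_sub_X_eq_sum_esymm (univ.val.map T)
  have h2 := congrArg (Polynomial.eval y) h
  rw [Polynomial.eval_finsetSum] at h2
  simp only [Multiset.map_map, Function.comp_def, Multiset.card_map, Finset.card_val,
    Finset.card_univ, Fintype.card_fin, Finset.esymm_map_val] at h2
  have h3 : (univ.val.map fun x : Fin k => Polynomial.X - Polynomial.C (T x)).prod
      = ∏ x : Fin k, (Polynomial.X - Polynomial.C (T x)) := rfl
  rw [h3, Polynomial.eval_prod] at h2
  simpa [elemSum, Polynomial.eval_finsetSum, Polynomial.eval_prod] using h2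

lemma prod_sub_eq_of_power_sums_eq {R : Type*} [CommRing R] {k : ℕ}
    (T T' : Fin k → R) (hunit : ∀ j, 1 ≤ j → j ≤ k → IsUnit (j : R))
    (h : ∀ j, 1 ≤ j → j ≤ k → ∑ c, T c ^ j = ∑ c, T' c ^ j) (y : R) :
    ∏ i, (y - T i) = ∏ i, (y - T' i) := by
  rw [prod_sub_eq_elemSum, prod_sub_eq_elemSum]
  refine sum_congr rfl fun j hj => ?_
  rw [elemSum_eq_of_power_sums_eq T T' k hunit h j (by have := mem_range.1 hj; omega)]

lemma card_injective_image_eq {σ : Type*} [Fintype σ] [DecidableEq σ] (k : ℕ)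
    (A : Finset σ) (hA : A.card = k) :
    (univ.filter fun c : Fin k → σ => Function.Injective c ∧ univ.image c = A).card
      = k.factorial := by
  have hcard : Fintype.card (Fin k ≃ A) = k.factorial := by
    have e : Fin k ≃ A := Fintype.equivOfCardEq (by simp [hA])
    rw [Fintype.card_equiv e, Fintype.card_fin]
  rw [← hcard, ← Finset.card_univ]
  symm
  refine Finset.card_bij (fun e _ => fun i => (e i : σ)) ?_ ?_ ?_
  · intro e _
    simp only [mem_filter, mem_univ, true_and]
    refine ⟨fun a b hab => e.injective (Subtype.ext hab), ?_⟩
    ext x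
    simp only [mem_image, mem_univ, true_and]
    constructor
    · rintro ⟨a, rfl⟩
      exact (e a).2
    · intro hx
      exact ⟨e.symm ⟨x, hx⟩, by simp⟩
  · intro e _ e' _ h
    ext i
    exact congrFun h i
  · intro c hc
    simp only [mem_filter, mem_univ, true_and] at hc
    obtain ⟨hinj, him⟩ := hc
    have hmem : ∀ i, c i ∈ A := fun i => him ▸ mem_image_of_mem c (mem_univ i)
    refine ⟨Equiv.ofBijective (fun i => ⟨c i, hmem i⟩) ⟨?_, ?_⟩, mem_univ _, ?_⟩
    · intro a b hab
      exact hinj (congrArg Subtype.val hab)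
    · rintro ⟨x, hx⟩
      rw [← him] at hx
      obtain ⟨a, -, ha⟩ := mem_image.1 hx
      exact ⟨a, Subtype.ext ha⟩
    · rfl

lemma sum_injective_prod {σ R : Type*} [Fintype σ] [DecidableEq σ] [CommRing R]
    (T : σ → R) (k : ℕ) :
    ∑ c : Fin k → σ with Function.Injective c, ∏ i, T (c i)
      = (k.factorial : R) * elemSum T k := by
  have hmaps : ∀ c ∈ univ.filter (fun c : Fin k → σ => Function.Injective c),
      univ.image c ∈ powersetCard k (univ : Finset σ) := by
    intro c hc
    rw [mem_powersetCard]
    refine ⟨subset_univ _, ?_⟩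
    rw [card_image_of_injective _ (mem_filter.1 hc).2]
    simp
  rw [← sum_fiberwise_of_maps_to hmaps, elemSum, mul_sum]
  refine sum_congr rfl fun A hA => ?_
  rw [← card_injective_image_eq k A (mem_powersetCard.1 hA).2, filter_filter, ← nsmul_eq_mul,
    ← sum_const]
  refine sum_congr rfl fun c hc => ?_
  obtain ⟨-, hinj, him⟩ := mem_filter.1 hc
  rw [← him, prod_image (fun a _ b _ h => hinj h)]

/-- Either the sum is controlled by the square mean, or by the elementary symmetric sum. -/
lemma norm_sum_dichotomy {σ : Type*} [Fintype σ] (T : σ → ℂ) (k : ℕ) (hk : 1 ≤ k) :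
    ‖∑ c, T c‖ ^ 2 ≤ (4 * k) ^ 2 * ∑ c, ‖T c‖ ^ 2 ∨
      ‖∑ c, T c‖ ^ k ≤ 2 ^ k * k.factorial * ‖elemSum T k‖ := by
  by_cases hQ : ‖∑ c, T c‖ ^ 2 ≤ (4 * k) ^ 2 * ∑ c, ‖T c‖ ^ 2
  · exact Or.inl hQ
  right
  push Not at hQ
  set S := ‖∑ c, T c‖ with hS
  set q := Real.sqrt (∑ c, ‖T c‖ ^ 2) with hq
  have hq0 : 0 ≤ q := Real.sqrt_nonneg _
  have hQ0 : 0 ≤ ∑ c, ‖T c‖ ^ 2 := sum_nonneg fun _ _ => by positivity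
  have hq2 : q ^ 2 = ∑ c, ‖T c‖ ^ 2 := Real.sq_sqrt hQ0
  have hS0 : 0 ≤ S := norm_nonneg _
  have hkR : (1 : ℝ) ≤ k := by exact_mod_cast hk
  have hqS : 4 * k * q < S := by
    apply lt_of_pow_lt_pow_left₀ 2 hS0
    rw [mul_pow, hq2]; exact hQ
  have hSpos : 0 < S := lt_of_le_of_lt (by positivity) hqS
  have hTq : ∀ c, ‖T c‖ ≤ q := by
    intro c
    apply Real.le_sqrt_of_sq_le
    exact single_le_sum (f := fun c => ‖T c‖ ^ 2) (fun _ _ => by positivity) (mem_univ c)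
  have hP : ∀ i, ‖∑ c, T c ^ (i + 2)‖ ≤ q ^ (i + 2) := by
    intro i
    calc ‖∑ c, T c ^ (i + 2)‖ ≤ ∑ c, ‖T c‖ ^ i * ‖T c‖ ^ 2 := by
          refine (norm_sum_le _ _).trans (sum_le_sum fun c _ => ?_)
          rw [norm_pow, pow_add]
      _ ≤ ∑ c, q ^ i * ‖T c‖ ^ 2 := by
          refine sum_le_sum fun c _ => ?_
          gcongr
          exact hTq c
      _ = q ^ (i + 2) := by rw [← mul_sum, ← hq2, pow_add]
  set a : ℕ → ℝ := fun j => ‖elemSum T j‖ with ha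
  have ha0 : ∀ j, 0 ≤ a j := fun j => norm_nonneg _
  -- consecutive elementary sums grow
  have key : ∀ j, j < k → a j * S ≤ 2 * (j + 1) * a (j + 1) := by
    intro j
    induction j using Nat.strong_induction_on with
    | _ j ih =>
      intro hj
      have hback : ∀ i, i ≤ j → a (j - i) ≤ a j * (2 * k / S) ^ i := by
        intro i
        induction i with
        | zero => intro _; simp
        | succ i ihi =>
          intro hi
          have h1 := ihi (by omega)
          have h2 := ih (j - (i + 1)) (by omega) (by omega)
          have h3 : j - (i + 1) + 1 = j - i := by omega
          rw [h3] at h2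
          have h4 : ((j - (i + 1) : ℕ) : ℝ) + 1 ≤ k := by
            have : j - (i + 1) + 1 ≤ k := by omega
            exact_mod_cast this
          have h5 : a (j - (i + 1)) ≤ a (j - i) * (2 * k / S) := by
            rw [← mul_div_assoc, le_div_iff₀ hSpos]
            calc a (j - (i + 1)) * S ≤ 2 * (((j - (i + 1) : ℕ) : ℝ) + 1) * a (j - i) := h2
              _ ≤ 2 * k * a (j - i) := by
                have := ha0 (j - i)
                gcongr
              _ = _ := by ring
          calc a (j - (i + 1)) ≤ a (j - i) * (2 * k / S) := h5
            _ ≤ (a j * (2 * k / S) ^ i) * (2 * k / S) := by gcongr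
            _ = _ := by ring
      have hN := newton_range T j
      rw [sum_range_succ'] at hN
      simp only [pow_zero, one_mul, Nat.sub_zero, zero_add, pow_one] at hN
      have hterm : ∀ i ∈ range j, ‖(-1 : ℂ) ^ (i + 1) * elemSum T (j - (i + 1)) *
          ∑ c, T c ^ (i + 1 + 1)‖ ≤ a j * S / 2 * (1 / 2) ^ (i + 1) := by
        intro i hi
        have hi' := mem_range.1 hi
        rw [norm_mul, norm_mul, norm_pow, norm_neg, norm_one, one_pow, one_mul]
        have h1 := hback (i + 1) (by omega)
        have h2 := hP i
        have h3 : q ≤ S / (4 * k) := by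
          rw [le_div_iff₀ (by positivity)]; linarith
        calc a (j - (i + 1)) * ‖∑ c, T c ^ (i + 1 + 1)‖
            ≤ (a j * (2 * k / S) ^ (i + 1)) * (S / (4 * k)) ^ (i + 2) := by
              have h4 : ‖∑ c, T c ^ (i + 1 + 1)‖ ≤ (S / (4 * k)) ^ (i + 2) :=
                h2.trans (pow_le_pow_left₀ hq0 h3 _)
              exact mul_le_mul h1 h4 (norm_nonneg _) (mul_nonneg (ha0 _) (by positivity))
          _ = a j * ((2 * k / S) * (S / (4 * k))) ^ (i + 1) * (S / (4 * k)) := by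
              rw [mul_pow]; ring
          _ = a j * (1 / 2) ^ (i + 1) * (S / (4 * k)) := by
              congr 3
              field_simp
              norm_num
          _ ≤ a j * (1 / 2) ^ (i + 1) * (S / 2) := by
              have := ha0 j
              gcongr
              linarith
          _ = _ := by ring
      have hgeom : ∑ i ∈ range j, (1 / 2 : ℝ) ^ (i + 1) ≤ 1 := by
        have h : ∀ n : ℕ, ∑ i ∈ range n, (1 / 2 : ℝ) ^ (i + 1) = 1 - (1 / 2) ^ n := by
          intro n
          induction n with
          | zero => simp
          | succ n ih => rw [sum_range_succ, ih]; ring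
        rw [h]
        have : (0 : ℝ) < (1 / 2) ^ j := by positivity
        linarith
      have hrest : ‖∑ i ∈ range j, (-1 : ℂ) ^ (i + 1) * elemSum T (j - (i + 1)) *
          ∑ c, T c ^ (i + 1 + 1)‖ ≤ a j * S / 2 := by
        calc _ ≤ ∑ i ∈ range j, a j * S / 2 * (1 / 2) ^ (i + 1) :=
              (norm_sum_le _ _).trans (sum_le_sum hterm)
          _ = a j * S / 2 * ∑ i ∈ range j, (1 / 2 : ℝ) ^ (i + 1) := by rw [mul_sum]
          _ ≤ a j * S / 2 * 1 := by
              have := ha0 j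
              gcongr
          _ = _ := by ring
      have hmain : a j * S ≤ ((j : ℝ) + 1) * a (j + 1) + a j * S / 2 := by
        have e1 : elemSum T j * ∑ c, T c = ((j + 1 : ℕ) : ℂ) * elemSum T (j + 1) -
            ∑ i ∈ range j, (-1 : ℂ) ^ (i + 1) * elemSum T (j - (i + 1)) *
              ∑ c, T c ^ (i + 1 + 1) := by
          rw [hN]; ring
        calc a j * S = ‖elemSum T j * ∑ c, T c‖ := by rw [norm_mul]
          _ ≤ _ := by
            rw [e1]
            refine (norm_sub_le _ _).trans ?_
            refine add_le_add ?_ hrest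
            rw [norm_mul, Complex.norm_natCast]
            push_cast
            exact le_refl _
      linarith
  have hfin : ∀ j, j ≤ k → S ^ j ≤ 2 ^ j * j.factorial * a j := by
    intro j
    induction j with
    | zero => intro _; simp [ha, elemSum_zero]
    | succ j ih =>
      intro hj
      have h1 := ih (by omega)
      have h2 := key j (by omega)
      calc S ^ (j + 1) = S ^ j * S := pow_succ _ _
        _ ≤ 2 ^ j * j.factorial * a j * S := by gcongr
        _ = 2 ^ j * j.factorial * (a j * S) := by ring
        _ ≤ 2 ^ j * j.factorial * (2 * (j + 1) * a (j + 1)) := by gcongr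
        _ = _ := by rw [Nat.factorial_succ]; push_cast; ring
  exact hfin k le_rfl

end PowerSums

namespace PowerSums

open Finset

lemma exists_index_eq_of_power_sums {k p : ℕ} (hp : p.Prime) (hkp : k < p) (S : Finset ℤ)
    (hS : ∀ x ∈ S, ∀ y ∈ S, (p : ℤ) ^ k ∣ x - y → x = y) (c : ℤ) (x y : Fin k → ℤ)
    (hx : ∀ i, x i ∈ S) (hy : ∀ i, y i ∈ S)
    (hinj : Function.Injective fun i => ((x i : ℤ) : ZMod p))
    (h : ∀ j, 1 ≤ j → j ≤ k → (p : ℤ) ^ k ∣ ∑ i, (x i - c) ^ j - ∑ i, (y i - c) ^ j)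
    (i' : Fin k) : ∃ i, x i = y i' := by
  have hk : 1 ≤ k := by have := i'.2; omega
  have hz : ∏ i, (((y i' - c : ℤ) : ZMod (p ^ k)) - ((x i - c : ℤ) : ZMod (p ^ k))) = 0 := by
    rw [prod_sub_eq_of_power_sums_eq (fun i => ((x i - c : ℤ) : ZMod (p ^ k)))
      (fun i => ((y i - c : ℤ) : ZMod (p ^ k)))]
    · exact prod_eq_zero (mem_univ i') (by simp)
    · intro j h1 h2
      rw [ZMod.isUnit_iff_coprime]
      apply Nat.Coprime.pow_right
      exact (Nat.coprime_of_lt_prime (by omega) (by omega) hp).symm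
    · intro j h1 h2
      have h3 := (ZMod.intCast_zmod_eq_zero_iff_dvd _ (p ^ k)).2
        (by push_cast; exact h j h1 h2 : ((p ^ k : ℕ) : ℤ) ∣
          ∑ i, (x i - c) ^ j - ∑ i, (y i - c) ^ j)
      push_cast at h3
      push_cast
      exact sub_eq_zero.1 h3
  have hdvd : (p : ℤ) ^ k ∣ ∏ i, (y i' - x i) := by
    have h4 := (ZMod.intCast_zmod_eq_zero_iff_dvd (∏ i, (y i' - x i)) (p ^ k)).1 (by
      rw [← hz]; push_cast
      exact prod_congr rfl fun i _ => by ring)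
    exact_mod_cast h4
  have hpZ : Prime (p : ℤ) := Nat.prime_iff_prime_int.1 hp
  obtain ⟨i, -, hi⟩ := (hpZ.dvd_finsetProd_iff _).1 ((dvd_pow_self (p : ℤ) (by omega)).trans hdvd)
  refine ⟨i, ?_⟩
  have hcop : IsCoprime ((p : ℤ) ^ k) (∏ l ∈ univ.erase i, (y i' - x l)) := by
    apply IsCoprime.pow_left
    apply IsCoprime.prod_right
    intro l hl
    rw [Prime.coprime_iff_not_dvd hpZ]
    intro hd
    apply (mem_erase.1 hl).1
    apply hinj
    have h5 : (p : ℤ) ∣ x i - x l := by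
      have := dvd_sub hd hi
      simpa using this
    have h6 := (ZMod.intCast_zmod_eq_zero_iff_dvd _ p).2 h5
    push_cast at h6
    exact (sub_eq_zero.1 h6).symm
  rw [← mul_prod_erase univ _ (mem_univ i)] at hdvd
  exact (hS _ (hy i') _ (hx i) (hcop.dvd_of_dvd_mul_right hdvd)).symm

/-- Linnik's lemma: the number of tuples with distinct residues modulo `p` and prescribed power
sums modulo `p, p ^ 2, …, p ^ k`. -/
lemma card_prescribed_power_sums_le {k p : ℕ} (hp : p.Prime) (hkp : k < p) (S : Finset ℤ)
    (hS : ∀ x ∈ S, ∀ y ∈ S, (p : ℤ) ^ k ∣ x - y → x = y) (c : ℤ) (h : ℕ → ℤ) :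
    ((Fintype.piFinset fun _ : Fin k => S).filter fun x =>
      (Function.Injective fun i => ((x i : ℤ) : ZMod p)) ∧
        ∀ j, 1 ≤ j → j ≤ k → (p : ℤ) ^ j ∣ ∑ i, (x i - c) ^ j - h j).card
      ≤ k.factorial * p ^ (k * (k - 1) / 2) := by
  classical
  have hp0 : 0 < p := hp.pos
  set t : Finset (Fin k → ℕ) := Fintype.piFinset fun j : Fin k => range (p ^ (k - 1 - (j : ℕ)))
    with ht
  have htc : t.card = p ^ (k * (k - 1) / 2) := by
    rw [ht, Fintype.card_piFinset]
    simp only [card_range]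
    rw [prod_pow_eq_pow_sum, Fin.sum_univ_eq_sum_range (fun j => k - 1 - j) k,
      sum_range_reflect (fun j => j) k, sum_range_id]
  rw [← htc]
  set f : (Fin k → ℤ) → (Fin k → ℕ) := fun x j =>
    (((∑ i, (x i - c) ^ ((j : ℕ) + 1) - h (j + 1)) / (p : ℤ) ^ ((j : ℕ) + 1)) %
      (p : ℤ) ^ (k - 1 - (j : ℕ))).toNat with hf
  refine card_le_mul_card_image_of_maps_to (f := f) ?_ _ ?_
  · intro x _
    rw [ht, Fintype.mem_piFinset]
    intro j
    rw [mem_range, hf]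
    have h1 : (0 : ℤ) < (p : ℤ) ^ (k - 1 - (j : ℕ)) := by positivity
    have h2 := Int.emod_lt_of_pos ((∑ i, (x i - c) ^ ((j : ℕ) + 1) - h (j + 1)) /
      (p : ℤ) ^ ((j : ℕ) + 1)) h1
    zify
    rw [Int.toNat_of_nonneg (Int.emod_nonneg _ h1.ne')]
    exact h2
  · intro b _
    set F := (((Fintype.piFinset fun _ : Fin k => S).filter fun x =>
      (Function.Injective fun i => ((x i : ℤ) : ZMod p)) ∧
        ∀ j, 1 ≤ j → j ≤ k → (p : ℤ) ^ j ∣ ∑ i, (x i - c) ^ j - h j).filter fun x => f x = b)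
      with hF
    rcases F.eq_empty_or_nonempty with he | ⟨y, hy⟩
    · rw [he]; simp
    have hsub : F ⊆ (univ : Finset (Equiv.Perm (Fin k))).image fun σ => fun i => y (σ i) := by
      intro x hx
      rw [hF] at hx hy
      simp only [mem_filter, Fintype.mem_piFinset] at hx hy
      obtain ⟨⟨hxS, hxinj, hxd⟩, hxf⟩ := hx
      obtain ⟨⟨hyS, hyinj, hyd⟩, hyf⟩ := hy
      have hcong : ∀ j, 1 ≤ j → j ≤ k →
          (p : ℤ) ^ k ∣ ∑ i, (x i - c) ^ j - ∑ i, (y i - c) ^ j := by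
        intro j h1 h2
        obtain ⟨u, hu⟩ := hxd j h1 h2
        obtain ⟨v, hv⟩ := hyd j h1 h2
        have hjk : j - 1 < k := by omega
        have hfe := congrFun (hxf.trans hyf.symm) ⟨j - 1, hjk⟩
        simp only [hf] at hfe
        have hj1 : j - 1 + 1 = j := by omega
        have hpj : (p : ℤ) ^ j ≠ 0 := by positivity
        have hpk : (0 : ℤ) < (p : ℤ) ^ (k - 1 - (j - 1)) := by positivity
        rw [hj1, hu, hv, Int.mul_ediv_cancel_left _ hpj, Int.mul_ediv_cancel_left _ hpj] at hfe
        have hfe' : u % (p : ℤ) ^ (k - 1 - (j - 1)) = v % (p : ℤ) ^ (k - 1 - (j - 1)) := by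
          have h3 := Int.emod_nonneg u hpk.ne'
          have h4 := Int.emod_nonneg v hpk.ne'
          omega
        have hd := Int.ModEq.dvd (Int.ModEq.symm hfe')
        have e1 : ∑ i, (x i - c) ^ j - ∑ i, (y i - c) ^ j = (p : ℤ) ^ j * (u - v) := by
          rw [mul_sub, ← hu, ← hv]; ring
        have e2 : (p : ℤ) ^ k = (p : ℤ) ^ j * (p : ℤ) ^ (k - 1 - (j - 1)) := by
          rw [← pow_add]; congr 1; omega
        rw [e1, e2]
        exact mul_dvd_mul_left _ hd
      choose g hg using exists_index_eq_of_power_sums hp hkp S hS c x y hxS hyS hxinj hcong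
      have hginj : Function.Injective g := by
        intro a b hab
        apply hyinj
        simp only
        rw [← hg a, ← hg b, hab]
      have hgb : Function.Bijective g := Finite.injective_iff_bijective.1 hginj
      rw [mem_image]
      refine ⟨(Equiv.ofBijective g hgb).symm, mem_univ _, ?_⟩
      funext i
      rw [← hg]
      congr 1
      exact (Equiv.ofBijective g hgb).apply_symm_apply i
    calc F.card ≤ _ := card_le_card hsub
      _ ≤ _ := card_image_le
      _ = k.factorial := by rw [card_univ, Fintype.card_perm, Fintype.card_fin]

end PowerSums

namespace PowerSums

open Finset Filter

section Energy

variable {ι H : Type*} [DecidableEq H]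

/-- The number of pairs of indices on which `φ` takes the same value. -/
def energy (φ : ι → H) (I : Finset ι) : ℕ :=
  ((I ×ˢ I).filter fun q => φ q.1 = φ q.2).card

lemma energy_eq_sum_sq (φ : ι → H) (I : Finset ι) :
    energy φ I = ∑ v ∈ I.image φ, (I.filter fun i => φ i = v).card ^ 2 := by
  classical
  rw [energy, card_eq_sum_card_fiberwise (f := fun q : ι × ι => φ q.1) (t := I.image φ)]
  · refine sum_congr rfl fun v _ => ?_
    rw [sq, ← card_product]
    congr 1
    ext q
    simp only [mem_filter, mem_product]
    constructor
    · rintro ⟨⟨⟨h1, h2⟩, h3⟩, h4⟩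
      exact ⟨⟨h1, h4⟩, h2, by rw [← h3, h4]⟩
    · rintro ⟨⟨h1, h4⟩, h2, h3⟩
      exact ⟨⟨⟨h1, h2⟩, by rw [h3, h4]⟩, h4⟩
  · intro q hq
    have := (mem_product.1 (mem_filter.1 hq).1).1
    exact mem_coe.2 (mem_image_of_mem φ this)

lemma card_sub_eq_le_energy [AddCommGroup H] (φ : ι → H) (I : Finset ι) (w : H) :
    ((I ×ˢ I).filter fun q => φ q.1 - φ q.2 = w).card ≤ energy φ I := by
  classical
  set n : H → ℕ := fun v => (I.filter fun i => φ i = v).card with hn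
  have h1 : ((I ×ˢ I).filter fun q => φ q.1 - φ q.2 = w).card
      = ∑ v ∈ I.image φ, n v * n (v - w) := by
    rw [card_eq_sum_card_fiberwise (f := fun q : ι × ι => φ q.1) (t := I.image φ)]
    · refine sum_congr rfl fun v _ => ?_
      rw [hn, ← card_product]
      congr 1
      ext q
      simp only [mem_filter, mem_product]
      constructor
      · rintro ⟨⟨⟨h1, h2⟩, h3⟩, h4⟩
        exact ⟨⟨h1, h4⟩, h2, by rw [← h3, h4]; abel⟩
      · rintro ⟨⟨h1, h4⟩, h2, h3⟩
        exact ⟨⟨⟨h1, h2⟩, by rw [h3, h4]; abel⟩, h4⟩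
    · intro q hq
      have := (mem_product.1 (mem_filter.1 hq).1).1
      exact mem_coe.2 (mem_image_of_mem φ this)
  have h2 : ∑ v ∈ I.image φ, n (v - w) ^ 2 ≤ ∑ v ∈ I.image φ, n v ^ 2 := by
    have e : ∑ v ∈ I.image φ, n (v - w) ^ 2
        = ∑ u ∈ (I.image φ).image (fun v => v - w), n u ^ 2 := by
      refine (sum_image (f := fun u => n u ^ 2) (g := fun v => v - w) ?_).symm
      intro a _ b _ hab
      simpa using hab
    rw [e]
    calc ∑ u ∈ (I.image φ).image (fun v => v - w), n u ^ 2
        ≤ ∑ u ∈ (I.image φ).image (fun v => v - w) ∪ I.image φ, n u ^ 2 :=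
          sum_le_sum_of_subset subset_union_left
      _ = ∑ u ∈ I.image φ, n u ^ 2 := by
          symm
          apply sum_subset subset_union_right
          intro u _ hu
          have : (I.filter fun i => φ i = u) = ∅ := by
            rw [filter_eq_empty_iff]
            intro i hi he
            exact hu (he ▸ mem_image_of_mem φ hi)
          simp [hn, this]
  rw [h1, energy_eq_sum_sq]
  have h3 : ∑ v ∈ I.image φ, 2 * (n v * n (v - w))
      ≤ ∑ v ∈ I.image φ, (n v ^ 2 + n (v - w) ^ 2) := by
    refine sum_le_sum fun v _ => ?_
    have := two_mul_le_add_sq (n v) (n (v - w))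
    linarith
  rw [sum_add_distrib, ← mul_sum] at h3
  change ∑ v ∈ I.image φ, n v * n (v - w) ≤ ∑ v ∈ I.image φ, n v ^ 2
  omega

end Energy

section Characters

variable {k : ℕ}

/-- The value at an integer vector of a character of `(ℤ / (M + 1)) ^ k`. -/
noncomputable def charVal {M : ℕ} (ψ : AddChar (Fin k → ZMod (M + 1)) ℂ) (v : Fin k → ℤ) : ℂ :=
  ψ fun j => (v j : ZMod (M + 1))

variable {M : ℕ} (ψ : AddChar (Fin k → ZMod (M + 1)) ℂ)

lemma charVal_add (v w : Fin k → ℤ) : charVal ψ (v + w) = charVal ψ v * charVal ψ w := by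
  rw [charVal, charVal, charVal, ← AddChar.map_add_eq_mul]
  congr 1
  ext j
  simp

lemma charVal_zero : charVal ψ 0 = 1 := by
  rw [charVal, ← AddChar.map_zero_eq_one ψ]
  congr 1

lemma charVal_sum {ι : Type*} (I : Finset ι) (f : ι → Fin k → ℤ) :
    charVal ψ (∑ i ∈ I, f i) = ∏ i ∈ I, charVal ψ (f i) := by
  classical
  induction I using Finset.induction_on with
  | empty => simp [charVal_zero]
  | insert a I ha ih => rw [sum_insert ha, prod_insert ha, charVal_add, ih]

lemma norm_charVal (v : Fin k → ℤ) : ‖charVal ψ v‖ = 1 := AddChar.norm_apply ψ _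

lemma eventually_intCast_injOn {ι : Type*} (I : Finset ι) (φ : ι → Fin k → ℤ) :
    ∀ᶠ M : ℕ in atTop, ∀ i ∈ I, ∀ i' ∈ I,
      (∀ j, (φ i j : ZMod (M + 1)) = φ i' j) → φ i = φ i' := by
  rw [Filter.eventually_all_finset]
  intro i _
  rw [Filter.eventually_all_finset]
  intro i' _
  have h : ∀ j : Fin k, ∀ᶠ M : ℕ in atTop,
      (φ i j : ZMod (M + 1)) = φ i' j → φ i j = φ i' j := by
    intro j
    filter_upwards [eventually_ge_atTop (φ i j - φ i' j).natAbs] with M hM he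
    have h1 : ((φ i j - φ i' j : ℤ) : ZMod (M + 1)) = 0 := by
      push_cast; rw [he, sub_self]
    have h2 := (ZMod.intCast_zmod_eq_zero_iff_dvd _ (M + 1)).1 h1
    have h3 := Int.eq_zero_of_abs_lt_dvd h2 (by
      rw [Int.abs_eq_natAbs]; exact_mod_cast Nat.lt_succ_of_le hM)
    omega
  filter_upwards [Filter.eventually_all.2 h] with M hM hall
  ext j
  exact hM j (hall j)

lemma eventually_sum_norm_sq {ι : Type*} (I : Finset ι) (φ : ι → Fin k → ℤ) :
    ∀ᶠ M : ℕ in atTop,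
      ∑ ψ : AddChar (Fin k → ZMod (M + 1)) ℂ, ‖∑ i ∈ I, charVal ψ (φ i)‖ ^ 2
        = ((M : ℝ) + 1) ^ k * energy φ I := by
  classical
  filter_upwards [eventually_intCast_injOn I φ] with M hM
  have h : ∀ ψ : AddChar (Fin k → ZMod (M + 1)) ℂ,
      ((‖∑ i ∈ I, charVal ψ (φ i)‖ ^ 2 : ℝ) : ℂ)
        = ∑ q ∈ I ×ˢ I, charVal ψ (φ q.1 - φ q.2) := by
    intro ψ
    push_cast
    rw [← Complex.mul_conj', map_sum, sum_mul_sum, sum_product]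
    refine sum_congr rfl fun i _ => sum_congr rfl fun i' _ => ?_
    rw [sub_eq_add_neg, charVal_add]
    congr 1
    rw [charVal, charVal, ← AddChar.map_neg_eq_conj]
    congr 1
    ext j
    simp
  have h2 : ((∑ ψ : AddChar (Fin k → ZMod (M + 1)) ℂ,
      ‖∑ i ∈ I, charVal ψ (φ i)‖ ^ 2 : ℝ) : ℂ) = ((((M : ℝ) + 1) ^ k * energy φ I : ℝ) : ℂ) := by
    rw [Complex.ofReal_sum, sum_congr rfl fun ψ _ => h ψ, sum_comm]
    simp only [charVal]
    simp_rw [AddChar.sum_apply_eq_ite]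
    rw [← sum_filter, sum_const, nsmul_eq_mul, mul_comm, energy]
    push_cast
    congr 1
    · simp [ZMod.card]
    · congr 2
      refine filter_congr fun q hq => ?_
      obtain ⟨h1, h2⟩ := mem_product.1 hq
      constructor
      · intro he
        apply hM _ h1 _ h2
        intro j
        have := congrFun he j
        simpa [sub_eq_zero] using this
      · intro he
        ext j
        simp [he]
  exact_mod_cast h2

end Characters

/-- The vector of powers `(x, x ^ 2, …, x ^ k)`. -/
def powVec (k : ℕ) (x : ℤ) : Fin k → ℤ := fun j => x ^ ((j : ℕ) + 1)

/-- The vector of power sums of a tuple. -/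
def tupleSum (k : ℕ) {s : ℕ} (x : Fin s → ℤ) : Fin k → ℤ := ∑ i, powVec k (x i)

/-- The tuples with entries in a set. -/
def tuples (s : ℕ) (S : Finset ℤ) : Finset (Fin s → ℤ) := Fintype.piFinset fun _ => S

lemma mem_tuples {s : ℕ} {S : Finset ℤ} {x : Fin s → ℤ} : x ∈ tuples s S ↔ ∀ i, x i ∈ S :=
  Fintype.mem_piFinset

lemma card_tuples (s : ℕ) (S : Finset ℤ) : (tuples s S).card = S.card ^ s := by
  simp [tuples]

/-- Number of solutions of the Vinogradov system with variables in `S`. -/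
def meanValue (s k : ℕ) (S : Finset ℤ) : ℕ := energy (tupleSum k (s := s)) (tuples s S)

lemma tupleSum_apply (k : ℕ) {s : ℕ} (x : Fin s → ℤ) (j : Fin k) :
    tupleSum k x j = ∑ i, x i ^ ((j : ℕ) + 1) := by
  simp [tupleSum, powVec]

lemma sum_sub_pow_eq {ι : Type*} [Fintype ι] {k : ℕ} (x y : ι → ℤ)
    (h : ∀ j, 1 ≤ j → j ≤ k → ∑ i, x i ^ j = ∑ i, y i ^ j) (c : ℤ) (j : ℕ) (hj : j ≤ k) :
    ∑ i, (x i - c) ^ j = ∑ i, (y i - c) ^ j := by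
  simp_rw [sub_eq_add_neg, add_pow]
  rw [sum_comm, sum_comm (s := univ)]
  refine sum_congr rfl fun l hl => ?_
  have hl' := mem_range.1 hl
  simp_rw [← sum_mul]
  rcases Nat.eq_zero_or_pos l with rfl | hl0
  · simp
  · rw [h l hl0 (by omega)]

lemma tupleSum_eq_iff {k s : ℕ} (x y : Fin s → ℤ) :
    tupleSum k x = tupleSum k y ↔ ∀ j, 1 ≤ j → j ≤ k → ∑ i, x i ^ j = ∑ i, y i ^ j := by
  constructor
  · intro h j h1 h2
    have := congrFun h ⟨j - 1, by omega⟩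
    simp only [tupleSum_apply] at this
    rwa [Nat.sub_add_cancel h1] at this
  · intro h
    ext j
    rw [tupleSum_apply, tupleSum_apply]
    exact h _ (by omega) (by have := j.2; omega)

lemma meanValue_le_of_affine {s k : ℕ} {S S' : Finset ℤ} (c p : ℤ) (hp : p ≠ 0)
    (h : ∀ x ∈ S, ∃ t ∈ S', x = c + p * t) : meanValue s k S ≤ meanValue s k S' := by
  classical
  choose! g hg1 hg2 using h
  unfold meanValue energy
  refine card_le_card_of_injOn (fun q => (fun i => g (q.1 i), fun i => g (q.2 i))) ?_ ?_
  · rintro ⟨x, y⟩ hq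
    simp only [coe_filter, mem_product, Set.mem_ofPred_eq, mem_tuples] at hq ⊢
    obtain ⟨⟨hx, hy⟩, he⟩ := hq
    refine ⟨⟨fun i => hg1 _ (hx i), fun i => hg1 _ (hy i)⟩, ?_⟩
    rw [tupleSum_eq_iff] at he ⊢
    intro j h1 h2
    have h3 := sum_sub_pow_eq x y he c j h2
    have e : ∀ z ∈ S, (z - c) ^ j = p ^ j * g z ^ j := by
      intro z hz
      rw [← mul_pow]
      congr 1
      have := hg2 z hz
      linarith
    rw [sum_congr rfl fun i _ => e _ (hx i), sum_congr rfl fun i _ => e _ (hy i), ← mul_sum,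
      ← mul_sum] at h3
    exact mul_left_cancel₀ (pow_ne_zero j hp) h3
  · rintro ⟨x, y⟩ hq ⟨x', y'⟩ hq' he
    simp only [coe_filter, mem_product, Set.mem_ofPred_eq, mem_tuples] at hq hq'
    simp only [Prod.mk.injEq] at he ⊢
    constructor
    · ext i
      rw [hg2 _ (hq.1.1 i), hg2 _ (hq'.1.1 i), congrFun he.1 i]
    · ext i
      rw [hg2 _ (hq.1.2 i), hg2 _ (hq'.1.2 i), congrFun he.2 i]

lemma meanValue_le_card_pow (s k : ℕ) (S : Finset ℤ) : meanValue s k S ≤ S.card ^ (2 * s) := by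
  unfold meanValue energy
  refine (card_filter_le _ _).trans ?_
  rw [card_product, card_tuples, ← pow_add]
  apply le_of_eq
  congr 1
  omega

end PowerSums

namespace PowerSums

open Finset Filter

/-- The exponential sum over powers of elements of `S`. -/
noncomputable def powCharSum {k M : ℕ} (ψ : AddChar (Fin k → ZMod (M + 1)) ℂ) (S : Finset ℤ) : ℂ :=
  ∑ x ∈ S, charVal ψ (powVec k x)

lemma powCharSum_pow {k M : ℕ} (ψ : AddChar (Fin k → ZMod (M + 1)) ℂ) (S : Finset ℤ) (s : ℕ) :
    powCharSum ψ S ^ s = ∑ x ∈ tuples s S, charVal ψ (tupleSum k x) := by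
  rw [powCharSum, Finset.sum_pow', tuples]
  refine sum_congr rfl fun x _ => ?_
  rw [tupleSum, charVal_sum]

lemma norm_powCharSum_le {k M : ℕ} (ψ : AddChar (Fin k → ZMod (M + 1)) ℂ) (S : Finset ℤ) :
    ‖powCharSum ψ S‖ ≤ S.card := by
  refine (norm_sum_le _ _).trans ?_
  simp [norm_charVal]

lemma eventually_moment (k s : ℕ) (S : Finset ℤ) :
    ∀ᶠ M : ℕ in atTop,
      ∑ ψ : AddChar (Fin k → ZMod (M + 1)) ℂ, ‖powCharSum ψ S‖ ^ (2 * s)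
        = ((M : ℝ) + 1) ^ k * meanValue s k S := by
  filter_upwards [eventually_sum_norm_sq (tuples s S) (tupleSum k (s := s))] with M hM
  rw [meanValue, ← hM]
  refine sum_congr rfl fun ψ _ => ?_
  rw [← powCharSum_pow, norm_pow, ← pow_mul, mul_comm]

/-- Tuples with distinct residues modulo `p`. -/
def distinctTuples (k p : ℕ) (S : Finset ℤ) : Finset (Fin k → ℤ) :=
  (tuples k S).filter fun x => ∀ i i', ((x i : ℤ) : ZMod p) = (x i' : ℤ) → i = i'

lemma sum_distinctTuples {k p M : ℕ} [NeZero p] (ψ : AddChar (Fin k → ZMod (M + 1)) ℂ)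
    (S : Finset ℤ) :
    ∑ x ∈ distinctTuples k p S, charVal ψ (tupleSum k x) = (k.factorial : ℂ) *
      elemSum (fun c : ZMod p => powCharSum ψ (S.filter fun x => (x : ZMod p) = c)) k := by
  classical
  rw [← sum_injective_prod]
  have hm : ∀ x ∈ distinctTuples k p S, (fun i => ((x i : ℤ) : ZMod p)) ∈
      univ.filter fun c : Fin k → ZMod p => Function.Injective c := by
    intro x hx
    simp only [mem_filter, mem_univ, true_and]
    intro i i' h
    exact (mem_filter.1 hx).2 i i' h
  rw [← sum_fiberwise_of_maps_to hm]
  refine sum_congr rfl fun c hc => ?_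
  simp only [powCharSum]
  rw [prod_univ_sum]
  refine sum_congr ?_ fun x _ => ?_
  · ext x
    simp only [distinctTuples, mem_filter, mem_tuples, Fintype.mem_piFinset]
    constructor
    · rintro ⟨⟨h1, -⟩, h3⟩ i
      exact ⟨h1 i, congrFun h3 i⟩
    · intro h
      have h3 : (fun i => ((x i : ℤ) : ZMod p)) = c := funext fun i => (h i).2
      refine ⟨⟨fun i => (h i).1, ?_⟩, h3⟩
      intro i i' hii
      apply (mem_filter.1 hc).2
      rw [← (h i).2, ← (h i').2, hii]
  · rw [tupleSum, charVal_sum]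

lemma mixed_energy_le {k p s : ℕ} (hp : p.Prime) (hkp : k < p) (S : Finset ℤ)
    (hS : ∀ x ∈ S, ∀ y ∈ S, (p : ℤ) ^ k ∣ x - y → x = y) (c : ℤ) (Sc : Finset ℤ)
    (hSc : ∀ x ∈ Sc, (p : ℤ) ∣ x - c) :
    energy (fun q : (Fin k → ℤ) × (Fin s → ℤ) => tupleSum k q.1 + tupleSum k q.2)
      (distinctTuples k p S ×ˢ tuples s Sc)
      ≤ meanValue s k Sc * (k.factorial * p ^ (k * (k - 1) / 2) * S.card ^ k) := by
  classical
  set D := distinctTuples k p S with hD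
  set t : Finset ((Fin k → ℤ) × (Fin k → ℤ)) := (D ×ˢ D).filter fun q =>
    ∀ j, 1 ≤ j → j ≤ k → (p : ℤ) ^ j ∣ ∑ i, (q.2 i - c) ^ j - ∑ i, (q.1 i - c) ^ j with ht
  have htc : t.card ≤ k.factorial * p ^ (k * (k - 1) / 2) * S.card ^ k := by
    have h1 : t.card ≤ k.factorial * p ^ (k * (k - 1) / 2) * D.card := by
      refine card_le_mul_card_image_of_maps_to (f := Prod.fst) ?_ _ ?_
      · intro q hq
        exact (mem_product.1 (mem_filter.1 hq).1).1
      · intro x _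
        refine le_trans ?_ (card_prescribed_power_sums_le hp hkp S hS c
          fun j => ∑ i, (x i - c) ^ j)
        refine card_le_card_of_injOn Prod.snd ?_ ?_
        · intro q hq
          simp only [ht, hD, coe_filter, mem_filter, mem_product, Set.mem_ofPred_eq,
            distinctTuples, mem_tuples, Fintype.mem_piFinset] at hq ⊢
          obtain ⟨⟨⟨-, h2⟩, h3⟩, rfl⟩ := hq
          exact ⟨h2.1, fun i i' h => h2.2 i i' h, h3⟩
        · intro q hq q' hq' h
          have h1 := (mem_filter.1 hq).2
          have h2 := (mem_filter.1 hq').2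
          exact Prod.ext (h1.trans h2.symm) h
    refine h1.trans (Nat.mul_le_mul_left _ ?_)
    rw [hD, distinctTuples, ← card_tuples]
    exact card_filter_le _ _
  refine le_trans ?_ (Nat.mul_le_mul_left _ htc)
  unfold energy
  refine card_le_mul_card_image_of_maps_to (f := fun q => (q.1.1, q.2.1)) ?_ _ ?_
  · rintro ⟨⟨x, z⟩, ⟨x', z'⟩⟩ hq
    simp only [mem_filter, mem_product, mem_tuples] at hq
    obtain ⟨⟨⟨hx, hz⟩, hx', hz'⟩, he⟩ := hq
    simp only [ht, mem_filter, mem_product]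
    refine ⟨⟨hx, hx'⟩, fun j h1 h2 => ?_⟩
    have h3 := sum_sub_pow_eq (k := k) (Sum.elim x z) (Sum.elim x' z') (by
      intro j h1 h2
      have := congrFun he ⟨j - 1, by omega⟩
      simp only [Pi.add_apply, tupleSum_apply, Nat.sub_add_cancel h1] at this
      simpa using this) c j h2
    simp only [Fintype.sum_sum_type, Sum.elim_inl, Sum.elim_inr] at h3
    have h4 : ∀ y : Fin s → ℤ, (∀ i, y i ∈ Sc) → (p : ℤ) ^ j ∣ ∑ i, (y i - c) ^ j :=
      fun y hy => dvd_sum fun i _ => pow_dvd_pow_of_dvd (hSc _ (hy i)) j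
    have h5 : ∑ i, (x' i - c) ^ j - ∑ i, (x i - c) ^ j
        = ∑ i, (z i - c) ^ j - ∑ i, (z' i - c) ^ j := by linarith
    rw [h5]
    exact dvd_sub (h4 z hz) (h4 z' hz')
  · rintro ⟨x, x'⟩ _
    refine le_trans ?_ (card_sub_eq_le_energy (tupleSum k (s := s)) (tuples s Sc)
      (tupleSum k x' - tupleSum k x))
    refine card_le_card_of_injOn (fun q => (q.1.2, q.2.2)) ?_ ?_
    · rintro ⟨⟨y, z⟩, ⟨y', z'⟩⟩ hq
      simp only [coe_filter, mem_filter, mem_product, Set.mem_ofPred_eq, Prod.mk.injEq] at hq ⊢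
      obtain ⟨⟨⟨⟨_, h1⟩, _, h2⟩, h3⟩, rfl, rfl⟩ := hq
      refine ⟨⟨h1, h2⟩, ?_⟩
      rw [sub_eq_sub_iff_add_eq_add, add_comm, h3, add_comm]
    · rintro ⟨⟨y, z⟩, ⟨y', z'⟩⟩ hq ⟨⟨w, u⟩, ⟨w', u'⟩⟩ hq' h
      simp only [coe_filter, mem_filter, Set.mem_ofPred_eq, Prod.mk.injEq] at hq hq' h ⊢
      obtain ⟨-, rfl, rfl⟩ := hq
      obtain ⟨-, rfl, rfl⟩ := hq'
      exact ⟨⟨rfl, h.1⟩, rfl, h.2⟩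

lemma sum_pow_le_card_mul {σ : Type*} [Fintype σ] (f : σ → ℝ) (hf : ∀ c, 0 ≤ f c) (n : ℕ)
    (hn : 1 ≤ n) :
    (∑ c, f c) ^ n ≤ (Fintype.card σ : ℝ) ^ (n - 1) * ∑ c, f c ^ n := by
  obtain ⟨m, rfl⟩ : ∃ m, n = m + 1 := ⟨n - 1, by omega⟩
  rcases Nat.eq_zero_or_pos (Fintype.card σ) with h0 | h0
  · have := Fintype.card_eq_zero_iff.1 h0
    simp
  have h := pow_sum_div_card_le_sum_pow (s := (univ : Finset σ)) (fun c _ => hf c) m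
  rw [div_le_iff₀ (by rw [card_univ]; positivity), card_univ] at h
  simpa [mul_comm] using h

/-- The `p`-adic recursion for Vinogradov's mean value. -/
lemma meanValue_recursion {k p s X Y : ℕ} (hk : 1 ≤ k) (hs : 1 ≤ s) (hp : p.Prime) (hkp : k < p)
    (hX : X ≤ p ^ k) (hXY : X ≤ p * Y) :
    meanValue (s + k) k (Ico 0 (X : ℤ)) ≤
      (4 ^ k * k.factorial * p ^ (2 * s) * p ^ (k * (k - 1) / 2) * X ^ k
        + (4 * k) ^ (2 * (s + k)) * p ^ (s + k) * Y ^ (2 * k)) *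
        meanValue s k (Ico 0 (Y : ℤ)) := by
  classical
  have : NeZero p := ⟨hp.ne_zero⟩
  set S : Finset ℤ := Ico 0 (X : ℤ) with hSdef
  set W : ZMod p → Finset ℤ := fun c => S.filter fun x => (x : ZMod p) = c with hW
  set J := meanValue s k (Ico 0 (Y : ℤ)) with hJ
  have hp0 : (0 : ℤ) < p := by exact_mod_cast hp.pos
  have hScard : S.card = X := by simp [hSdef]
  have hSinj : ∀ x ∈ S, ∀ y ∈ S, (p : ℤ) ^ k ∣ x - y → x = y := by
    intro x hx y hy hd
    have hx' := mem_Ico.1 hx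
    have hy' := mem_Ico.1 hy
    have hX' : (X : ℤ) ≤ (p : ℤ) ^ k := by exact_mod_cast hX
    have := Int.eq_zero_of_abs_lt_dvd hd (by rw [abs_lt]; constructor <;> linarith)
    omega
  have hWdvd : ∀ c, ∀ x ∈ W c, (p : ℤ) ∣ x - (c.val : ℤ) := by
    intro c x hx
    have := (mem_filter.1 hx).2
    rw [← ZMod.intCast_zmod_eq_zero_iff_dvd]
    push_cast
    rw [this, ZMod.natCast_zmod_val, sub_self]
  have hWaff : ∀ c, ∀ x ∈ W c, ∃ t ∈ Ico 0 (Y : ℤ), x = (c.val : ℤ) + p * t := by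
    intro c x hx
    obtain ⟨t, ht⟩ := hWdvd c x hx
    have hx' := mem_Ico.1 (mem_filter.1 hx).1
    have hc : (c.val : ℤ) < p := by exact_mod_cast ZMod.val_lt c
    have hc0 : (0 : ℤ) ≤ c.val := by positivity
    have hXY' : (X : ℤ) ≤ p * Y := by exact_mod_cast hXY
    refine ⟨t, mem_Ico.2 ⟨?_, ?_⟩, by linarith⟩
    · by_contra hneg
      push Not at hneg
      have : (p : ℤ) * t ≤ p * (-1) := by
        apply mul_le_mul_of_nonneg_left _ hp0.le
        omega
      linarith [hx'.1]
    · have : (p : ℤ) * t < p * Y := by linarith [hx'.2]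
      exact lt_of_mul_lt_mul_left this hp0.le
  have hWJ : ∀ c, meanValue s k (W c) ≤ J := fun c =>
    meanValue_le_of_affine _ _ hp0.ne' (hWaff c)
  have hWcard : ∀ c, (W c).card ≤ Y := by
    intro c
    have hsub : W c ⊆ (Ico 0 (Y : ℤ)).image fun t => (c.val : ℤ) + p * t := by
      intro x hx
      obtain ⟨t, ht, he⟩ := hWaff c x hx
      exact mem_image.2 ⟨t, ht, he.symm⟩
    refine (card_le_card hsub).trans (card_image_le.trans ?_)
    simp
  -- choose the modulus
  have hev := (eventually_moment k (s + k) S).and ((Filter.eventually_all.2 fun c : ZMod p =>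
    (eventually_moment k s (W c))).and (Filter.eventually_all.2 fun c : ZMod p =>
      eventually_sum_norm_sq (distinctTuples k p S ×ˢ tuples s (W c))
        (fun q : (Fin k → ℤ) × (Fin s → ℤ) => tupleSum k q.1 + tupleSum k q.2)))
  obtain ⟨M, hM1, hM2, hM3⟩ := hev.exists
  set G : ℝ := ((M : ℝ) + 1) ^ k with hG
  have hG0 : 0 < G := by positivity
  have hmixed : ∀ c, ∑ ψ : AddChar (Fin k → ZMod (M + 1)) ℂ,
      ‖∑ x ∈ distinctTuples k p S, charVal ψ (tupleSum k x)‖ ^ 2 * ‖powCharSum ψ (W c)‖ ^ (2 * s)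
      ≤ G * (J * (k.factorial * p ^ (k * (k - 1) / 2) * X ^ k)) := by
    intro c
    have h1 := hM3 c
    have h2 := mixed_energy_le (s := s) hp hkp S hSinj (c.val : ℤ) (W c) (hWdvd c)
    have h3 : (energy (fun q : (Fin k → ℤ) × (Fin s → ℤ) => tupleSum k q.1 + tupleSum k q.2)
      (distinctTuples k p S ×ˢ tuples s (W c)) : ℝ)
        ≤ J * (k.factorial * p ^ (k * (k - 1) / 2) * X ^ k) := by
      have := h2.trans (Nat.mul_le_mul_right _ (hWJ c))
      rw [hScard] at this
      exact_mod_cast this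
    calc _ = G * (energy (fun q : (Fin k → ℤ) × (Fin s → ℤ) => tupleSum k q.1 + tupleSum k q.2)
      (distinctTuples k p S ×ˢ tuples s (W c)) : ℝ) := by
          rw [← h1]
          refine sum_congr rfl fun ψ _ => ?_
          rw [mul_comm 2 s, pow_mul, ← mul_pow, ← norm_pow, ← norm_mul, powCharSum_pow,
            sum_mul_sum, sum_product]
          simp_rw [charVal_add]
      _ ≤ _ := by gcongr
  have hpoint : ∀ ψ : AddChar (Fin k → ZMod (M + 1)) ℂ, ‖powCharSum ψ S‖ ^ (2 * (s + k)) ≤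
      4 ^ k * (p : ℝ) ^ (2 * s - 1) * ∑ c,
        ‖∑ x ∈ distinctTuples k p S, charVal ψ (tupleSum k x)‖ ^ 2 *
          ‖powCharSum ψ (W c)‖ ^ (2 * s) +
      (4 * k) ^ (2 * (s + k)) * (p : ℝ) ^ (s + k - 1) * ∑ c,
        (Y : ℝ) ^ (2 * k) * ‖powCharSum ψ (W c)‖ ^ (2 * s) := by
    intro ψ
    have hsplit : powCharSum ψ S = ∑ c, powCharSum ψ (W c) := by
      simp only [powCharSum, hW]
      exact (sum_fiberwise S (fun x : ℤ => (x : ZMod p)) _).symm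
    have hcardp : Fintype.card (ZMod p) = p := ZMod.card p
    have hA0 : 0 ≤ 4 ^ k * (p : ℝ) ^ (2 * s - 1) * ∑ c,
        ‖∑ x ∈ distinctTuples k p S, charVal ψ (tupleSum k x)‖ ^ 2 *
          ‖powCharSum ψ (W c)‖ ^ (2 * s) :=
      mul_nonneg (by positivity) (sum_nonneg fun _ _ => by positivity)
    have hB0 : 0 ≤ (4 * k) ^ (2 * (s + k)) * (p : ℝ) ^ (s + k - 1) * ∑ c,
        (Y : ℝ) ^ (2 * k) * ‖powCharSum ψ (W c)‖ ^ (2 * s) :=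
      mul_nonneg (by positivity) (sum_nonneg fun _ _ => by positivity)
    rcases norm_sum_dichotomy (fun c : ZMod p => powCharSum ψ (W c)) k hk with h | h
    · refine le_trans ?_ (le_add_of_nonneg_left hA0)
      rw [hsplit]
      calc ‖∑ c, powCharSum ψ (W c)‖ ^ (2 * (s + k))
          = (‖∑ c, powCharSum ψ (W c)‖ ^ 2) ^ (s + k) := by rw [pow_mul]
        _ ≤ ((4 * k) ^ 2 * ∑ c, ‖powCharSum ψ (W c)‖ ^ 2) ^ (s + k) := by gcongr
        _ = (4 * k) ^ (2 * (s + k)) * (∑ c, ‖powCharSum ψ (W c)‖ ^ 2) ^ (s + k) := by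
            rw [mul_pow, ← pow_mul]
        _ ≤ (4 * k) ^ (2 * (s + k)) * ((p : ℝ) ^ (s + k - 1) *
              ∑ c, (‖powCharSum ψ (W c)‖ ^ 2) ^ (s + k)) := by
            gcongr
            have := sum_pow_le_card_mul (fun c : ZMod p => ‖powCharSum ψ (W c)‖ ^ 2)
              (fun _ => by positivity) (s + k) (by omega)
            rwa [hcardp] at this
        _ ≤ _ := by
            rw [← mul_assoc]
            gcongr with c
            rw [← pow_mul, mul_add, pow_add, mul_comm]
            gcongr
            exact (norm_powCharSum_le ψ _).trans (by exact_mod_cast hWcard c)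
    · refine le_trans ?_ (le_add_of_nonneg_right hB0)
      rw [hsplit]
      have h1 : ‖∑ c, powCharSum ψ (W c)‖ ^ (2 * k) ≤
          4 ^ k * ‖∑ x ∈ distinctTuples k p S, charVal ψ (tupleSum k x)‖ ^ 2 := by
        rw [sum_distinctTuples (p := p), norm_mul, Complex.norm_natCast]
        calc ‖∑ c, powCharSum ψ (W c)‖ ^ (2 * k) = (‖∑ c, powCharSum ψ (W c)‖ ^ k) ^ 2 := by
              rw [← pow_mul, mul_comm]
          _ ≤ (2 ^ k * k.factorial * ‖elemSum (fun c : ZMod p => powCharSum ψ (W c)) k‖) ^ 2 := by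
              gcongr
          _ = _ := by
              rw [mul_assoc, mul_pow, ← pow_mul, mul_comm k 2, pow_mul]
              norm_num [hW]
      have h2 : ‖∑ c, powCharSum ψ (W c)‖ ^ (2 * s) ≤
          (p : ℝ) ^ (2 * s - 1) * ∑ c, ‖powCharSum ψ (W c)‖ ^ (2 * s) := by
        have := sum_pow_le_card_mul (fun c : ZMod p => ‖powCharSum ψ (W c)‖)
              (fun _ => by positivity) (2 * s) (by omega)
        rw [hcardp] at this
        exact (pow_le_pow_left₀ (norm_nonneg _) (norm_sum_le _ _) _).trans this
      calc ‖∑ c, powCharSum ψ (W c)‖ ^ (2 * (s + k))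
          = ‖∑ c, powCharSum ψ (W c)‖ ^ (2 * k) * ‖∑ c, powCharSum ψ (W c)‖ ^ (2 * s) := by
            rw [← pow_add]; congr 1; ring
        _ ≤ (4 ^ k * ‖∑ x ∈ distinctTuples k p S, charVal ψ (tupleSum k x)‖ ^ 2) *
            ((p : ℝ) ^ (2 * s - 1) * ∑ c, ‖powCharSum ψ (W c)‖ ^ (2 * s)) := by gcongr
        _ = _ := by rw [← mul_sum]; ring
  have hsum : G * meanValue (s + k) k S ≤
      4 ^ k * (p : ℝ) ^ (2 * s - 1) * ∑ _c : ZMod p,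
        G * (J * (k.factorial * p ^ (k * (k - 1) / 2) * X ^ k)) +
      (4 * k) ^ (2 * (s + k)) * (p : ℝ) ^ (s + k - 1) * ∑ _c : ZMod p,
        (Y : ℝ) ^ (2 * k) * (G * J) := by
    rw [← hM1]
    refine (sum_le_sum fun ψ _ => hpoint ψ).trans ?_
    rw [sum_add_distrib, ← mul_sum, ← mul_sum, sum_comm, sum_comm (s := univ)
      (f := fun ψ c => (Y : ℝ) ^ (2 * k) * ‖powCharSum ψ (W c)‖ ^ (2 * s))]
    gcongr with c _ c _
    · exact hmixed c
    · rw [← mul_sum, hM2 c]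
      gcongr
      exact_mod_cast hWJ c
  have hpp : ∀ n : ℕ, 1 ≤ n → (p : ℝ) ^ (n - 1) * p = (p : ℝ) ^ n := by
    intro n hn
    rw [← pow_succ, Nat.sub_add_cancel hn]
  simp only [sum_const, card_univ, ZMod.card, nsmul_eq_mul] at hsum
  have hfin : G * (meanValue (s + k) k S : ℝ) ≤ G *
      ((4 ^ k * k.factorial * p ^ (2 * s) * p ^ (k * (k - 1) / 2) * X ^ k
        + (4 * k) ^ (2 * (s + k)) * p ^ (s + k) * Y ^ (2 * k)) * J) := by
    refine hsum.trans (le_of_eq ?_)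
    rw [← hpp (2 * s) (by omega), ← hpp (s + k) (by omega)]
    ring
  have := le_of_mul_le_mul_left hfin hG0
  exact_mod_cast this

end PowerSums

namespace PowerSums

open Finset

set_option maxHeartbeats 1000000 in
lemma meanValue_step {k s : ℕ} (hk : 2 ≤ k) (hs : k ^ 2 ≤ s) (hs' : s + k ≤ 11 * k ^ 2)
    (C Δ : ℝ) (hC : 1 ≤ C) (hΔ0 : 0 ≤ Δ) (hΔ : Δ ≤ k * (k + 1) / 2)
    (hJ : ∀ X : ℕ, 1 ≤ X → (meanValue s k (Ico 0 (X : ℤ)) : ℝ) ≤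
      C * (X : ℝ) ^ (2 * s - k * (k + 1) / 2 + Δ : ℝ))
    (X : ℕ) (hX : k ^ k ≤ X) :
    (meanValue (s + k) k (Ico 0 (X : ℤ)) : ℝ) ≤
      (4 * k) ^ (45 * k ^ 2) * C *
        (X : ℝ) ^ (2 * (s + k) - k * (k + 1) / 2 + Δ * (1 - 1 / k) : ℝ) := by
  have hkR : (2 : ℝ) ≤ k := by exact_mod_cast hk
  have hk0 : (0 : ℝ) < k := by linarith
  have hX1 : 1 ≤ X := le_trans (Nat.one_le_pow _ _ (by omega)) hX
  have hXR : (1 : ℝ) ≤ X := by exact_mod_cast hX1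
  set r : ℝ := (X : ℝ) ^ (1 / k : ℝ) with hr
  have hr1 : 1 ≤ r := Real.one_le_rpow hXR (by positivity)
  have hr0 : 0 < r := by linarith
  have hrk : r ^ k = X := by
    rw [hr, ← Real.rpow_natCast, ← Real.rpow_mul (by linarith), one_div,
      inv_mul_cancel₀ hk0.ne', Real.rpow_one]
  have hkr : (k : ℝ) ≤ r := by
    apply le_of_pow_le_pow_left₀ (n := k) (by omega) hr0.le
    rw [hrk]; exact_mod_cast hX
  set y := ⌈r⌉₊ with hy
  have hyr : r ≤ y := Nat.le_ceil r
  have hy2 : (y : ℝ) ≤ 2 * r := by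
    have := Nat.ceil_lt_add_one hr0.le
    linarith
  have hyne : y ≠ 0 := by
    intro h; rw [h] at hyr; norm_num at hyr; linarith
  obtain ⟨p, hp, hyp, hp2⟩ := Nat.exists_prime_lt_and_le_two_mul y hyne
  have hypR : (y : ℝ) < p := by exact_mod_cast hyp
  have hp4 : (p : ℝ) ≤ 4 * r := by
    have : (p : ℝ) ≤ 2 * y := by exact_mod_cast hp2
    linarith
  have hrp : r ≤ p := by linarith
  have hkp : k < p := by
    have : (k : ℝ) < p := by linarith
    exact_mod_cast this
  have hXp : X ≤ p ^ k := by
    have : (X : ℝ) ≤ (p : ℝ) ^ k := by rw [← hrk]; gcongr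
    exact_mod_cast this
  set Y := X / p + 1 with hY
  have hXY : X ≤ p * Y := by
    rw [hY]; exact (Nat.lt_mul_div_succ X hp.pos).le
  have hY1 : 1 ≤ Y := Nat.succ_pos _
  have hrk1 : r ^ (k - 1) * r = r ^ k := by rw [← pow_succ]; congr 1; omega
  have hY2 : (Y : ℝ) ≤ 2 * r ^ (k - 1) := by
    have h1 : ((X / p : ℕ) : ℝ) ≤ X / p := Nat.cast_div_le
    have h2 : (X : ℝ) / p ≤ r ^ (k - 1) := by
      rw [div_le_iff₀ (by linarith), ← hrk, ← hrk1]
      gcongr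
    have h3 : 1 ≤ r ^ (k - 1) := one_le_pow₀ hr1
    rw [hY]; push_cast; linarith
  set e : ℝ := 2 * s - k * (k + 1) / 2 + Δ with he
  have hsR : (k : ℝ) ^ 2 ≤ s := by exact_mod_cast hs
  have hs0 : (0 : ℝ) ≤ s := by positivity
  have he0 : 0 ≤ e := by rw [he]; nlinarith
  have he2 : e ≤ (2 * s : ℕ) := by rw [he]; push_cast; linarith
  have hYe : (Y : ℝ) ^ e ≤ 2 ^ (2 * s) * r ^ ((k - 1) * e : ℝ) := by
    calc (Y : ℝ) ^ e ≤ (2 * r ^ (k - 1)) ^ e := by gcongr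
      _ = 2 ^ e * (r ^ (k - 1)) ^ e := Real.mul_rpow (by norm_num) (by positivity)
      _ ≤ 2 ^ ((2 * s : ℕ) : ℝ) * (r ^ (k - 1)) ^ e := by
          gcongr
          norm_num
      _ = _ := by
          rw [Real.rpow_natCast, ← Real.rpow_natCast r, ← Real.rpow_mul hr0.le,
            Nat.cast_sub (by omega)]
          push_cast; ring_nf
  have hJY : (meanValue s k (Ico 0 (Y : ℤ)) : ℝ) ≤ C * (2 ^ (2 * s) * r ^ ((k - 1) * e : ℝ)) :=
    (hJ Y hY1).trans (by gcongr)
  set e' : ℝ := 2 * (s + k) - k * (k + 1) / 2 + Δ * (1 - 1 / k) with he'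
  have hXe' : (X : ℝ) ^ e' = r ^ (k * e' : ℝ) := by
    rw [← hrk, ← Real.rpow_natCast r, ← Real.rpow_mul hr0.le]
  have hke' : k * e' = 2 * k * s + 2 * k ^ 2 - k * (k * (k + 1) / 2) + (k - 1) * Δ := by
    rw [he']; field_simp
  have htri : ((k * (k - 1) / 2 : ℕ) : ℝ) = k * (k - 1) / 2 := by
    rw [Nat.cast_div (Nat.even_mul_pred_self k).two_dvd (by norm_num), Nat.cast_mul,
      Nat.cast_sub (by omega)]
    norm_num
  -- the two terms of the recursion
  have hpow1 : r ^ (2 * s) * r ^ (k * (k - 1) / 2) * (r ^ k) ^ k * r ^ ((k - 1) * e : ℝ)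
      = r ^ (k * e' : ℝ) := by
    rw [← pow_mul, ← Real.rpow_natCast, ← Real.rpow_natCast, ← Real.rpow_natCast,
      ← Real.rpow_add hr0, ← Real.rpow_add hr0, ← Real.rpow_add hr0, htri]
    congr 1
    rw [hke', he]; push_cast; ring
  have hpow2 : r ^ (s + k) * (r ^ (k - 1)) ^ (2 * k) * r ^ ((k - 1) * e : ℝ)
      ≤ r ^ (k * e' : ℝ) := by
    rw [← pow_mul, ← Real.rpow_natCast, ← Real.rpow_natCast,
      ← Real.rpow_add hr0, ← Real.rpow_add hr0]
    apply Real.rpow_le_rpow_of_exponent_le hr1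
    rw [hke', he]; push_cast [Nat.cast_sub (show 1 ≤ k by omega)]
    have h1 : (k : ℝ) ^ 2 / 2 - k / 2 ≤ s := by nlinarith
    linarith
  have hrec := meanValue_recursion (k := k) (p := p) (s := s) (X := X) (Y := Y) (by omega)
    ((Nat.one_le_pow 2 k (by omega)).trans hs) hp hkp hXp hXY
  have hrecR : (meanValue (s + k) k (Ico 0 (X : ℤ)) : ℝ) ≤
      (4 ^ k * k.factorial * p ^ (2 * s) * p ^ (k * (k - 1) / 2) * X ^ k
        + (4 * k) ^ (2 * (s + k)) * p ^ (s + k) * Y ^ (2 * k)) *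
        meanValue s k (Ico 0 (Y : ℤ)) := by exact_mod_cast hrec
  have h4k : (1 : ℝ) ≤ 4 * k := by linarith
  have h4k4 : (4 : ℝ) ≤ 4 * k := by linarith
  have hkk : k ≤ k ^ 2 := by nlinarith
  have hc1 : (4 : ℝ) ^ k * k.factorial * 4 ^ (2 * s) * 4 ^ (k * (k - 1) / 2) * 2 ^ (2 * s)
      ≤ (4 * k) ^ (44 * k ^ 2) := by
    have h1 : (k.factorial : ℝ) ≤ (k : ℝ) ^ k := by exact_mod_cast Nat.factorial_le_pow k
    calc (4 : ℝ) ^ k * k.factorial * 4 ^ (2 * s) * 4 ^ (k * (k - 1) / 2) * 2 ^ (2 * s)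
        ≤ (4 : ℝ) ^ k * k ^ k * (4 * k) ^ (2 * s) * (4 * k) ^ (k * (k - 1) / 2) * 4 ^ s := by
          rw [pow_mul 2 2 s]
          gcongr
          norm_num
      _ ≤ (4 * k) ^ k * (4 * k) ^ (2 * s) * (4 * k) ^ (k * (k - 1) / 2) * (4 * k) ^ s := by
          rw [← mul_pow]
          gcongr
      _ ≤ _ := by
          rw [← pow_add, ← pow_add, ← pow_add]
          apply pow_le_pow_right₀ h4k
          have h2 : k * (k - 1) / 2 ≤ k ^ 2 := by
            refine (Nat.div_le_self _ _).trans ?_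
            rw [sq]; exact Nat.mul_le_mul_left _ (by omega)
          omega
  have hc2 : ((4 : ℝ) * k) ^ (2 * (s + k)) * 4 ^ (s + k) * 2 ^ (2 * k) * 2 ^ (2 * s)
      ≤ (4 * k) ^ (44 * k ^ 2) := by
    calc ((4 : ℝ) * k) ^ (2 * (s + k)) * 4 ^ (s + k) * 2 ^ (2 * k) * 2 ^ (2 * s)
        = ((4 : ℝ) * k) ^ (2 * (s + k)) * 4 ^ (s + k) * 4 ^ k * 4 ^ s := by
          rw [pow_mul 2 2 s, pow_mul 2 2 k]; norm_num
      _ ≤ (4 * k) ^ (2 * (s + k)) * (4 * k) ^ (s + k) * (4 * k) ^ k * (4 * k) ^ s := by gcongr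
      _ ≤ _ := by
          rw [← pow_add, ← pow_add, ← pow_add]
          apply pow_le_pow_right₀ h4k
          omega
  have hfin : 2 * (4 * (k : ℝ)) ^ (44 * k ^ 2) ≤ (4 * k) ^ (45 * k ^ 2) := by
    have h1 : 45 * k ^ 2 = 44 * k ^ 2 + k ^ 2 := by ring
    rw [h1, pow_add, mul_comm]
    gcongr
    calc (2 : ℝ) ≤ 4 * k := by linarith
      _ = (4 * k) ^ 1 := by rw [pow_one]
      _ ≤ _ := pow_le_pow_right₀ h4k (by nlinarith)
  have hre : 0 ≤ r ^ ((k - 1) * e : ℝ) := by positivity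
  rw [hXe']
  calc (meanValue (s + k) k (Ico 0 (X : ℤ)) : ℝ)
      ≤ (4 ^ k * k.factorial * (4 * r) ^ (2 * s) * (4 * r) ^ (k * (k - 1) / 2) * (r ^ k) ^ k
        + (4 * k) ^ (2 * (s + k)) * (4 * r) ^ (s + k) * (2 * r ^ (k - 1)) ^ (2 * k)) *
        (C * (2 ^ (2 * s) * r ^ ((k - 1) * e : ℝ))) := by
        rw [hrk]
        refine hrecR.trans ?_
        gcongr
    _ = C * ((4 ^ k * k.factorial * 4 ^ (2 * s) * 4 ^ (k * (k - 1) / 2) * 2 ^ (2 * s)) *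
          (r ^ (2 * s) * r ^ (k * (k - 1) / 2) * (r ^ k) ^ k * r ^ ((k - 1) * e : ℝ)) +
        ((4 * k) ^ (2 * (s + k)) * 4 ^ (s + k) * 2 ^ (2 * k) * 2 ^ (2 * s)) *
          (r ^ (s + k) * (r ^ (k - 1)) ^ (2 * k) * r ^ ((k - 1) * e : ℝ))) := by
        rw [mul_pow, mul_pow, mul_pow, mul_pow]; ring
    _ ≤ C * ((4 * k) ^ (44 * k ^ 2) * r ^ (k * e' : ℝ) +
        (4 * k) ^ (44 * k ^ 2) * r ^ (k * e' : ℝ)) := by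
        rw [hpow1]
        gcongr
    _ = (2 * (4 * (k : ℝ)) ^ (44 * k ^ 2)) * C * r ^ (k * e' : ℝ) := by ring
    _ ≤ _ := by gcongr

lemma meanValue_induction {k : ℕ} (hk : 2 ≤ k) (l : ℕ) (hl : l ≤ 10 * k) (X : ℕ) (hX : 1 ≤ X) :
    (meanValue (k ^ 2 + l * k) k (Ico 0 (X : ℤ)) : ℝ) ≤
      ((k : ℝ) ^ (k ^ 3) * ((4 * k) ^ (45 * k ^ 2)) ^ l) *
        (X : ℝ) ^ (2 * (k ^ 2 + l * k : ℕ) - k * (k + 1) / 2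
          + k * (k + 1) / 2 * (1 - 1 / k) ^ l : ℝ) := by
  have hkR : (2 : ℝ) ≤ k := by exact_mod_cast hk
  have hk0 : (0 : ℝ) < k := by linarith
  have hinv : 0 ≤ 1 - 1 / (k : ℝ) := by
    rw [sub_nonneg, div_le_one hk0]; linarith
  have hinv1 : 1 - 1 / (k : ℝ) ≤ 1 := by
    have : 0 < 1 / (k : ℝ) := by positivity
    linarith
  have hB : (1 : ℝ) ≤ (4 * k) ^ (45 * k ^ 2) := one_le_pow₀ (by linarith)
  have hA : (1 : ℝ) ≤ (k : ℝ) ^ (k ^ 3) := one_le_pow₀ (by linarith)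
  have hsmall : ∀ l X : ℕ, 1 ≤ X → X ≤ k ^ k →
      (meanValue (k ^ 2 + l * k) k (Ico 0 (X : ℤ)) : ℝ) ≤
      ((k : ℝ) ^ (k ^ 3) * ((4 * k) ^ (45 * k ^ 2)) ^ l) *
        (X : ℝ) ^ (2 * (k ^ 2 + l * k : ℕ) - k * (k + 1) / 2
          + k * (k + 1) / 2 * (1 - 1 / k) ^ l : ℝ) := by
    intro l X hX hXk
    have hXR : (1 : ℝ) ≤ X := by exact_mod_cast hX
    have h1 : (meanValue (k ^ 2 + l * k) k (Ico 0 (X : ℤ)) : ℝ)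
        ≤ (X : ℝ) ^ (2 * (k ^ 2 + l * k)) := by
      have := meanValue_le_card_pow (k ^ 2 + l * k) k (Ico 0 (X : ℤ))
      simp only [Int.card_Ico, sub_zero, Int.toNat_natCast] at this
      exact_mod_cast this
    set f : ℝ := k * (k + 1) / 2 * (1 - 1 / k) ^ l with hf
    have hf0 : 0 ≤ f := by positivity
    have h2 : (X : ℝ) ^ (2 * (k ^ 2 + l * k)) = (X : ℝ) ^ (k * (k + 1) / 2 - f : ℝ) *
        (X : ℝ) ^ (2 * (k ^ 2 + l * k : ℕ) - k * (k + 1) / 2 + f : ℝ) := by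
      rw [← Real.rpow_add (by linarith), ← Real.rpow_natCast]
      congr 1
      push_cast; ring
    have h3 : (X : ℝ) ^ (k * (k + 1) / 2 - f : ℝ) ≤ (k : ℝ) ^ (k ^ 3) := by
      calc (X : ℝ) ^ (k * (k + 1) / 2 - f : ℝ) ≤ (X : ℝ) ^ ((k ^ 2 : ℕ) : ℝ) := by
            apply Real.rpow_le_rpow_of_exponent_le hXR
            push_cast; nlinarith
        _ = (X : ℝ) ^ (k ^ 2) := Real.rpow_natCast _ _
        _ ≤ ((k : ℝ) ^ k) ^ (k ^ 2) := by
            gcongr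
            exact_mod_cast hXk
        _ = _ := by rw [← pow_mul]; congr 1; ring
    rw [h2] at h1
    refine h1.trans ?_
    gcongr
    calc (X : ℝ) ^ (k * (k + 1) / 2 - f : ℝ) ≤ (k : ℝ) ^ (k ^ 3) * 1 := by rw [mul_one]; exact h3
      _ ≤ _ := by
        gcongr
        exact one_le_pow₀ hB
  induction l generalizing X with
  | zero =>
    rcases le_or_gt X (k ^ k) with h | h
    · exact hsmall 0 X hX h
    · have hXR : (1 : ℝ) ≤ X := by exact_mod_cast hX
      have h1 := meanValue_le_card_pow (k ^ 2 + 0 * k) k (Ico 0 (X : ℤ))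
      simp only [Int.card_Ico, sub_zero, Int.toNat_natCast] at h1
      have h2 : (meanValue (k ^ 2 + 0 * k) k (Ico 0 (X : ℤ)) : ℝ)
        ≤ (X : ℝ) ^ (2 * (k ^ 2 + 0 * k)) := by exact_mod_cast h1
      refine h2.trans ?_
      rw [pow_zero, pow_zero, mul_one, mul_one, ← Real.rpow_natCast (X : ℝ)]
      have e : (2 * ((k ^ 2 + 0 * k : ℕ) : ℝ) - k * (k + 1) / 2 + k * (k + 1) / 2 : ℝ)
        = ((2 * (k ^ 2 + 0 * k) : ℕ) : ℝ) := by push_cast; ring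
      rw [e]
      exact le_mul_of_one_le_left (by positivity) hA
  | succ l ih =>
    rcases le_or_gt X (k ^ k) with h | h
    · exact hsmall (l + 1) X hX h
    have hl1 : l * k + k ≤ 10 * k * k := by nlinarith
    have hstep := meanValue_step (s := k ^ 2 + l * k) hk (by omega) (by nlinarith)
      ((k : ℝ) ^ (k ^ 3) * ((4 * k) ^ (45 * k ^ 2)) ^ l)
      (k * (k + 1) / 2 * (1 - 1 / k) ^ l)
      (by nlinarith [one_le_pow₀ hB (n := l)]) (by positivity)
      (mul_le_of_le_one_right (by positivity) (pow_le_one₀ hinv hinv1))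
      (fun X hX => ih (by omega) X hX) X h.le
    have e1 : k ^ 2 + (l + 1) * k = k ^ 2 + l * k + k := by ring
    rw [e1]
    refine hstep.trans (le_of_eq ?_)
    congr 1
    · rw [pow_succ]; ring
    · congr 1
      rw [pow_succ]; push_cast; ring

/-- A form of Vinogradov's mean value theorem. -/
theorem meanValue_le {k : ℕ} (hk : 2 ≤ k) (X : ℕ) (hX : 1 ≤ X) :
    (meanValue (11 * k ^ 2) k (Ico 0 (X : ℤ)) : ℝ) ≤
      (4 * (k : ℝ)) ^ (451 * k ^ 3) *
        (X : ℝ) ^ (22 * k ^ 2 - k * (k + 1) / 2 + k * (k + 1) / 2 * Real.exp (-10) : ℝ) := by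
  have hkR : (2 : ℝ) ≤ k := by exact_mod_cast hk
  have hk0 : (0 : ℝ) < k := by linarith
  have hXR : (1 : ℝ) ≤ X := by exact_mod_cast hX
  have h := meanValue_induction hk (10 * k) le_rfl X hX
  have e1 : k ^ 2 + 10 * k * k = 11 * k ^ 2 := by ring
  rw [e1] at h
  refine h.trans ?_
  gcongr ?_ * ?_
  · calc (k : ℝ) ^ (k ^ 3) * ((4 * k) ^ (45 * k ^ 2)) ^ (10 * k)
        ≤ (4 * k : ℝ) ^ (k ^ 3) * ((4 * k) ^ (45 * k ^ 2)) ^ (10 * k) := by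
          gcongr; linarith
      _ = _ := by rw [← pow_mul, ← pow_add]; congr 1; ring
  · apply Real.rpow_le_rpow_of_exponent_le hXR
    have h1 : (1 - 1 / (k : ℝ)) ^ (10 * k) ≤ Real.exp (-10) := by
      have h2 : 1 - 1 / (k : ℝ) ≤ Real.exp (-(1 / k)) := by
        have := Real.add_one_le_exp (-(1 / (k : ℝ)))
        linarith
      have hinv : 0 ≤ 1 - 1 / (k : ℝ) := by
        rw [sub_nonneg, div_le_one hk0]; linarith
      calc (1 - 1 / (k : ℝ)) ^ (10 * k) ≤ Real.exp (-(1 / k)) ^ (10 * k) := by gcongr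
        _ = _ := by
          rw [← Real.exp_nat_mul]; congr 1; push_cast; field_simp
    have h3 : (k : ℝ) * (k + 1) / 2 * (1 - 1 / (k : ℝ)) ^ (10 * k)
        ≤ k * (k + 1) / 2 * Real.exp (-10) := by gcongr
    push_cast
    linarith

end PowerSums

namespace PowerSums

open Finset

/-- The additive character `exp (2 π i x)`. -/
noncomputable def ee (x : ℝ) : ℂ := Complex.exp (2 * Real.pi * x * Complex.I)

lemma ee_eq (x : ℝ) : ee x = Complex.exp ((2 * Real.pi * x : ℝ) * Complex.I) := by
  rw [ee]; push_cast; rfl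

lemma ee_add (x y : ℝ) : ee (x + y) = ee x * ee y := by
  rw [ee, ee, ee, ← Complex.exp_add]; congr 1; push_cast; ring

lemma ee_zero : ee 0 = 1 := by simp [ee]

lemma norm_ee (x : ℝ) : ‖ee x‖ = 1 := by
  rw [ee_eq, Complex.norm_exp_ofReal_mul_I]

lemma ee_neg (x : ℝ) : ee (-x) = (starRingEnd ℂ) (ee x) := by
  rw [ee, ee, ← Complex.exp_conj]
  congr 1
  simp only [map_mul, Complex.conj_I, Complex.conj_ofReal, Complex.ofReal_neg, map_ofNat]
  ring

lemma ee_sum {ι : Type*} (I : Finset ι) (f : ι → ℝ) : ee (∑ i ∈ I, f i) = ∏ i ∈ I, ee (f i) := by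
  classical
  induction I using Finset.induction_on with
  | empty => simp [ee_zero]
  | insert a I ha ih => rw [sum_insert ha, prod_insert ha, ee_add, ih]

lemma norm_ee_sub_ee_le (x y : ℝ) : ‖ee x - ee y‖ ≤ 2 * Real.pi * |x - y| := by
  have h : ee x = ee y * ee (x - y) := by rw [← ee_add]; congr 1; ring
  have h2 : ee x - ee y = ee y * (ee (x - y) - 1) := by rw [h]; ring
  rw [h2, norm_mul, norm_ee, one_mul, ee_eq, mul_comm _ Complex.I]
  refine (Real.norm_exp_I_mul_ofReal_sub_one_le).trans ?_
  rw [Real.norm_eq_abs, abs_mul, abs_of_pos (by positivity)]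

lemma norm_ee_sub_one_ge (x : ℝ) (hx : |x| ≤ 1 / 2) : 4 * |x| ≤ ‖ee x - 1‖ := by
  have h : ‖ee x - 1‖ = 2 * |Real.sin (Real.pi * x)| := by
    rw [ee_eq, mul_comm _ Complex.I, Complex.norm_exp_I_mul_ofReal_sub_one, norm_mul]
    simp only [Real.norm_eq_abs, abs_two]
    congr 3; ring
  rw [h]
  have hab : |Real.sin (Real.pi * x)| = Real.sin (Real.pi * |x|) := by
    rcases le_total 0 x with h0 | h0
    · rw [abs_of_nonneg h0, abs_of_nonneg]
      rw [abs_of_nonneg h0] at hx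
      apply Real.sin_nonneg_of_nonneg_of_le_pi (by positivity)
      nlinarith [Real.pi_pos]
    · rw [abs_of_nonpos h0] at hx ⊢
      rw [mul_neg, Real.sin_neg, abs_of_nonpos]
      apply Real.sin_nonpos_of_nonpos_of_neg_pi_le
      · nlinarith [Real.pi_pos]
      · nlinarith [Real.pi_pos]
  rw [hab]
  have := Real.mul_le_sin (x := Real.pi * |x|) (by positivity) (by nlinarith [Real.pi_pos])
  have h2 : 2 / Real.pi * (Real.pi * |x|) = 2 * |x| := by field_simp
  rw [h2] at this
  linarith

/-- Geometric sum bound. -/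
lemma norm_sum_ee_Ico_le (θ : ℝ) (hθ0 : θ ≠ 0) (hθ : |θ| ≤ 1 / 2) (a : ℤ) (n : ℕ) :
    ‖∑ i ∈ range n, ee (θ * (a + i))‖ ≤ 1 / (2 * |θ|) := by
  have h1 : ∀ i : ℕ, ee (θ * (a + i)) = ee (θ * a) * ee θ ^ i := by
    intro i
    have : ee θ ^ i = ee (θ * i) := by
      rw [ee, ee, ← Complex.exp_nat_mul]; congr 1; push_cast; ring
    rw [this, ← ee_add]; congr 1; ring
  have hge := norm_ee_sub_one_ge θ hθ
  have hpos : 0 < |θ| := abs_pos.2 hθ0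
  have hne : ee θ ≠ 1 := by
    intro h
    rw [h] at hge
    simp at hge
    linarith
  simp_rw [h1]
  rw [← mul_sum, norm_mul, norm_ee, one_mul, geom_sum_eq hne, norm_div]
  rw [div_le_div_iff₀ (by linarith) (by positivity)]
  have h2 : ‖ee θ ^ n - 1‖ ≤ 2 := by
    refine (norm_sub_le _ _).trans ?_
    rw [norm_pow, norm_ee]; norm_num
  nlinarith

lemma norm_sum_ee_Icc_le (θ : ℝ) (hθ0 : θ ≠ 0) (hθ : |θ| ≤ 1 / 2) (V : ℕ) :
    ‖∑ w ∈ Icc (-(V : ℤ)) V, ee (θ * w)‖ ≤ 1 / (2 * |θ|) := by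
  have h := norm_sum_ee_Ico_le θ hθ0 hθ (-(V : ℤ)) (2 * V + 1)
  refine le_trans (le_of_eq ?_) h
  congr 1
  symm
  refine sum_bij (fun i _ => (-(V : ℤ)) + (i : ℤ)) ?_ ?_ ?_ ?_
  · intro i hi
    have := mem_range.1 hi
    rw [mem_Icc]; omega
  · intro i _ j _ h
    simpa using h
  · intro w hw
    have := mem_Icc.1 hw
    refine ⟨(w + V).toNat, ?_, ?_⟩
    · rw [mem_range]; omega
    · omega
  · intro i _
    congr 1; push_cast; ring

/-- The linear form `∑ θ_j w_j`. -/
noncomputable def dotR {k : ℕ} (θ : Fin k → ℝ) (w : Fin k → ℤ) : ℝ := ∑ j, θ j * w j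

lemma dotR_sub {k : ℕ} (θ : Fin k → ℝ) (v w : Fin k → ℤ) :
    dotR θ (v - w) = dotR θ v - dotR θ w := by
  simp [dotR, mul_sub]

lemma dotR_tupleSum {k s : ℕ} (θ : Fin k → ℝ) (x : Fin s → ℤ) :
    dotR θ (tupleSum k x) = ∑ i, dotR θ (powVec k (x i)) := by
  simp only [dotR, tupleSum, Finset.sum_apply, Int.cast_sum, mul_sum]
  rw [sum_comm]

lemma norm_pow_eq_sum_pairs {k : ℕ} (s : ℕ) (θ : Fin k → ℝ) (S : Finset ℤ) :
    ((‖∑ b ∈ S, ee (dotR θ (powVec k b))‖ ^ (2 * s) : ℝ) : ℂ) =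
      ∑ q ∈ tuples s S ×ˢ tuples s S, ee (dotR θ (tupleSum k q.1 - tupleSum k q.2)) := by
  have h : (∑ b ∈ S, ee (dotR θ (powVec k b))) ^ s
      = ∑ x ∈ tuples s S, ee (dotR θ (tupleSum k x)) := by
    rw [Finset.sum_pow', tuples]
    refine sum_congr rfl fun x _ => ?_
    rw [dotR_tupleSum, ee_sum]
  rw [mul_comm 2 s, pow_mul, ← norm_pow, h]
  push_cast
  rw [← Complex.mul_conj', map_sum, sum_mul_sum, sum_product]
  refine sum_congr rfl fun i _ => sum_congr rfl fun i' _ => ?_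
  rw [dotR_sub, sub_eq_add_neg, ee_add, ee_neg]

/-- Box containing all differences of power sums. -/
noncomputable def diffBox (k s X : ℕ) : Finset (Fin k → ℤ) :=
  Fintype.piFinset fun j => Icc (-((s * X ^ ((j : ℕ) + 1) : ℕ) : ℤ)) ((s * X ^ ((j : ℕ) + 1) : ℕ) : ℤ)

lemma diff_mem_diffBox {k s X : ℕ} {x y : Fin s → ℤ} (hx : x ∈ tuples s (Ico 0 (X : ℤ)))
    (hy : y ∈ tuples s (Ico 0 (X : ℤ))) : tupleSum k x - tupleSum k y ∈ diffBox k s X := by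
  have h : ∀ z ∈ tuples s (Ico 0 (X : ℤ)), ∀ j : Fin k,
      0 ≤ tupleSum k z j ∧ tupleSum k z j ≤ ((s * X ^ ((j : ℕ) + 1) : ℕ) : ℤ) := by
    intro z hz j
    rw [tupleSum_apply]
    have hz' := fun i => mem_Ico.1 (mem_tuples.1 hz i)
    constructor
    · exact sum_nonneg fun i _ => pow_nonneg (hz' i).1 _
    · calc ∑ i, z i ^ ((j : ℕ) + 1) ≤ ∑ _i : Fin s, (X : ℤ) ^ ((j : ℕ) + 1) :=
            sum_le_sum fun i _ => pow_le_pow_left₀ (hz' i).1 (hz' i).2.le _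
        _ = _ := by simp
  rw [diffBox, Fintype.mem_piFinset]
  intro j
  have h1 := h x hx j
  have h2 := h y hy j
  rw [mem_Icc, Pi.sub_apply]
  constructor <;> linarith

lemma sum_pairs_le {k : ℕ} (s X : ℕ) (h : (Fin k → ℤ) → ℝ) (h0 : ∀ w, 0 ≤ h w) :
    ∑ q ∈ tuples s (Ico 0 (X : ℤ)) ×ˢ tuples s (Ico 0 (X : ℤ)), h (tupleSum k q.1 - tupleSum k q.2)
      ≤ meanValue s k (Ico 0 (X : ℤ)) * ∑ w ∈ diffBox k s X, h w := by
  classical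
  have hm : ∀ q ∈ tuples s (Ico 0 (X : ℤ)) ×ˢ tuples s (Ico 0 (X : ℤ)),
      tupleSum k q.1 - tupleSum k q.2 ∈ diffBox k s X := fun q hq =>
    diff_mem_diffBox (mem_product.1 hq).1 (mem_product.1 hq).2
  rw [← sum_fiberwise_of_maps_to hm, mul_sum]
  refine sum_le_sum fun w _ => ?_
  rw [sum_congr rfl (g := fun _ => h w) (by
    intro q hq; rw [(mem_filter.1 hq).2]), sum_const, nsmul_eq_mul]
  gcongr
  · exact h0 w
  · exact_mod_cast card_sub_eq_le_energy (tupleSum k (s := s)) _ w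

lemma finset_sum_pow_le_card_mul {σ : Type*} (I : Finset σ) (f : σ → ℝ) (hf : ∀ c ∈ I, 0 ≤ f c)
    (n : ℕ) (hn : 1 ≤ n) :
    (∑ c ∈ I, f c) ^ n ≤ (I.card : ℝ) ^ (n - 1) * ∑ c ∈ I, f c ^ n := by
  obtain ⟨m, rfl⟩ : ∃ m, n = m + 1 := ⟨n - 1, by omega⟩
  rcases Nat.eq_zero_or_pos I.card with h0 | h0
  · rw [card_eq_zero] at h0; simp [h0]
  have h := pow_sum_div_card_le_sum_pow (s := I) hf m
  rw [div_le_iff₀ (by positivity)] at h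
  simpa [mul_comm] using h

/-- The double sum controlling one coordinate. -/
noncomputable def linSum (β : ℝ) (V : ℕ) : ℝ :=
  ∑ u ∈ Icc (-(V : ℤ)) V, ‖∑ w ∈ Icc (-(V : ℤ)) V, ee (β * u * w)‖

lemma bilinear_bound {k s : ℕ} (hs : 1 ≤ s) (X : ℕ) (β : Fin k → ℝ) :
    ‖∑ a ∈ Ico 0 (X : ℤ), ∑ b ∈ Ico 0 (X : ℤ),
        ee (∑ j : Fin k, β j * ((a : ℝ) * b) ^ ((j : ℕ) + 1))‖ ^ (4 * s ^ 2) ≤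
      (X : ℝ) ^ (8 * s ^ 2 - 4 * s) * (meanValue s k (Ico 0 (X : ℤ)) : ℝ) ^ 2 *
        ∏ j : Fin k, linSum (β j) (s * X ^ ((j : ℕ) + 1)) := by
  classical
  set S := Ico 0 (X : ℤ) with hS
  set P := tuples s S ×ˢ tuples s S with hP
  set J : ℝ := (meanValue s k S : ℝ) with hJ
  have hcS : (S.card : ℝ) = X := by simp [hS]
  have hcP : (P.card : ℝ) = (X : ℝ) ^ (2 * s) := by
    rw [hP, card_product, card_tuples]
    push_cast
    rw [hcS, ← pow_add]; congr 1; omega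
  set f : ℤ → ℂ := fun a => ∑ b ∈ S, ee (dotR (fun j => β j * (a : ℝ) ^ ((j : ℕ) + 1))
    (powVec k b)) with hf
  set g : (Fin k → ℤ) → ℂ := fun w => ∑ a ∈ S, ee (dotR (fun j => β j * w j) (powVec k a))
    with hg
  have hW : ∑ a ∈ S, ∑ b ∈ S, ee (∑ j : Fin k, β j * ((a : ℝ) * b) ^ ((j : ℕ) + 1))
      = ∑ a ∈ S, f a := by
    refine sum_congr rfl fun a _ => sum_congr rfl fun b _ => ?_
    congr 1
    refine sum_congr rfl fun j _ => ?_
    simp only [powVec]; push_cast; rw [mul_pow]; ring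
  have hstep1 : ‖∑ a ∈ S, f a‖ ^ (2 * s) ≤ (X : ℝ) ^ (2 * s - 1) * ∑ a ∈ S, ‖f a‖ ^ (2 * s) := by
    have := finset_sum_pow_le_card_mul S (fun a => ‖f a‖) (fun _ _ => norm_nonneg _) (2 * s)
      (by omega)
    rw [hcS] at this
    exact (pow_le_pow_left₀ (norm_nonneg _) (norm_sum_le _ _) _).trans this
  have hswap : ∀ (a : ℤ) (w : Fin k → ℤ),
      dotR (fun j => β j * (a : ℝ) ^ ((j : ℕ) + 1)) w = dotR (fun j => β j * w j) (powVec k a) := by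
    intro a w
    simp only [dotR, powVec]
    refine sum_congr rfl fun j _ => ?_
    push_cast; ring
  have hstep2 : ∑ a ∈ S, ‖f a‖ ^ (2 * s) ≤ ∑ q ∈ P, ‖g (tupleSum k q.1 - tupleSum k q.2)‖ := by
    have e : ((∑ a ∈ S, ‖f a‖ ^ (2 * s) : ℝ) : ℂ)
        = ∑ q ∈ P, g (tupleSum k q.1 - tupleSum k q.2) := by
      rw [Complex.ofReal_sum, sum_congr rfl fun a _ => norm_pow_eq_sum_pairs s _ S, sum_comm]
      refine sum_congr rfl fun q _ => sum_congr rfl fun a _ => ?_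
      rw [hswap]
    have h0 : 0 ≤ ∑ a ∈ S, ‖f a‖ ^ (2 * s) := sum_nonneg fun _ _ => by positivity
    calc ∑ a ∈ S, ‖f a‖ ^ (2 * s) = ‖((∑ a ∈ S, ‖f a‖ ^ (2 * s) : ℝ) : ℂ)‖ := by
          rw [Complex.norm_real, Real.norm_of_nonneg h0]
      _ ≤ _ := by rw [e]; exact norm_sum_le _ _
  have hstep3 : (∑ q ∈ P, ‖g (tupleSum k q.1 - tupleSum k q.2)‖) ^ (2 * s) ≤
      ((X : ℝ) ^ (2 * s)) ^ (2 * s - 1) * (J * ∑ w ∈ diffBox k s X, ‖g w‖ ^ (2 * s)) := by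
    have h1 := finset_sum_pow_le_card_mul P (fun q => ‖g (tupleSum k q.1 - tupleSum k q.2)‖)
      (fun _ _ => norm_nonneg _) (2 * s) (by omega)
    rw [hcP] at h1
    refine h1.trans ?_
    gcongr
    exact sum_pairs_le s X (fun w => ‖g w‖ ^ (2 * s)) (fun _ => by positivity)
  have hstep4 : ∑ w ∈ diffBox k s X, ‖g w‖ ^ (2 * s) ≤
      J * ∏ j : Fin k, linSum (β j) (s * X ^ ((j : ℕ) + 1)) := by
    set h : (Fin k → ℤ) → ℝ := fun u =>
      ∏ j : Fin k, ‖∑ w ∈ Icc (-((s * X ^ ((j : ℕ) + 1) : ℕ) : ℤ)) ((s * X ^ ((j : ℕ) + 1) : ℕ) : ℤ),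
        ee (β j * u j * w)‖ with hh
    have e : ((∑ w ∈ diffBox k s X, ‖g w‖ ^ (2 * s) : ℝ) : ℂ)
        = ∑ q ∈ P, ∑ w ∈ diffBox k s X,
          ee (dotR (fun j => β j * w j) (tupleSum k q.1 - tupleSum k q.2)) := by
      rw [Complex.ofReal_sum, sum_congr rfl fun w _ => norm_pow_eq_sum_pairs s _ S, sum_comm]
    have h0 : 0 ≤ ∑ w ∈ diffBox k s X, ‖g w‖ ^ (2 * s) := sum_nonneg fun _ _ => by positivity
    have hprod : ∀ u : Fin k → ℤ,
        ‖∑ w ∈ diffBox k s X, ee (dotR (fun j => β j * w j) u)‖ = h u := by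
      intro u
      rw [hh]
      simp only
      rw [← norm_prod, prod_univ_sum]
      congr 1
      refine sum_congr rfl fun w _ => ?_
      rw [dotR, ee_sum]
      refine prod_congr rfl fun j _ => ?_
      congr 1; ring
    calc ∑ w ∈ diffBox k s X, ‖g w‖ ^ (2 * s)
        = ‖((∑ w ∈ diffBox k s X, ‖g w‖ ^ (2 * s) : ℝ) : ℂ)‖ := by
          rw [Complex.norm_real, Real.norm_of_nonneg h0]
      _ ≤ ∑ q ∈ P, h (tupleSum k q.1 - tupleSum k q.2) := by
          rw [e]
          refine (norm_sum_le _ _).trans (sum_le_sum fun q _ => ?_)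
          rw [hprod]
      _ ≤ J * ∑ u ∈ diffBox k s X, h u :=
          sum_pairs_le s X h fun u => prod_nonneg fun _ _ => norm_nonneg _
      _ = _ := by
          simp only [linSum]
          rw [prod_univ_sum]
          rfl
  rw [hW]
  have hJ0 : 0 ≤ J := by positivity
  calc ‖∑ a ∈ S, f a‖ ^ (4 * s ^ 2) = (‖∑ a ∈ S, f a‖ ^ (2 * s)) ^ (2 * s) := by
        rw [← pow_mul]; congr 1; ring
    _ ≤ ((X : ℝ) ^ (2 * s - 1) * ∑ q ∈ P, ‖g (tupleSum k q.1 - tupleSum k q.2)‖) ^ (2 * s) := by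
        gcongr
        refine hstep1.trans ?_
        gcongr
    _ = ((X : ℝ) ^ (2 * s - 1)) ^ (2 * s) *
          (∑ q ∈ P, ‖g (tupleSum k q.1 - tupleSum k q.2)‖) ^ (2 * s) := by rw [mul_pow]
    _ ≤ ((X : ℝ) ^ (2 * s - 1)) ^ (2 * s) * (((X : ℝ) ^ (2 * s)) ^ (2 * s - 1) *
          (J * (J * ∏ j : Fin k, linSum (β j) (s * X ^ ((j : ℕ) + 1))))) := by
        gcongr
        refine hstep3.trans ?_
        gcongr
    _ = _ := by
        have e : 8 * s ^ 2 - 4 * s = (2 * s - 1) * (2 * s) + 2 * s * (2 * s - 1) := by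
          obtain ⟨m, rfl⟩ : ∃ m, s = m + 1 := ⟨s - 1, by omega⟩
          have e1 : 2 * (m + 1) - 1 = 2 * m + 1 := by omega
          rw [e1]
          apply Nat.sub_eq_of_eq_add
          ring
        rw [e, pow_add, ← pow_mul, ← pow_mul]
        ring

end PowerSums

namespace PowerSums

open Finset

lemma linSum_nonneg (β : ℝ) (V : ℕ) : 0 ≤ linSum β V := sum_nonneg fun _ _ => norm_nonneg _

lemma card_Icc_neg (V : ℕ) : ((Icc (-(V : ℤ)) V).card : ℝ) = 2 * V + 1 := by
  rw [Int.card_Icc]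
  have : ((V : ℤ) + 1 - -(V : ℤ)).toNat = 2 * V + 1 := by omega
  rw [this]; push_cast; ring

lemma norm_inner_le (β : ℝ) (V : ℕ) (u : ℤ) :
    ‖∑ w ∈ Icc (-(V : ℤ)) V, ee (β * u * w)‖ ≤ 2 * V + 1 := by
  refine (norm_sum_le _ _).trans ?_
  simp only [norm_ee, sum_const, nsmul_eq_mul, mul_one]
  exact (card_Icc_neg V).le

lemma linSum_le_sq (β : ℝ) (V : ℕ) : linSum β V ≤ (2 * V + 1) ^ 2 := by
  refine (sum_le_sum fun u _ => norm_inner_le β V u).trans ?_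
  rw [sum_const, nsmul_eq_mul, card_Icc_neg]
  exact le_of_eq (by ring)

lemma linSum_le {β : ℝ} (hβ : β ≠ 0) {V : ℕ} (hV : |β| * V ≤ 1 / 2) :
    linSum β V ≤ 2 * V + 1 + (1 + Real.log V) / |β| := by
  have hpos : 0 < |β| := abs_pos.2 hβ
  have key : ∀ u ∈ Icc (-(V : ℤ)) V, u ≠ 0 →
      ‖∑ w ∈ Icc (-(V : ℤ)) V, ee (β * u * w)‖ ≤ 1 / (2 * |β|) * (1 / (u.natAbs : ℝ)) := by
    intro u hu hu0
    have hu' := mem_Icc.1 hu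
    have hua : (u.natAbs : ℝ) = |(u : ℝ)| := by
      rw [← Int.cast_natCast, Int.natCast_natAbs, Int.cast_abs]
    have hle : |(u : ℝ)| ≤ V := by
      rw [← hua]; exact_mod_cast (by omega : u.natAbs ≤ V)
    have h := norm_sum_ee_Icc_le (β * u) (mul_ne_zero hβ (by exact_mod_cast hu0))
      (by rw [abs_mul]; exact (mul_le_mul_of_nonneg_left hle hpos.le).trans hV) V
    refine h.trans (le_of_eq ?_)
    rw [abs_mul, hua]
    have : |(u : ℝ)| ≠ 0 := by simpa using hu0
    field_simp
  have hsplit : Icc (-(V : ℤ)) V = insert 0 ((Icc 1 V).image (fun i : ℕ => (i : ℤ)) ∪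
      (Icc 1 V).image (fun i : ℕ => -(i : ℤ))) := by
    ext u
    simp only [mem_Icc, mem_insert, mem_union, mem_image]
    constructor
    · intro h
      rcases lt_trichotomy u 0 with h0 | h0 | h0
      · right; right; exact ⟨u.natAbs, by omega, by omega⟩
      · left; exact h0
      · right; left; exact ⟨u.natAbs, by omega, by omega⟩
    · rintro (h | ⟨i, hi, rfl⟩ | ⟨i, hi, rfl⟩) <;> omega
  have hH : ∑ i ∈ Icc 1 V, 1 / (i : ℝ) ≤ 1 + Real.log V := by
    have := harmonic_le_one_add_log V
    rw [harmonic_eq_sum_Icc] at this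
    push_cast at this
    simpa using this
  have h0 : (0 : ℤ) ∈ Icc (-(V : ℤ)) V := by rw [mem_Icc]; omega
  have hbound : ∀ u ∈ Icc (-(V : ℤ)) V, ‖∑ w ∈ Icc (-(V : ℤ)) V, ee (β * u * w)‖ ≤
      if u = 0 then (2 * V + 1 : ℝ) else 1 / (2 * |β|) * (1 / (u.natAbs : ℝ)) := by
    intro u hu
    split_ifs with h
    · exact norm_inner_le β V u
    · exact key u hu h
  refine (sum_le_sum hbound).trans ?_
  rw [hsplit, sum_insert, sum_union, sum_image, sum_image]
  · simp only [if_true]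
    have e1 : ∑ x ∈ Icc 1 V, (if (x : ℤ) = 0 then (2 * V + 1 : ℝ)
        else 1 / (2 * |β|) * (1 / ((x : ℤ).natAbs : ℝ))) = 1 / (2 * |β|) * ∑ i ∈ Icc 1 V, 1 / (i : ℝ) := by
      rw [mul_sum]
      refine sum_congr rfl fun i hi => ?_
      have := (mem_Icc.1 hi).1
      rw [if_neg (by omega)]; simp
    have e2 : ∑ x ∈ Icc 1 V, (if -(x : ℤ) = 0 then (2 * V + 1 : ℝ)
        else 1 / (2 * |β|) * (1 / ((-(x : ℤ)).natAbs : ℝ))) = 1 / (2 * |β|) * ∑ i ∈ Icc 1 V, 1 / (i : ℝ) := by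
      rw [mul_sum]
      refine sum_congr rfl fun i hi => ?_
      have := (mem_Icc.1 hi).1
      rw [if_neg (by omega)]; simp
    rw [e1, e2]
    have e3 : (1 + Real.log V) / |β| = 1 / (2 * |β|) * (1 + Real.log V) +
        1 / (2 * |β|) * (1 + Real.log V) := by field_simp; ring
    rw [e3]
    have : 0 ≤ 1 / (2 * |β|) := by positivity
    nlinarith [mul_le_mul_of_nonneg_left hH this]
  · intro a _ b _ h; simpa using h
  · intro a _ b _ h; simpa using h
  · rw [disjoint_left]
    simp only [mem_image, mem_Icc]
    rintro u ⟨i, hi, rfl⟩ ⟨j, hj, h⟩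
    omega
  · simp only [mem_union, mem_image, mem_Icc]
    rintro (⟨i, hi, h⟩ | ⟨i, hi, h⟩) <;> omega

lemma exp_ge_mul {z : ℝ} (hz : 10 ^ 10 ≤ z) : 3000 * z ≤ Real.exp (0.01 * z) := by
  have h := Real.quadratic_le_exp_of_nonneg (x := 0.01 * z) (by linarith)
  nlinarith

set_option maxHeartbeats 1000000 in
/-- Saving in one coordinate of the bilinear bound. -/
lemma linSum_le_saving {y l β : ℝ} {k s X J : ℕ} (hy : 0.22 ≤ y) (hk : (k : ℝ) ≤ 5 * y + 1)
    (hk1 : 1 ≤ k) (hs : s = 11 * k ^ 2)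
    (hl : 10 ^ 12 * (1 + y) ^ 2 ≤ l) (hX1 : (X : ℝ) ≤ Real.exp (0.4 * l))
    (hX2 : Real.exp (0.4 * l) ≤ 2 * X) (hJ1 : 1.8 * y ≤ J) (hJ2 : J ≤ 4.6 * y)
    (hβ1 : Real.exp ((y - J) * l) / 2 ^ (J + 1) ≤ |β|) (hβ2 : |β| ≤ Real.exp ((y - J) * l)) :
    linSum β (s * X ^ J) ≤ 9 * ((s : ℝ) * X ^ J) ^ 2 * Real.exp (-(0.04 * (y * l))) := by
  set z := y * l with hz
  have hl0 : 10 ^ 12 ≤ l := by nlinarith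
  have hyz' : 10 ^ 12 * y ≤ z := by
    have := mul_le_mul_of_nonneg_left hl0 (by linarith : (0 : ℝ) ≤ y)
    linarith
  have hz0 : 10 ^ 11 ≤ z := by linarith
  have hyl : y ≤ l := by nlinarith
  have hyz : y ^ 2 ≤ z := by
    have := mul_le_mul_of_nonneg_left hyl (by linarith : (0 : ℝ) ≤ y)
    rw [sq]; exact this
  have hk' : (k : ℝ) ≤ 9.55 * y := by linarith
  have hsr : (s : ℝ) = 11 * (k : ℝ) ^ 2 := by rw [hs]; push_cast; ring
  have hkr : (1 : ℝ) ≤ k := by exact_mod_cast hk1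
  have hs1 : (1 : ℝ) ≤ s := by rw [hsr]; nlinarith
  have hsz : (s : ℝ) ≤ 1004 * z := by
    have : (k : ℝ) ^ 2 ≤ (9.55 * y) ^ 2 := pow_le_pow_left₀ (by linarith) hk' 2
    rw [hsr]; linarith
  have hX0 : (0 : ℝ) < X := by
    have := Real.exp_pos (0.4 * l); linarith
  have hXJ1 : (X : ℝ) ^ J ≤ Real.exp (0.4 * J * l) := by
    calc (X : ℝ) ^ J ≤ Real.exp (0.4 * l) ^ J := pow_le_pow_left₀ hX0.le hX1 J
      _ = _ := by rw [← Real.exp_nat_mul]; congr 1; ring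
  have hXJ2 : Real.exp (0.4 * J * l - J) ≤ (X : ℝ) ^ J := by
    have h1 : Real.exp (0.4 * l - 1) ≤ X := by
      rw [Real.exp_sub]
      have := Real.add_one_le_exp (1 : ℝ)
      rw [div_le_iff₀ (Real.exp_pos 1)]
      exact hX2.trans (by rw [mul_comm]; gcongr; linarith)
    calc Real.exp (0.4 * J * l - J) = Real.exp (0.4 * l - 1) ^ J := by
          rw [← Real.exp_nat_mul]; congr 1; ring
      _ ≤ _ := pow_le_pow_left₀ (Real.exp_pos _).le h1 J
  set v : ℝ := (s : ℝ) * X ^ J with hv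
  have hvV : ((s * X ^ J : ℕ) : ℝ) = v := by rw [hv]; push_cast; rfl
  have hv2 : Real.exp (0.4 * J * l - J) ≤ v := by
    rw [hv]; exact hXJ2.trans (le_mul_of_one_le_left (pow_pos hX0 J).le hs1)
  have hv0 : 0 < v := lt_of_lt_of_le (Real.exp_pos _) hv2
  have hv1 : v ≤ s * Real.exp (0.4 * J * l) := by rw [hv]; gcongr
  have hβ1' : Real.exp ((y - J) * l - (J + 1)) ≤ |β| := by
    refine le_trans ?_ hβ1
    rw [Real.exp_sub]
    gcongr
    calc (2 : ℝ) ^ (J + 1) ≤ Real.exp 1 ^ (J + 1) := by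
          gcongr; linarith [Real.add_one_le_exp (1 : ℝ)]
      _ = _ := by rw [← Real.exp_nat_mul]; congr 1; push_cast; ring
  have hβ0 : 0 < |β| := lt_of_lt_of_le (Real.exp_pos _) hβ1'
  have hexpz := exp_ge_mul (z := z) (by linarith)
  have hJl : 1.8 * z ≤ J * l := by
    have := mul_le_mul_of_nonneg_right hJ1 (by linarith : (0 : ℝ) ≤ l)
    linarith
  have hJl2 : J * l ≤ 4.6 * z := by
    have := mul_le_mul_of_nonneg_right hJ2 (by linarith : (0 : ℝ) ≤ l)
    linarith
  have hsmall : |β| * ((s * X ^ J : ℕ) : ℝ) ≤ 1 / 2 := by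
    rw [hvV]
    calc |β| * v ≤ Real.exp ((y - J) * l) * (s * Real.exp (0.4 * J * l)) := by gcongr
      _ = s * Real.exp (z - 0.6 * (J * l)) := by
          rw [mul_left_comm, ← Real.exp_add]; congr 2; rw [hz]; ring
      _ ≤ s * Real.exp (-(0.01 * z)) := by gcongr; linarith
      _ ≤ 1 / 2 := by
          rw [Real.exp_neg, ← div_eq_mul_inv, div_le_iff₀ (Real.exp_pos _)]
          linarith
  have h := linSum_le (abs_pos.1 hβ0) hsmall
  rw [hvV] at h
  have hvge1 : 1 ≤ v := le_trans (by
    rw [← Real.exp_zero]; apply Real.exp_le_exp.2; linarith) hv2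
  refine h.trans ?_
  have claim1 : 3 * v ≤ 4.5 * v ^ 2 * Real.exp (-(0.04 * z)) := by
    have : Real.exp (0.04 * z) ≤ v := le_trans (by
      apply Real.exp_le_exp.2; linarith) hv2
    rw [Real.exp_neg, ← div_eq_mul_inv, le_div_iff₀ (Real.exp_pos _)]
    have := mul_le_mul_of_nonneg_left this hv0.le
    nlinarith only [this, hv0]
  have claim2 : (1 + Real.log v) / |β| ≤ 4.5 * v ^ 2 * Real.exp (-(0.04 * z)) := by
    rw [div_le_iff₀ hβ0]
    have hlog : Real.log v ≤ 1004 * z + 1.84 * z := by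
      calc Real.log v ≤ Real.log (s * Real.exp (0.4 * J * l)) := Real.log_le_log hv0 hv1
        _ = Real.log s + 0.4 * J * l := by
            rw [Real.log_mul (by linarith) (Real.exp_pos _).ne', Real.log_exp]
        _ ≤ _ := by
            have := Real.log_le_sub_one_of_pos (x := (s : ℝ)) (by linarith)
            linarith
    have h1 : 1 + Real.log v ≤ Real.exp (0.01 * z) := by linarith
    have h2 : Real.exp (0.01 * z) ≤ v ^ 2 * Real.exp (-(0.04 * z)) * |β| := by
      calc Real.exp (0.01 * z) ≤ Real.exp (0.4 * J * l - J) ^ 2 * Real.exp (-(0.04 * z)) *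
            Real.exp ((y - J) * l - (J + 1)) := by
            rw [← Real.exp_nat_mul, ← Real.exp_add, ← Real.exp_add]
            apply Real.exp_le_exp.2
            push_cast
            have : (y - J) * l = z - J * l := by rw [hz]; ring
            rw [this]
            linarith
        _ ≤ _ := by gcongr
    have h3 : 0 ≤ v ^ 2 * Real.exp (-(0.04 * z)) * |β| := by positivity
    linarith
  linarith

end PowerSums

namespace PowerSums

open Finset

lemma exp_neg_ten_le : Real.exp (-10) ≤ 1 / 10000 := by
  rw [Real.exp_neg, ← one_div]
  apply one_div_le_one_div_of_le (by norm_num)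
  have h : Real.exp 10 = Real.exp 1 ^ 10 := by rw [← Real.exp_nat_mul]; norm_num
  rw [h]
  calc (10000 : ℝ) ≤ 2.7 ^ 10 := by norm_num
    _ ≤ _ := pow_le_pow_left₀ (by norm_num) (by linarith [Real.exp_one_gt_d9]) 10

lemma card_window_ge {y : ℝ} {k : ℕ} (hy : 0.22 ≤ y) (hk : 5 * y ≤ k) :
    y / 2 ≤ ((univ.filter fun j : Fin k =>
      1.8 * y ≤ (((j : ℕ) + 1 : ℕ) : ℝ) ∧ (((j : ℕ) + 1 : ℕ) : ℝ) ≤ 4.6 * y).card : ℝ) := by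
  rcases lt_or_ge y 0.435 with h | h
  · have hk0 : 0 < k := by
      by_contra h0
      have : k = 0 := by omega
      rw [this] at hk; norm_num at hk; linarith
    have : 0 < (univ.filter fun j : Fin k =>
      1.8 * y ≤ (((j : ℕ) + 1 : ℕ) : ℝ) ∧ (((j : ℕ) + 1 : ℕ) : ℝ) ≤ 4.6 * y).card := by
      rw [card_pos]
      refine ⟨⟨0, hk0⟩, ?_⟩
      rw [mem_filter]
      refine ⟨mem_univ _, ?_, ?_⟩ <;> norm_num <;> linarith
    have : (1 : ℝ) ≤ ((univ.filter fun j : Fin k =>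
      1.8 * y ≤ (((j : ℕ) + 1 : ℕ) : ℝ) ∧ (((j : ℕ) + 1 : ℕ) : ℝ) ≤ 4.6 * y).card : ℝ) := by
      exact_mod_cast this
    linarith
  · set a := ⌈1.8 * y⌉₊ with ha
    set b := ⌊4.6 * y⌋₊ with hb
    have ha1 : (a : ℝ) < 1.8 * y + 1 := Nat.ceil_lt_add_one (by linarith)
    have hb1 : 4.6 * y < b + 1 := Nat.lt_floor_add_one _
    have hb2 : (b : ℝ) ≤ 4.6 * y := Nat.floor_le (by linarith)
    have ha2 : 1.8 * y ≤ a := Nat.le_ceil _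
    have ha0 : 1 ≤ a := by
      rw [Nat.one_le_iff_ne_zero]; intro h0; rw [h0] at ha2; norm_num at ha2; linarith
    have hbk : b ≤ k := by
      have : (b : ℝ) ≤ k := by linarith
      exact_mod_cast this
    have hcard : (Icc a b).card ≤ (univ.filter fun j : Fin k =>
      1.8 * y ≤ (((j : ℕ) + 1 : ℕ) : ℝ) ∧ (((j : ℕ) + 1 : ℕ) : ℝ) ≤ 4.6 * y).card := by
      refine card_le_card_of_surjOn (fun j => (j : ℕ) + 1) ?_
      intro i hi
      have hi' := mem_Icc.1 (mem_coe.1 hi)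
      refine ⟨⟨i - 1, by omega⟩, ?_, by simp; omega⟩
      rw [mem_coe, mem_filter]
      have e : ((i - 1 + 1 : ℕ) : ℝ) = i := by congr 1; omega
      refine ⟨mem_univ _, ?_, ?_⟩
      · simp only; rw [e]
        exact ha2.trans (by exact_mod_cast hi'.1)
      · simp only; rw [e]
        exact le_trans (by exact_mod_cast hi'.2) hb2
    rw [Nat.card_Icc] at hcard
    have h1 : (b : ℝ) + 1 - a ≤ ((b + 1 - a : ℕ) : ℝ) := by
      rw [sub_le_iff_le_add]; exact_mod_cast (by omega : b + 1 ≤ b + 1 - a + a)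
    have h2 : ((b + 1 - a : ℕ) : ℝ) ≤ _ := Nat.cast_le.2 hcard
    linarith

lemma natCast_le_exp (n : ℕ) : (n : ℝ) ≤ Real.exp n := by
  linarith [Real.add_one_le_exp (n : ℝ)]

lemma sum_two_mul_succ (k : ℕ) : ∑ j : Fin k, 2 * ((j : ℕ) + 1) = k * (k + 1) := by
  rw [Fin.sum_univ_eq_sum_range (fun j => 2 * (j + 1)) k]
  induction k with
  | zero => simp
  | succ n ih => rw [sum_range_succ, ih]; ring

lemma prod_linSum_le {y l : ℝ} {k X : ℕ} (hy : 0.22 ≤ y) (hk1 : 5 * y ≤ k)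
    (hk2 : (k : ℝ) ≤ 5 * y + 1) (hl : 10 ^ 12 * (1 + y) ^ 2 ≤ l)
    (hX1 : (X : ℝ) ≤ Real.exp (0.4 * l)) (hX2 : Real.exp (0.4 * l) ≤ 2 * X) (β : Fin k → ℝ)
    (hβ1 : ∀ j : Fin k, Real.exp ((y - ((j : ℕ) + 1 : ℕ)) * l) / 2 ^ ((j : ℕ) + 1 + 1) ≤ |β j|)
    (hβ2 : ∀ j : Fin k, |β j| ≤ Real.exp ((y - ((j : ℕ) + 1 : ℕ)) * l)) :
    ∏ j : Fin k, linSum (β j) ((11 * k ^ 2) * X ^ ((j : ℕ) + 1)) ≤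
      Real.exp (12 * k ^ 2 - 0.02 * y ^ 2 * l) * (X : ℝ) ^ (k * (k + 1)) := by
  classical
  have hk0 : 1 ≤ k := by
    rw [Nat.one_le_iff_ne_zero]; intro h0; rw [h0] at hk1; norm_num at hk1; linarith
  set s := 11 * k ^ 2 with hs
  set G := univ.filter fun j : Fin k =>
      1.8 * y ≤ (((j : ℕ) + 1 : ℕ) : ℝ) ∧ (((j : ℕ) + 1 : ℕ) : ℝ) ≤ 4.6 * y with hG
  have hX1' : 1 ≤ X := by
    rw [Nat.one_le_iff_ne_zero]; intro h0; rw [h0] at hX2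
    have := Real.exp_pos (0.4 * l); norm_num at hX2; linarith
  have hs1 : 1 ≤ s := by rw [hs]; nlinarith
  have hterm : ∀ j : Fin k, linSum (β j) (s * X ^ ((j : ℕ) + 1)) ≤
      9 * ((s : ℝ) * X ^ ((j : ℕ) + 1)) ^ 2 * (if j ∈ G then Real.exp (-(0.04 * (y * l))) else 1) := by
    intro j
    split_ifs with h
    · rw [hG, mem_filter] at h
      exact linSum_le_saving hy hk2 hk0 hs hl hX1 hX2 h.2.1 h.2.2 (hβ1 j) (hβ2 j)
    · refine (linSum_le_sq _ _).trans ?_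
      have h1 : (1 : ℝ) ≤ ((s * X ^ ((j : ℕ) + 1) : ℕ) : ℝ) := by
        exact_mod_cast Nat.one_le_iff_ne_zero.2 (by positivity)
      have e : (s : ℝ) * X ^ ((j : ℕ) + 1) = ((s * X ^ ((j : ℕ) + 1) : ℕ) : ℝ) := by push_cast; rfl
      rw [e]
      nlinarith
  refine (prod_le_prod (fun _ _ => linSum_nonneg _ _) fun j _ => hterm j).trans ?_
  rw [prod_mul_distrib, prod_ite]
  have hfil : (univ.filter fun j : Fin k => j ∈ G) = G := by ext; simp
  rw [hfil, prod_const, prod_const_one, mul_one, ← Real.exp_nat_mul]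
  have h9 : 9 * (s : ℝ) ^ 2 ≤ Real.exp (12 * k) := by
    have h1 := natCast_le_exp k
    have h2 : (33 : ℝ) ≤ Real.exp (4 * k) := by
      have : (1 : ℝ) ≤ k := by exact_mod_cast hk0
      have h3 : Real.exp 4 ≤ Real.exp (4 * k) := Real.exp_le_exp.2 (by linarith)
      have h : Real.exp 4 = Real.exp 1 ^ 4 := by rw [← Real.exp_nat_mul]; norm_num
      refine le_trans ?_ h3
      rw [h]
      calc (33 : ℝ) ≤ 2.7 ^ 4 := by norm_num
        _ ≤ _ := pow_le_pow_left₀ (by norm_num) (by linarith [Real.exp_one_gt_d9]) 4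
    calc 9 * (s : ℝ) ^ 2 = (33 * (k : ℝ) ^ 2) ^ 2 := by rw [hs]; push_cast; ring
      _ ≤ (Real.exp (4 * k) * Real.exp k ^ 2) ^ 2 := by gcongr
      _ = _ := by
        rw [← Real.exp_nat_mul, ← Real.exp_add, ← Real.exp_nat_mul]; congr 1; push_cast; ring
  have hprod : ∏ j : Fin k, 9 * ((s : ℝ) * X ^ ((j : ℕ) + 1)) ^ 2 ≤
      Real.exp (12 * k ^ 2) * (X : ℝ) ^ (k * (k + 1)) := by
    have : ∀ j : Fin k, 9 * ((s : ℝ) * X ^ ((j : ℕ) + 1)) ^ 2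
        = 9 * (s : ℝ) ^ 2 * (X : ℝ) ^ (2 * ((j : ℕ) + 1)) := by intro j; rw [mul_pow]; ring
    simp_rw [this]
    rw [prod_mul_distrib, prod_const, prod_pow_eq_pow_sum, sum_two_mul_succ, card_univ,
      Fintype.card_fin]
    gcongr
    calc (9 * (s : ℝ) ^ 2) ^ k ≤ Real.exp (12 * k) ^ k := by gcongr
      _ = _ := by rw [← Real.exp_nat_mul]; congr 1; ring
  have hG' := card_window_ge hy hk1
  rw [← hG] at hG'
  have hl0 : 0 ≤ l := by nlinarith
  have hexp : Real.exp ((G.card : ℝ) * -(0.04 * (y * l))) ≤ Real.exp (-(0.02 * y ^ 2 * l)) := by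
    apply Real.exp_le_exp.2
    have := mul_le_mul_of_nonneg_right hG' (by positivity : 0 ≤ 0.04 * (y * l))
    nlinarith only [this]
  calc _ ≤ Real.exp (12 * k ^ 2) * (X : ℝ) ^ (k * (k + 1)) * Real.exp (-(0.02 * y ^ 2 * l)) := by
        gcongr
    _ = _ := by rw [mul_right_comm, ← Real.exp_add]; rfl

/-- Vinogradov's bound for the bilinear polynomial sum. -/
lemma norm_bilinear_le {y l : ℝ} {k X : ℕ} (hy : 0.22 ≤ y) (hk1 : 5 * y ≤ k)
    (hk2 : (k : ℝ) ≤ 5 * y + 1) (hl : 10 ^ 12 * (1 + y) ^ 2 ≤ l)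
    (hX1 : (X : ℝ) ≤ Real.exp (0.4 * l)) (hX2 : Real.exp (0.4 * l) ≤ 2 * X) (β : Fin k → ℝ)
    (hβ1 : ∀ j : Fin k, Real.exp ((y - ((j : ℕ) + 1 : ℕ)) * l) / 2 ^ ((j : ℕ) + 1 + 1) ≤ |β j|)
    (hβ2 : ∀ j : Fin k, |β j| ≤ Real.exp ((y - ((j : ℕ) + 1 : ℕ)) * l)) :
    ‖∑ a ∈ Ico 0 (X : ℤ), ∑ b ∈ Ico 0 (X : ℤ),
        ee (∑ j : Fin k, β j * ((a : ℝ) * b) ^ ((j : ℕ) + 1))‖ ≤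
      (X : ℝ) ^ 2 * Real.exp (-(1 / 10 ^ 9 * l / (1 + y) ^ 2)) := by
  have hk0 : 2 ≤ k := by
    have : (1 : ℝ) < k := by linarith
    exact_mod_cast this
  have hX1' : 1 ≤ X := by
    rw [Nat.one_le_iff_ne_zero]; intro h0; rw [h0] at hX2
    have := Real.exp_pos (0.4 * l); norm_num at hX2; linarith
  have hs1 : 1 ≤ 11 * k ^ 2 := by nlinarith
  set s := 11 * k ^ 2 with hs
  have hsr : (s : ℝ) = 11 * (k : ℝ) ^ 2 := by rw [hs]; push_cast; ring
  have hXpos : (0 : ℝ) < X := by exact_mod_cast hX1'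
  obtain ⟨x, hx⟩ : ∃ x : ℝ, (X : ℝ) = Real.exp x := ⟨Real.log X, (Real.exp_log hXpos).symm⟩
  have hxl : x ≤ 0.4 * l := by rw [hx] at hX1; exact Real.exp_le_exp.1 hX1
  have hbil := bilinear_bound hs1 X β
  have hprod := prod_linSum_le hy hk1 hk2 hl hX1 hX2 β hβ1 hβ2
  rw [← hs] at hprod
  have hJ : (meanValue s k (Ico 0 (X : ℤ)) : ℝ) ≤
      Real.exp (1804 * k ^ 4 + x * (22 * k ^ 2 - k * (k + 1) / 2 + k * (k + 1) / 2 * Real.exp (-10))) := by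
    refine (meanValue_le hk0 X hX1').trans ?_
    rw [Real.exp_add, hx, ← Real.exp_mul]
    gcongr
    calc (4 * (k : ℝ)) ^ (451 * k ^ 3) ≤ Real.exp ((4 * k : ℕ) : ℝ) ^ (451 * k ^ 3) := by
          gcongr; exact_mod_cast natCast_le_exp (4 * k)
      _ = _ := by rw [← Real.exp_nat_mul]; congr 1; push_cast; ring
  have hs2 : 4 * s ≤ 8 * s ^ 2 := by nlinarith
  refine le_of_pow_le_pow_left₀ (n := 4 * s ^ 2) (by positivity) (by positivity) ?_
  refine hbil.trans ?_
  calc (X : ℝ) ^ (8 * s ^ 2 - 4 * s) * (meanValue s k (Ico 0 (X : ℤ)) : ℝ) ^ 2 *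
        ∏ j : Fin k, linSum (β j) (s * X ^ ((j : ℕ) + 1))
      ≤ (X : ℝ) ^ (8 * s ^ 2 - 4 * s) * (Real.exp (1804 * k ^ 4 + x * (22 * k ^ 2 - k * (k + 1) / 2
          + k * (k + 1) / 2 * Real.exp (-10)))) ^ 2 *
        (Real.exp (12 * k ^ 2 - 0.02 * y ^ 2 * l) * (X : ℝ) ^ (k * (k + 1))) := by
        gcongr
        exact prod_nonneg fun _ _ => linSum_nonneg _ _
    _ ≤ _ := ?_
  rw [hx]
  simp only [← Real.exp_nat_mul, ← Real.exp_add]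
  apply Real.exp_le_exp.2
  push_cast [Nat.cast_sub hs2]
  have hkr : (2 : ℝ) ≤ k := by exact_mod_cast hk0
  have hk' : (k : ℝ) ≤ 9.55 * y := by linarith
  have hl0 : 0 < l := by nlinarith
  have hle2 : (k : ℝ) * (k + 1) ≤ 135 * y ^ 2 := by
    have : (k : ℝ) * (k + 1) ≤ (9.55 * y) * (9.55 * y + 0.5 * k) := by
      apply mul_le_mul hk' _ (by linarith) (by linarith)
      linarith
    nlinarith
  have hk4 : (k : ℝ) ^ 4 ≤ 8320 * y ^ 4 := by
    calc (k : ℝ) ^ 4 ≤ (9.55 * y) ^ 4 := by gcongr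
      _ = 9.55 ^ 4 * y ^ 4 := by ring
      _ ≤ _ := by gcongr; norm_num
  have hyl : y ^ 2 ≤ l / 10 ^ 12 := by
    rw [le_div_iff₀ (by norm_num)]; nlinarith
  have hA : (k : ℝ) ^ 4 ≤ 8320 * (y ^ 2 * (l / 10 ^ 12)) := by
    refine hk4.trans ?_
    have : y ^ 4 = y ^ 2 * y ^ 2 := by ring
    rw [this]; gcongr
  have hB : (k : ℝ) ^ 2 ≤ (k : ℝ) ^ 4 := pow_le_pow_right₀ (by linarith) (by norm_num)
  have hC : x * ((k : ℝ) * (k + 1)) * Real.exp (-10) ≤ 0.4 * l * (135 * y ^ 2) * (1 / 10000) := by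
    have h0 : 0 ≤ (k : ℝ) * (k + 1) := by positivity
    calc x * ((k : ℝ) * (k + 1)) * Real.exp (-10) ≤ 0.4 * l * ((k : ℝ) * (k + 1)) * Real.exp (-10) := by
          gcongr
      _ ≤ _ := by gcongr; exact exp_neg_ten_le
  have hD : (k : ℝ) ^ 4 * (1 / 10 ^ 9 * l / (1 + y) ^ 2) ≤ 8320 * y ^ 2 * (1 / 10 ^ 9 * l) := by
    rw [mul_div_assoc', div_le_iff₀ (by positivity)]
    calc (k : ℝ) ^ 4 * (1 / 10 ^ 9 * l) ≤ 8320 * y ^ 4 * (1 / 10 ^ 9 * l) := by gcongr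
      _ = 8320 * y ^ 2 * (1 / 10 ^ 9 * l) * y ^ 2 := by ring
      _ ≤ _ := by gcongr; linarith
  have hy2 : 0 ≤ y ^ 2 * l := by positivity
  rw [hsr]
  set D := 1 / 10 ^ 9 * l / (1 + y) ^ 2 with hDdef
  nlinarith only [hA, hB, hC, hD, hy2]

end PowerSums

namespace PowerSums

open Finset

lemma taylor_inv_eq (F r u : ℝ) (hr : 0 < r) (hu : 0 ≤ u) (k : ℕ) :
    F / (r + u) = F / r + ∑ j : Fin k, (-1) ^ ((j : ℕ) + 1) * F / r ^ ((j : ℕ) + 2) * u ^ ((j : ℕ) + 1)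
      + (-1) ^ (k + 1) * F * u ^ (k + 1) / (r ^ (k + 1) * (r + u)) := by
  rw [Fin.sum_univ_eq_sum_range (fun j => (-1) ^ (j + 1) * F / r ^ (j + 2) * u ^ (j + 1)) k]
  have hru : r + u ≠ 0 := by positivity
  induction k with
  | zero => simp; field_simp; ring
  | succ n ih =>
    rw [ih, sum_range_succ, add_assoc, add_assoc, add_assoc]
    congr 2
    field_simp
    ring

lemma taylor_inv_le {F r u : ℝ} (hF : 0 ≤ F) (hr : 0 < r) (hu : 0 ≤ u) (k : ℕ) :
    |F / (r + u) - (F / r + ∑ j : Fin k,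
      (-1) ^ ((j : ℕ) + 1) * F / r ^ ((j : ℕ) + 2) * u ^ ((j : ℕ) + 1))|
      ≤ F / r * (u / r) ^ (k + 1) := by
  rw [taylor_inv_eq F r u hr hu k, add_sub_cancel_left, abs_div, abs_mul, abs_mul, abs_pow, abs_neg,
    abs_one, one_pow, one_mul, abs_of_nonneg hF, abs_of_nonneg (by positivity : 0 ≤ u ^ (k + 1)),
    abs_of_pos (by positivity)]
  rw [div_pow, div_mul_div_comm, mul_comm r (r ^ (k + 1))]
  gcongr
  linarith

lemma norm_sum_Ioc_shift_le (f : ℕ → ℂ) (hf : ∀ r, ‖f r‖ ≤ 1) {R R' : ℕ} (hR : R ≤ R') (u : ℕ) :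
    ‖∑ r ∈ Ioc R R', f r - ∑ r ∈ Ioc R R', f (r + u)‖ ≤ 2 * u := by
  have htel : ∀ g : ℕ → ℂ, ∑ r ∈ Ioc R R', g r - ∑ r ∈ Ioc R R', g (r + 1) = g (R + 1) - g (R' + 1) := by
    intro g
    induction R', hR using Nat.le_induction with
    | base => simp
    | succ n hn ih =>
      rw [sum_Ioc_succ_top (by omega), sum_Ioc_succ_top (by omega)]
      linear_combination ih
  induction u with
  | zero => simp
  | succ u ih =>
    have h := htel fun r => f (r + u)
    have h2 : ‖f (R + 1 + u) - f (R' + 1 + u)‖ ≤ 2 := by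
      refine (norm_sub_le _ _).trans ?_
      linarith [hf (R + 1 + u), hf (R' + 1 + u)]
    have e : ∑ r ∈ Ioc R R', f (r + 1 + u) = ∑ r ∈ Ioc R R', f (r + (u + 1)) :=
      sum_congr rfl fun r _ => by congr 1; ring
    rw [e] at h
    have h3 := norm_add_le (∑ r ∈ Ioc R R', f r - ∑ r ∈ Ioc R R', f (r + u))
      (f (R + 1 + u) - f (R' + 1 + u))
    rw [← h, sub_add_sub_cancel] at h3
    rw [← h] at h2
    push_cast
    linarith

/-- Local form: for a fixed large `r`, the bilinear shift average is small. -/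
lemma norm_bilinear_inv_le {y l r : ℝ} {X : ℕ} (hy : 0.22 ≤ y) (hl : 10 ^ 12 * (1 + y) ^ 2 ≤ l)
    (hX1 : (X : ℝ) ≤ Real.exp (0.4 * l)) (hX2 : Real.exp (0.4 * l) ≤ 2 * X)
    (hr1 : Real.exp l ≤ r) (hr2 : r ≤ 2 * Real.exp l) :
    ‖∑ a ∈ Ico 0 (X : ℤ), ∑ b ∈ Ico 0 (X : ℤ), ee (Real.exp ((1 + y) * l) / (r + (a : ℝ) * b))‖ ≤
      8 * ((X : ℝ) ^ 2 * Real.exp (-(1 / 10 ^ 9 * l / (1 + y) ^ 2))) := by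
  set k := ⌈5 * y⌉₊ with hk
  set F := Real.exp ((1 + y) * l) with hF
  have hk1 : 5 * y ≤ k := Nat.le_ceil _
  have hk2 : (k : ℝ) ≤ 5 * y + 1 := (Nat.ceil_lt_add_one (by linarith)).le
  have hr0 : 0 < r := lt_of_lt_of_le (Real.exp_pos _) hr1
  have hl0 : 0 < l := by nlinarith
  set β : Fin k → ℝ := fun j => (-1) ^ ((j : ℕ) + 1) * F / r ^ ((j : ℕ) + 2) with hβ
  have hF0 : 0 < F := Real.exp_pos _
  have hβabs : ∀ j, |β j| = F / r ^ ((j : ℕ) + 2) := by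
    intro j
    rw [hβ]; simp only
    rw [abs_div, abs_mul, abs_pow, abs_neg, abs_one, one_pow, one_mul, abs_of_pos hF0,
      abs_of_pos (by positivity)]
  have hFj : ∀ j : ℕ, Real.exp ((y - (j + 1 : ℕ)) * l) = F / Real.exp l ^ (j + 2) := by
    intro j
    rw [hF, ← Real.exp_nat_mul, ← Real.exp_sub]
    congr 1; push_cast; ring
  have hmain := norm_bilinear_le hy hk1 hk2 hl hX1 hX2 β
    (by
      intro j
      rw [hβabs, hFj, div_div, ← mul_pow]
      gcongr
      linarith)
    (by
      intro j
      rw [hβabs, hFj]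
      gcongr)
  set E := Real.exp (-(1 / 10 ^ 9 * l / (1 + y) ^ 2)) with hE
  set g : ℤ → ℤ → ℂ := fun a b => ee (F / r) *
    ee (∑ j : Fin k, β j * ((a : ℝ) * b) ^ ((j : ℕ) + 1)) with hg
  have hdiff : ∀ a ∈ Ico 0 (X : ℤ), ∀ b ∈ Ico 0 (X : ℤ),
      ‖ee (F / (r + (a : ℝ) * b)) - g a b‖ ≤ 7 * E := by
    intro a ha b hb
    rw [mem_Ico] at ha hb
    have ha0 : (0 : ℝ) ≤ a := by exact_mod_cast ha.1
    have hb0 : (0 : ℝ) ≤ b := by exact_mod_cast hb.1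
    have haX : (a : ℝ) ≤ X := by exact_mod_cast ha.2.le
    have hbX : (b : ℝ) ≤ X := by exact_mod_cast hb.2.le
    rw [hg]; simp only
    rw [← ee_add]
    refine (norm_ee_sub_ee_le _ _).trans ?_
    have h1 := taylor_inv_le hF0.le hr0 (mul_nonneg ha0 hb0) k
    have h2 : F / r * ((a : ℝ) * b / r) ^ (k + 1) ≤ E := by
      calc F / r * ((a : ℝ) * b / r) ^ (k + 1)
          ≤ F / Real.exp l * (Real.exp (0.4 * l) * Real.exp (0.4 * l) / Real.exp l) ^ (k + 1) := by
            have : (a : ℝ) * b ≤ Real.exp (0.4 * l) * Real.exp (0.4 * l) := by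
              gcongr <;> linarith
            gcongr
        _ = Real.exp (y * l - 0.2 * l * (k + 1)) := by
            rw [hF, ← Real.exp_add, ← Real.exp_sub, ← Real.exp_sub, ← Real.exp_nat_mul,
              ← Real.exp_add]
            congr 1; push_cast; ring
        _ ≤ E := by
            apply Real.exp_le_exp.2
            have h3 : 1 / 10 ^ 9 * l / (1 + y) ^ 2 ≤ 0.2 * l := by
              rw [div_le_iff₀ (by positivity)]
              have : 1 ≤ (1 + y) ^ 2 := by nlinarith
              nlinarith
            nlinarith
    have h4 : |F / (r + (a : ℝ) * b) - (F / r + ∑ j : Fin k, β j * ((a : ℝ) * b) ^ ((j : ℕ) + 1))|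
        ≤ E := h1.trans h2
    have : 2 * Real.pi ≤ 7 := by linarith [Real.pi_lt_d2]
    exact mul_le_mul this h4 (abs_nonneg _) (by norm_num)
  have hgnorm : ‖∑ a ∈ Ico 0 (X : ℤ), ∑ b ∈ Ico 0 (X : ℤ), g a b‖ ≤ (X : ℝ) ^ 2 * E := by
    rw [hg]
    simp only [← mul_sum]
    rw [norm_mul, norm_ee, one_mul]
    exact hmain
  have hd : ‖∑ a ∈ Ico 0 (X : ℤ), ∑ b ∈ Ico 0 (X : ℤ), (ee (F / (r + (a : ℝ) * b)) - g a b)‖ ≤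
      (X : ℝ) ^ 2 * (7 * E) := by
    calc _ ≤ ∑ a ∈ Ico 0 (X : ℤ), ∑ b ∈ Ico 0 (X : ℤ), 7 * E := by
          refine (norm_sum_le _ _).trans (sum_le_sum fun a ha => ?_)
          exact (norm_sum_le _ _).trans (sum_le_sum fun b hb => hdiff a ha b hb)
      _ = _ := by simp; ring
  have hsplit : ∑ a ∈ Ico 0 (X : ℤ), ∑ b ∈ Ico 0 (X : ℤ), ee (F / (r + (a : ℝ) * b)) =
      ∑ a ∈ Ico 0 (X : ℤ), ∑ b ∈ Ico 0 (X : ℤ), g a b +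
      ∑ a ∈ Ico 0 (X : ℤ), ∑ b ∈ Ico 0 (X : ℤ), (ee (F / (r + (a : ℝ) * b)) - g a b) := by
    simp only [sum_sub_distrib]; ring
  rw [hsplit]
  refine (norm_add_le _ _).trans ?_
  linarith

lemma weyl_sum_large {y l : ℝ} (hy : 0.22 ≤ y) (hl : 10 ^ 12 * (1 + y) ^ 2 ≤ l) {R R' : ℕ}
    (hR : (R : ℝ) = Real.exp l) (hRR' : R ≤ R') (hR' : R' ≤ 2 * R) :
    ‖∑ r ∈ Ioc R R', ee (Real.exp ((1 + y) * l) / r)‖ ≤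
      10 * R * Real.exp (-(1 / 10 ^ 9 * l / (1 + y) ^ 2)) := by
  set F := Real.exp ((1 + y) * l) with hF
  set E := Real.exp (-(1 / 10 ^ 9 * l / (1 + y) ^ 2)) with hE
  set X := ⌊Real.exp (0.4 * l)⌋₊ with hX
  have hl0 : 0 < l := by nlinarith
  have hX1 : (X : ℝ) ≤ Real.exp (0.4 * l) := Nat.floor_le (Real.exp_pos _).le
  have hX1' : 1 ≤ X := by
    apply Nat.le_floor
    rw [Nat.cast_one]
    exact Real.one_le_exp (by positivity)
  have hXr : (1 : ℝ) ≤ X := by exact_mod_cast hX1'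
  have hX2 : Real.exp (0.4 * l) ≤ 2 * X := by
    have := Nat.lt_floor_add_one (Real.exp (0.4 * l)); rw [← hX] at this; linarith
  set S := ∑ r ∈ Ioc R R', ee (F / r) with hS
  have hshift : ∀ a ∈ Ico 0 (X : ℤ), ∀ b ∈ Ico 0 (X : ℤ),
      ‖S - ∑ r ∈ Ioc R R', ee (F / ((r : ℝ) + (a : ℝ) * b))‖ ≤ 2 * (X : ℝ) ^ 2 := by
    intro a ha b hb
    rw [mem_Ico] at ha hb
    obtain ⟨a', rfl⟩ := Int.eq_ofNat_of_zero_le ha.1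
    obtain ⟨b', rfl⟩ := Int.eq_ofNat_of_zero_le hb.1
    have h := norm_sum_Ioc_shift_le (fun r : ℕ => ee (F / r)) (fun r => (norm_ee _).le) hRR' (a' * b')
    push_cast at h ⊢
    refine h.trans ?_
    have ha2 : (a' : ℝ) ≤ X := by exact_mod_cast ha.2.le
    have hb2 : (b' : ℝ) ≤ X := by exact_mod_cast hb.2.le
    rw [sq]; gcongr
  have hsum : ‖∑ a ∈ Ico 0 (X : ℤ), ∑ b ∈ Ico 0 (X : ℤ),
      (S - ∑ r ∈ Ioc R R', ee (F / ((r : ℝ) + (a : ℝ) * b)))‖ ≤ (X : ℝ) ^ 2 * (2 * (X : ℝ) ^ 2) := by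
    calc _ ≤ ∑ a ∈ Ico 0 (X : ℤ), ∑ b ∈ Ico 0 (X : ℤ), 2 * (X : ℝ) ^ 2 := by
          refine (norm_sum_le _ _).trans (sum_le_sum fun a ha => ?_)
          exact (norm_sum_le _ _).trans (sum_le_sum fun b hb => hshift a ha b hb)
      _ = _ := by simp; ring
  have hswap : ∑ a ∈ Ico 0 (X : ℤ), ∑ b ∈ Ico 0 (X : ℤ),
      ∑ r ∈ Ioc R R', ee (F / ((r : ℝ) + (a : ℝ) * b)) =
      ∑ r ∈ Ioc R R', ∑ a ∈ Ico 0 (X : ℤ), ∑ b ∈ Ico 0 (X : ℤ),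
        ee (F / ((r : ℝ) + (a : ℝ) * b)) := by
    rw [sum_comm (s := Ioc R R')]
    refine sum_congr rfl fun a _ => ?_
    rw [sum_comm]
  have hW : ‖∑ r ∈ Ioc R R', ∑ a ∈ Ico 0 (X : ℤ), ∑ b ∈ Ico 0 (X : ℤ),
      ee (F / ((r : ℝ) + (a : ℝ) * b))‖ ≤ R * (8 * ((X : ℝ) ^ 2 * E)) := by
    calc _ ≤ ∑ r ∈ Ioc R R', 8 * ((X : ℝ) ^ 2 * E) := by
          refine (norm_sum_le _ _).trans (sum_le_sum fun r hr => ?_)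
          have hr' := mem_Ioc.1 hr
          refine norm_bilinear_inv_le hy hl hX1 hX2 ?_ ?_
          · rw [← hR]; exact_mod_cast hr'.1.le
          · rw [← hR]; exact_mod_cast hr'.2.trans hR'
      _ = ((R' - R : ℕ) : ℝ) * (8 * ((X : ℝ) ^ 2 * E)) := by simp
      _ ≤ _ := by
          gcongr
          omega
  have hXS : (X : ℝ) ^ 2 * ‖S‖ ≤ R * (8 * ((X : ℝ) ^ 2 * E)) + (X : ℝ) ^ 2 * (2 * (X : ℝ) ^ 2) := by
    have e : ((X : ℂ) ^ 2) * S = ∑ a ∈ Ico 0 (X : ℤ), ∑ b ∈ Ico 0 (X : ℤ),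
        (S - ∑ r ∈ Ioc R R', ee (F / ((r : ℝ) + (a : ℝ) * b))) +
        ∑ r ∈ Ioc R R', ∑ a ∈ Ico 0 (X : ℤ), ∑ b ∈ Ico 0 (X : ℤ),
          ee (F / ((r : ℝ) + (a : ℝ) * b)) := by
      simp only [sum_sub_distrib]
      rw [hswap]
      simp
      ring
    have e2 : (X : ℝ) ^ 2 * ‖S‖ = ‖((X : ℂ) ^ 2) * S‖ := by simp
    rw [e2, e]
    refine (norm_add_le _ _).trans ?_
    linarith
  have hXR : (X : ℝ) ^ 2 ≤ R * E := by
    rw [hR]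
    calc (X : ℝ) ^ 2 ≤ Real.exp (0.4 * l) ^ 2 := by gcongr
      _ ≤ _ := by
        rw [← Real.exp_nat_mul, ← Real.exp_add]
        apply Real.exp_le_exp.2
        have h3 : 1 / 10 ^ 9 * l / (1 + y) ^ 2 ≤ 0.2 * l := by
          rw [div_le_iff₀ (by positivity)]
          have : 1 ≤ (1 + y) ^ 2 := by nlinarith
          nlinarith
        push_cast; linarith
  have hX0 : 0 < (X : ℝ) ^ 2 := by positivity
  refine le_of_mul_le_mul_left (hXS.trans ?_) hX0
  nlinarith

/-- Vinogradov's estimate for the sums of `e(F / r)` over short dyadic ranges. -/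
theorem weyl_sum_le {R R' : ℕ} (hR : 1 ≤ R) (hRR' : R ≤ R') (hR' : R' ≤ 2 * R) {F : ℝ}
    (hF : (R : ℝ) ^ (1.22 : ℝ) ≤ |F|) :
    ‖∑ r ∈ Ioc R R', ee (F / r)‖ ≤
      Real.exp 1000 * R * Real.exp (-(1 / 10 ^ 9 * Real.log R ^ 3 / Real.log |F| ^ 2)) := by
  have htriv : ‖∑ r ∈ Ioc R R', ee (F / r)‖ ≤ R := by
    refine (norm_sum_le _ _).trans ?_
    simp only [norm_ee, sum_const, Nat.card_Ioc, nsmul_eq_mul, mul_one]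
    exact_mod_cast (by omega : R' - R ≤ R)
  have hRpos : (0 : ℝ) < R := by exact_mod_cast hR
  set l := Real.log R with hl
  have hRl : (R : ℝ) = Real.exp l := (Real.exp_log hRpos).symm
  have hl0 : 0 ≤ l := Real.log_nonneg (by exact_mod_cast hR)
  have hFpos : 0 < |F| := lt_of_lt_of_le (by positivity) hF
  have hlF : 1.22 * l ≤ Real.log |F| := by
    have := Real.log_le_log (by positivity) hF
    rwa [Real.log_rpow hRpos] at this
  by_cases hbig : 1 / 10 ^ 9 * l ^ 3 / Real.log |F| ^ 2 ≤ 1000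
  · refine htriv.trans ?_
    rw [mul_right_comm, ← Real.exp_add]
    exact le_mul_of_one_le_left hRpos.le (Real.one_le_exp (by linarith))
  push Not at hbig
  have hl1 : 0 < l := by
    rcases hl0.eq_or_lt with h | h
    · rw [← h] at hbig; norm_num at hbig
    · exact h
  set y := Real.log |F| / l - 1 with hy
  have hFl : Real.log |F| = (1 + y) * l := by rw [hy]; field_simp; ring
  have hy1 : 0.22 ≤ y := by
    rw [hFl] at hlF
    have := le_of_mul_le_mul_right hlF hl1
    linarith
  have hexp : 1 / 10 ^ 9 * l ^ 3 / Real.log |F| ^ 2 = 1 / 10 ^ 9 * l / (1 + y) ^ 2 := by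
    rw [hFl]; field_simp
  rw [hexp] at hbig ⊢
  have hl2 : 10 ^ 12 * (1 + y) ^ 2 ≤ l := by
    rw [lt_div_iff₀ (by positivity)] at hbig
    linarith
  have hmain := weyl_sum_large hy1 hl2 hRl hRR' hR'
  rw [← hFl, Real.exp_log hFpos] at hmain
  have hsame : ‖∑ r ∈ Ioc R R', ee (F / r)‖ = ‖∑ r ∈ Ioc R R', ee (|F| / r)‖ := by
    rcases abs_choice F with h | h
    · rw [h]
    · rw [h]
      simp only [neg_div, ee_neg, ← map_sum]
      rw [RCLike.norm_conj]
  rw [hsame]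
  refine hmain.trans ?_
  gcongr
  linarith [Real.add_one_le_exp (1000 : ℝ)]

end PowerSums

namespace PowerSums

open Finset

open ArithmeticFunction
open scoped ArithmeticFunction.Moebius ArithmeticFunction.zeta

lemma sum_conv (f g : ℕ → ℝ) (φ : ℕ → ℂ) (D D' : ℕ) :
    ∑ d ∈ Ioc D D', ((∑ x ∈ d.divisorsAntidiagonal, f x.1 * g x.2 : ℝ) : ℂ) * φ d =
      ∑ b ∈ Ioc 0 D', (f b : ℂ) * ∑ c ∈ Ioc (D / b) (D' / b), (g c : ℂ) * φ (b * c) := by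
  simp only [Complex.ofReal_sum, sum_mul, mul_sum]
  rw [sum_sigma', sum_sigma']
  refine sum_bij' (fun x _ => ⟨x.2.1, x.2.2⟩) (fun x _ => ⟨x.1 * x.2, (x.1, x.2)⟩) ?_ ?_ ?_ ?_ ?_
  · rintro ⟨d, b, c⟩ h
    simp only [mem_sigma, mem_Ioc, Nat.mem_divisorsAntidiagonal] at h ⊢
    obtain ⟨⟨h1, h2⟩, rfl, h4⟩ := h
    have hb : 0 < b := Nat.pos_of_ne_zero fun h => h4 (by simp [h])
    have hc : 0 < c := Nat.pos_of_ne_zero fun h => h4 (by simp [h])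
    refine ⟨⟨hb, ?_⟩, ?_, ?_⟩
    · nlinarith
    · rw [Nat.div_lt_iff_lt_mul hb]; linarith
    · rw [Nat.le_div_iff_mul_le hb]; linarith
  · rintro ⟨b, c⟩ h
    simp only [mem_sigma, mem_Ioc, Nat.mem_divisorsAntidiagonal] at h ⊢
    obtain ⟨⟨hb, _⟩, h2, h3⟩ := h
    rw [Nat.div_lt_iff_lt_mul hb] at h2
    rw [Nat.le_div_iff_mul_le hb] at h3
    refine ⟨⟨by linarith, by linarith⟩, trivial, ?_⟩
    have : 0 < c := Nat.pos_of_ne_zero fun h => by simp [h] at h2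
    positivity
  · rintro ⟨d, b, c⟩ h
    simp only [mem_sigma, Nat.mem_divisorsAntidiagonal] at h
    obtain ⟨_, rfl, _⟩ := h
    rfl
  · rintro ⟨b, c⟩ h; rfl
  · rintro ⟨d, b, c⟩ h
    simp only [mem_sigma, Nat.mem_divisorsAntidiagonal] at h
    obtain ⟨_, rfl, _⟩ := h
    push_cast; ring

lemma abel_bound (w : ℕ → ℝ) (a : ℕ → ℂ) {R R' : ℕ} (hR : R ≤ R') (hw0 : ∀ c, 0 ≤ w c)
    (hw : ∀ c, R < c → w c ≤ w (c + 1)) {B : ℝ}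
    (hB : ∀ r, R ≤ r → r ≤ R' → ‖∑ c ∈ Ioc R r, a c‖ ≤ B) :
    ‖∑ c ∈ Ioc R R', (w c : ℂ) * a c‖ ≤ 2 * w R' * B := by
  have hB0 : 0 ≤ B := (norm_nonneg _).trans (hB R le_rfl hR)
  have key : ∀ r, R ≤ r → r ≤ R' → ‖∑ c ∈ Ioc R r, (w c : ℂ) * a c - w r * ∑ c ∈ Ioc R r, a c‖ ≤ w r * B := by
    intro r hr
    induction r, hr using Nat.le_induction with
    | base => intro _; simp; exact mul_nonneg (hw0 _) hB0
    | succ n hn ih =>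
      intro hn'
      rcases hn.eq_or_lt with h | h
      · rw [← h]; simp; exact mul_nonneg (hw0 _) hB0
      have h1 := ih (by omega)
      have h2 := hB n hn (by omega)
      have e : ∑ c ∈ Ioc R (n + 1), (w c : ℂ) * a c - w (n + 1) * ∑ c ∈ Ioc R (n + 1), a c =
          (∑ c ∈ Ioc R n, (w c : ℂ) * a c - w n * ∑ c ∈ Ioc R n, a c)
          - ((w (n + 1) - w n : ℝ) : ℂ) * ∑ c ∈ Ioc R n, a c := by
        rw [sum_Ioc_succ_top (by omega), sum_Ioc_succ_top (by omega)]
        push_cast; ring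
      rw [e]
      refine (norm_sub_le _ _).trans ?_
      rw [norm_mul, Complex.norm_real, Real.norm_of_nonneg (by linarith [hw n h])]
      have := mul_le_mul_of_nonneg_left h2 (by linarith [hw n h] : 0 ≤ w (n + 1) - w n)
      linarith
  have h := key R' hR le_rfl
  have h2 := hB R' hR le_rfl
  have h3 := norm_sub_norm_le (∑ c ∈ Ioc R R', (w c : ℂ) * a c) (w R' * ∑ c ∈ Ioc R R', a c)
  rw [norm_mul, Complex.norm_real, Real.norm_of_nonneg (hw0 _)] at h3
  have := mul_le_mul_of_nonneg_left h2 (hw0 R')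
  linarith

/-- Truncation of an arithmetic function to `[1, z]`. -/
noncomputable def trunc (z : ℕ) (f : ArithmeticFunction ℝ) : ArithmeticFunction ℝ :=
  ⟨fun n => if n ≤ z then f n else 0, by simp⟩

lemma trunc_apply (z : ℕ) (f : ArithmeticFunction ℝ) (n : ℕ) :
    trunc z f n = if n ≤ z then f n else 0 := rfl

lemma vaughan (z : ℕ) :
    (Λ : ArithmeticFunction ℝ) = trunc z Λ + trunc z (μ : ArithmeticFunction ℝ) * log
      - trunc z (μ : ArithmeticFunction ℝ) * trunc z Λ * (ζ : ArithmeticFunction ℝ)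
      + (((μ : ArithmeticFunction ℝ) - trunc z (μ : ArithmeticFunction ℝ)) *
        (ζ : ArithmeticFunction ℝ)) * (Λ - trunc z Λ) := by
  have h1 : (μ : ArithmeticFunction ℝ) * (ζ : ArithmeticFunction ℝ) = 1 := coe_moebius_mul_coe_zeta
  have h2 : (Λ : ArithmeticFunction ℝ) * (ζ : ArithmeticFunction ℝ) = log := vonMangoldt_mul_zeta
  linear_combination (trunc z Λ - Λ) * h1 + (trunc z (μ : ArithmeticFunction ℝ)) * h2

lemma abs_trunc_le (z : ℕ) (f : ArithmeticFunction ℝ) (n : ℕ) : |trunc z f n| ≤ |f n| := by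
  rw [trunc_apply]; split_ifs
  · exact le_rfl
  · simp

lemma abs_moebius_real_le (n : ℕ) : |(μ : ArithmeticFunction ℝ) n| ≤ 1 := by
  rw [intCoe_apply, ← Int.cast_abs]
  exact_mod_cast abs_moebius_le_one

lemma abs_typeI_coeff_le (z n : ℕ) :
    |(trunc z (μ : ArithmeticFunction ℝ) * trunc z Λ) n| ≤ Real.log n := by
  rw [mul_apply]
  calc |∑ x ∈ n.divisorsAntidiagonal, trunc z (μ : ArithmeticFunction ℝ) x.1 * trunc z Λ x.2|
      ≤ ∑ x ∈ n.divisorsAntidiagonal, Λ x.2 := by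
        refine (abs_sum_le_sum_abs _ _).trans (sum_le_sum fun x _ => ?_)
        rw [abs_mul]
        have h1 := (abs_trunc_le z (μ : ArithmeticFunction ℝ) x.1).trans (abs_moebius_real_le x.1)
        have h2 := abs_trunc_le z Λ x.2
        rw [abs_of_nonneg vonMangoldt_nonneg] at h2
        calc _ ≤ 1 * Λ x.2 := mul_le_mul h1 h2 (abs_nonneg _) zero_le_one
          _ = _ := one_mul _
    _ = Real.log n := by
        rw [← vonMangoldt_sum, Nat.sum_divisorsAntidiagonal' (fun _ b => Λ b)]

lemma typeI_coeff_eq_zero {z n : ℕ} (hn : z * z < n) :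
    (trunc z (μ : ArithmeticFunction ℝ) * trunc z Λ) n = 0 := by
  rw [mul_apply]
  refine sum_eq_zero fun x hx => ?_
  rw [Nat.mem_divisorsAntidiagonal] at hx
  rw [trunc_apply, trunc_apply]
  split_ifs with h1 h2
  · exfalso; have := Nat.mul_le_mul h1 h2; omega
  all_goals simp

/-- The type II coefficient. -/
noncomputable def alpha (z : ℕ) : ArithmeticFunction ℝ :=
  ((μ : ArithmeticFunction ℝ) - trunc z (μ : ArithmeticFunction ℝ)) * (ζ : ArithmeticFunction ℝ)

lemma abs_alpha_le (z n : ℕ) : |alpha z n| ≤ n.divisors.card := by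
  rw [alpha, mul_apply]
  calc _ ≤ ∑ x ∈ n.divisorsAntidiagonal, (1 : ℝ) := by
        refine (abs_sum_le_sum_abs _ _).trans (sum_le_sum fun x _ => ?_)
        rw [abs_mul]
        have h1 : |((μ : ArithmeticFunction ℝ) - trunc z (μ : ArithmeticFunction ℝ)) x.1| ≤ 1 := by
          rw [show ((μ : ArithmeticFunction ℝ) - trunc z (μ : ArithmeticFunction ℝ)) x.1 = (μ : ArithmeticFunction ℝ) x.1 - trunc z (μ : ArithmeticFunction ℝ) x.1 from rfl, trunc_apply]
          split_ifs
          · simp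
          · simpa using abs_moebius_real_le x.1
        have h2 : |(ζ : ArithmeticFunction ℝ) x.2| ≤ 1 := by
          rw [natCoe_apply, zeta_apply]; split_ifs <;> simp
        calc _ ≤ (1 : ℝ) * 1 := mul_le_mul h1 h2 (abs_nonneg _) zero_le_one
          _ = 1 := one_mul 1
    _ = _ := by
      rw [Nat.sum_divisorsAntidiagonal (fun _ _ => (1 : ℝ))]; simp

lemma alpha_eq_zero {z n : ℕ} (hn : n ≤ z) : alpha z n = 0 := by
  rw [alpha, mul_apply]
  refine sum_eq_zero fun x hx => ?_
  rw [Nat.mem_divisorsAntidiagonal] at hx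
  have : x.1 ≤ n := Nat.le_of_dvd (Nat.pos_of_ne_zero hx.2) ⟨x.2, hx.1.symm⟩
  rw [show ((μ : ArithmeticFunction ℝ) - trunc z (μ : ArithmeticFunction ℝ)) x.1 = (μ : ArithmeticFunction ℝ) x.1 - trunc z (μ : ArithmeticFunction ℝ) x.1 from rfl, trunc_apply, if_pos (by omega), sub_self, zero_mul]

lemma card_divisors_le_two_mul_sqrt (n : ℕ) : n.divisors.card ≤ 2 * n.sqrt := by
  have h : n.divisors ⊆ Ioc 0 n.sqrt ∪ (Ioc 0 n.sqrt).image (fun d => n / d) := by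
    intro d hd
    rw [Nat.mem_divisors] at hd
    obtain ⟨⟨e, he⟩, hn⟩ := hd
    have hd0 : 0 < d := Nat.pos_of_ne_zero fun h => hn (by simp [he, h])
    have he0 : 0 < e := Nat.pos_of_ne_zero fun h => hn (by simp [he, h])
    rw [mem_union, mem_image]
    rcases le_total d e with hle | hle
    · left
      rw [mem_Ioc, Nat.le_sqrt]
      exact ⟨hd0, by nlinarith⟩
    · right
      refine ⟨e, ?_, ?_⟩
      · rw [mem_Ioc, Nat.le_sqrt]
        exact ⟨he0, by nlinarith⟩
      · rw [he]; exact Nat.mul_div_cancel _ he0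
  calc n.divisors.card ≤ _ := card_le_card h
    _ ≤ _ := card_union_le _ _
    _ ≤ n.sqrt + n.sqrt := by
      gcongr
      · simp
      · exact card_image_le.trans (by simp)
    _ = _ := by ring

lemma sum_inv_le (B : ℕ) : ∑ b ∈ Ioc 0 B, 1 / (b : ℝ) ≤ 1 + Real.log B := by
  have := harmonic_le_one_add_log B
  rw [harmonic_eq_sum_Icc] at this
  push_cast at this
  have e : Ioc 0 B = Icc 1 B := by ext; simp [Nat.succ_le_iff]
  rw [e]
  simpa using this

lemma sum_card_divisors_le (B : ℕ) :
    ∑ b ∈ Ioc 0 B, (b.divisors.card : ℝ) ≤ B * (1 + Real.log B) := by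
  have h := sum_conv (fun _ => 1) (fun _ => 1) (fun _ => 1) 0 B
  have e : ∑ b ∈ Ioc 0 B, (b.divisors.card : ℝ) = ∑ b ∈ Ioc 0 B, ((B / b : ℕ) : ℝ) := by
    have h2 : ∀ b : ℕ, (∑ x ∈ b.divisorsAntidiagonal, (1 : ℝ) * 1) = b.divisors.card := by
      intro b
      rw [Nat.sum_divisorsAntidiagonal (fun _ _ => (1 : ℝ) * 1)]; simp
    simp only [h2] at h
    simp only [Complex.ofReal_one, mul_one, one_mul, Nat.zero_div, sum_const, Nat.card_Ioc,
      Nat.sub_zero, nsmul_eq_mul] at h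
    exact_mod_cast h
  rw [e]
  calc ∑ b ∈ Ioc 0 B, ((B / b : ℕ) : ℝ) ≤ ∑ b ∈ Ioc 0 B, (B : ℝ) * (1 / b) := by
        refine sum_le_sum fun b _ => ?_
        rw [mul_one_div]; exact Nat.cast_div_le
    _ ≤ _ := by rw [← mul_sum]; gcongr; exact sum_inv_le B

end PowerSums

namespace PowerSums

open Finset

/-- The saving factor in the exponential sum estimates. -/
noncomputable def decay (D : ℕ) (F : ℝ) : ℝ :=
  Real.exp (-(1 / 10 ^ 12 * Real.log D ^ 3 / Real.log |F| ^ 2))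

lemma decay_pos (D : ℕ) (F : ℝ) : 0 < decay D F := Real.exp_pos _

lemma decay_le_one {D : ℕ} (hD : 1 ≤ D) (F : ℝ) : decay D F ≤ 1 := by
  rw [decay, Real.exp_le_one_iff, neg_nonpos]
  have : 0 ≤ Real.log D := Real.log_nonneg (by exact_mod_cast hD)
  positivity

lemma decay_ge {D : ℕ} (hD : 2 ≤ D) {F : ℝ} (hF : Real.log D / 4 ≤ Real.log |F|) :
    Real.exp (-(Real.log D / 10 ^ 10)) ≤ decay D F := by
  rw [decay]
  apply Real.exp_le_exp.2
  have h0 : 0 < Real.log D := Real.log_pos (by exact_mod_cast hD)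
  have hF0 : 0 < Real.log |F| := by linarith
  rw [neg_le_neg_iff, div_le_iff₀ (by positivity)]
  have : (Real.log D / 4) ^ 2 ≤ Real.log |F| ^ 2 := pow_le_pow_left₀ (by positivity) hF 2
  have := mul_le_mul_of_nonneg_left this (by positivity : 0 ≤ Real.log D / 10 ^ 10)
  nlinarith [pow_pos h0 3]

lemma weyl_decay {D R R' : ℕ} {F F' : ℝ} (hD : 2 ≤ D) (hR : D ≤ R ^ 4) (hRR' : R ≤ R')
    (hR' : R' ≤ 2 * R + 1) (hF' : (R : ℝ) ^ (1.22 : ℝ) ≤ |F'|) (hFF : |F'| ≤ |F|) :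
    ‖∑ r ∈ Ioc R R', ee (F' / r)‖ ≤ 2 * Real.exp 1000 * R * decay D F ^ 2 := by
  have hR2 : 2 ≤ R := by
    by_contra h
    have : R ^ 4 ≤ 1 ^ 4 := Nat.pow_le_pow_left (by omega) 4
    omega
  have hRpos : (0 : ℝ) < R := by positivity
  have hDpos : (0 : ℝ) < D := by positivity
  have hlD : 0 < Real.log D := Real.log_pos (by exact_mod_cast hD)
  have hlR : Real.log D / 4 ≤ Real.log R := by
    have : Real.log D ≤ Real.log ((R : ℝ) ^ 4) := Real.log_le_log hDpos (by exact_mod_cast hR)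
    rw [Real.log_pow] at this
    push_cast at this; linarith
  have hlF' : 1.22 * Real.log R ≤ Real.log |F'| := by
    have := Real.log_le_log (by positivity) hF'
    rwa [Real.log_rpow hRpos] at this
  have hF'pos : 0 < |F'| := lt_of_lt_of_le (by positivity) hF'
  have hlFF : Real.log |F'| ≤ Real.log |F| := Real.log_le_log hF'pos hFF
  have hcomp : Real.exp (-(1 / 10 ^ 9 * Real.log R ^ 3 / Real.log |F'| ^ 2)) ≤ decay D F ^ 2 := by
    rw [decay, ← Real.exp_nat_mul]
    apply Real.exp_le_exp.2
    have h1 : (Real.log D / 4) ^ 3 ≤ Real.log R ^ 3 := pow_le_pow_left₀ (by positivity) hlR 3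
    have h2 : 0 < Real.log |F'| := by linarith
    have h3 : 1 / 10 ^ 9 * (Real.log D / 4) ^ 3 / Real.log |F| ^ 2 ≤
        1 / 10 ^ 9 * Real.log R ^ 3 / Real.log |F'| ^ 2 := by gcongr
    have h4 : 2 * (1 / 10 ^ 12 * Real.log D ^ 3 / Real.log |F| ^ 2) ≤
        1 / 10 ^ 9 * (Real.log D / 4) ^ 3 / Real.log |F| ^ 2 := by
      rw [mul_div_assoc']
      refine div_le_div_of_nonneg_right ?_ (sq_nonneg _)
      have := pow_pos hlD 3
      rw [div_pow]
      linarith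
    push_cast
    linarith
  have hdec0 := decay_pos D F
  rcases Nat.lt_or_ge (2 * R) R' with h | h
  · have e : R' = 2 * R + 1 := by omega
    have h1 := weyl_sum_le (by omega : 1 ≤ R) (by omega : R ≤ 2 * R) le_rfl hF'
    rw [e, sum_Ioc_succ_top (by omega)]
    refine (norm_add_le _ _).trans ?_
    rw [norm_ee]
    have h2 : 1 ≤ R * decay D F ^ 2 := by
      have h3 := decay_ge (F := F) hD (by linarith)
      calc (1 : ℝ) ≤ Real.exp (Real.log R) * Real.exp (-(Real.log D / 10 ^ 10)) ^ 2 := by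
            rw [← Real.exp_nat_mul, ← Real.exp_add]
            apply Real.one_le_exp
            push_cast; linarith
        _ ≤ _ := by rw [Real.exp_log hRpos]; gcongr
    have h4 : (1 : ℝ) ≤ Real.exp 1000 := Real.one_le_exp (by norm_num)
    have h5 : Real.exp 1000 * R * Real.exp (-(1 / 10 ^ 9 * Real.log R ^ 3 / Real.log |F'| ^ 2)) ≤
      Real.exp 1000 * R * decay D F ^ 2 := by gcongr
    have h6 : 1 ≤ Real.exp 1000 * (R * decay D F ^ 2) := one_le_mul_of_one_le_of_one_le h4 h2
    linarith
  · refine (weyl_sum_le (by omega) hRR' h hF').trans ?_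
    gcongr
    have := Real.exp_pos 1000
    linarith

lemma typeI_inner {D D' b r : ℕ} {F : ℝ} (hD : 2 ≤ D) (hb : 1 ≤ b) (hbD : D ≤ (D / b) ^ 4)
    (hD' : D' ≤ 2 * D) (hF : (D : ℝ) ^ (1.85 : ℝ) ≤ |F|) (hr : D / b ≤ r) (hr' : r ≤ D' / b) :
    ‖∑ c ∈ Ioc (D / b) r, ee (F / ((b * c : ℕ) : ℝ))‖ ≤
      2 * Real.exp 1000 * (D * (1 / b)) * decay D F ^ 2 := by
  have hbpos : (0 : ℝ) < b := by positivity
  have hb1 : (1 : ℝ) ≤ b := by exact_mod_cast hb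
  have hDpos : (0 : ℝ) < D := by positivity
  have hD1 : (1 : ℝ) ≤ D := by exact_mod_cast (by omega : 1 ≤ D)
  have hle : ((D / b : ℕ) : ℝ) ≤ D / b := Nat.cast_div_le
  have e : ∀ c : ℕ, ee (F / ((b * c : ℕ) : ℝ)) = ee (F / b / c) := by
    intro c; push_cast; rw [div_div]
  simp_rw [e]
  have h := weyl_decay (D := D) (R := D / b) (R' := r) (F := F) (F' := F / b) hD hbD hr
    (by
      refine hr'.trans ?_
      have h1 : D' / b < 2 * (D / b) + 2 := by
        rw [Nat.div_lt_iff_lt_mul hb]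
        have := Nat.lt_mul_div_succ D hb
        nlinarith
      omega)
    (by
      rw [abs_div, abs_of_pos hbpos]
      calc ((D / b : ℕ) : ℝ) ^ (1.22 : ℝ) ≤ ((D : ℝ) / b) ^ (1.22 : ℝ) := by gcongr
        _ = (D : ℝ) ^ (1.22 : ℝ) / (b : ℝ) ^ (1.22 : ℝ) := Real.div_rpow hDpos.le hbpos.le _
        _ ≤ (D : ℝ) ^ (1.85 : ℝ) / (b : ℝ) ^ (1 : ℝ) := by
            gcongr <;> first | assumption | norm_num
        _ ≤ _ := by rw [Real.rpow_one]; gcongr)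
    (by
      rw [abs_div, abs_of_pos hbpos]
      exact div_le_self (abs_nonneg _) hb1)
  refine h.trans ?_
  rw [mul_one_div]
  have := decay_pos D F
  gcongr

lemma norm_sq_sum_mul_le {ι : Type*} (I : Finset ι) (a : ι → ℝ) (y : ι → ℂ) {A : ℝ}
    (ha : ∀ c ∈ I, |a c| ≤ A) :
    ‖∑ c ∈ I, (a c : ℂ) * y c‖ ^ 2 ≤ I.card * A ^ 2 * ∑ c ∈ I, ‖y c‖ ^ 2 := by
  calc ‖∑ c ∈ I, (a c : ℂ) * y c‖ ^ 2 ≤ (∑ c ∈ I, |a c| * ‖y c‖) ^ 2 := by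
        gcongr
        refine (norm_sum_le _ _).trans (le_of_eq (sum_congr rfl fun c _ => ?_))
        rw [norm_mul, Complex.norm_real, Real.norm_eq_abs]
    _ ≤ (∑ c ∈ I, |a c| ^ 2) * ∑ c ∈ I, ‖y c‖ ^ 2 := sum_mul_sq_le_sq_mul_sq _ _ _
    _ ≤ _ := by
        gcongr
        calc ∑ c ∈ I, |a c| ^ 2 ≤ ∑ _c ∈ I, A ^ 2 :=
              sum_le_sum fun c hc => pow_le_pow_left₀ (abs_nonneg _) (ha c hc) 2
          _ = _ := by simp

lemma typeII_inner {D D' M b b' : ℕ} {F : ℝ} (hD : 2 ≤ D) (hM : D ≤ M ^ 4) (hD' : D' ≤ 2 * D)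
    (hF : (2 * (M : ℝ)) ^ (1.22 : ℝ) ≤ |F| * M ^ 2 / (4 * D ^ 2)) (hb : b ∈ Ioc 0 (D' / M))
    (hb' : b' ∈ Ioc 0 (D' / M)) (hne : b ≠ b') :
    ‖∑ c ∈ (Ioc M (2 * M)).filter (fun c => (D / c < b ∧ b ≤ D' / c) ∧ (D / c < b' ∧ b' ≤ D' / c)),
      ee ((F / b - F / b') / c)‖ ≤ 4 * Real.exp 1000 * M * decay D F ^ 2 := by
  rw [mem_Ioc] at hb hb'
  have hM0 : 0 < M := Nat.pos_of_ne_zero fun h => by simp [h] at hM; omega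
  set R := max M (max (D / b) (D / b')) with hR
  set R' := min (2 * M) (min (D' / b) (D' / b')) with hR'
  have hset : (Ioc M (2 * M)).filter (fun c => (D / c < b ∧ b ≤ D' / c) ∧ (D / c < b' ∧ b' ≤ D' / c))
      = Ioc R R' := by
    ext c
    rw [mem_filter, mem_Ioc, mem_Ioc, hR, hR', max_lt_iff, max_lt_iff, le_min_iff, le_min_iff]
    by_cases hc : M < c
    · have hc0 : 0 < c := by omega
      rw [Nat.div_lt_iff_lt_mul hc0, Nat.div_lt_iff_lt_mul hc0, Nat.le_div_iff_mul_le hc0,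
        Nat.le_div_iff_mul_le hc0, Nat.div_lt_iff_lt_mul hb.1, Nat.div_lt_iff_lt_mul hb'.1,
        Nat.le_div_iff_mul_le hb.1, Nat.le_div_iff_mul_le hb'.1, mul_comm c b, mul_comm c b']
      tauto
    · tauto
  rw [hset]
  have hdec := decay_pos D F
  have hMpos : (0 : ℝ) < M := by positivity
  have hDpos : (0 : ℝ) < D := by positivity
  rcases Nat.lt_or_ge R' R with h | h
  · rw [Ioc_eq_empty (by omega), sum_empty, norm_zero]; positivity
  have hMR : M ≤ R := le_max_left _ _
  have hR2M : R ≤ 2 * M := h.trans (min_le_left _ _)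
  have hbr : (0 : ℝ) < b := by exact_mod_cast hb.1
  have hbr' : (0 : ℝ) < b' := by exact_mod_cast hb'.1
  have hbd : ∀ x : ℕ, x ≤ D' / M → (x : ℝ) * M ≤ 2 * D := by
    intro x hx
    have := (Nat.le_div_iff_mul_le hM0).1 hx
    exact_mod_cast this.trans hD'
  have h1 := hbd b hb.2
  have h2 := hbd b' hb'.2
  have hdiff : |F / b - F / b'| = |F| * (|(b' : ℝ) - b| / (b * b')) := by
    rw [div_sub_div _ _ hbr.ne' hbr'.ne', abs_div, abs_of_pos (mul_pos hbr hbr')]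
    rw [show F * (b' : ℝ) - b * F = F * (b' - b) by ring, abs_mul, mul_div_assoc]
  have hge1 : (1 : ℝ) ≤ |(b' : ℝ) - b| := by
    have : (1 : ℤ) ≤ |(b' : ℤ) - b| := Int.one_le_abs (by omega)
    exact_mod_cast this
  have hle : |(b' : ℝ) - b| ≤ b * b' := by
    have hb1 : (1 : ℝ) ≤ b := by exact_mod_cast hb.1
    have hb1' : (1 : ℝ) ≤ b' := by exact_mod_cast hb'.1
    rw [abs_le]; constructor <;> nlinarith
  refine (weyl_decay (D := D) (F := F) (F' := F / b - F / b') hD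
    (hM.trans (Nat.pow_le_pow_left hMR 4)) h ((min_le_left _ _).trans (by omega)) ?_ ?_).trans ?_
  · have hR2M' : (R : ℝ) ≤ 2 * M := by exact_mod_cast hR2M
    calc (R : ℝ) ^ (1.22 : ℝ) ≤ (2 * (M : ℝ)) ^ (1.22 : ℝ) := by gcongr
      _ ≤ |F| * M ^ 2 / (4 * D ^ 2) := hF
      _ ≤ _ := by
        rw [hdiff, mul_div_assoc]
        refine mul_le_mul_of_nonneg_left ?_ (abs_nonneg _)
        rw [div_le_div_iff₀ (by positivity) (by positivity)]
        have h3 : ((b : ℝ) * M) * (b' * M) ≤ (2 * D) * (2 * D) := by gcongr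
        have h4 : (1 : ℝ) * (4 * D ^ 2) ≤ |(b' : ℝ) - b| * (4 * D ^ 2) := by gcongr
        nlinarith
  · rw [hdiff]
    refine mul_le_of_le_one_right (abs_nonneg _) ?_
    rw [div_le_one (by positivity)]
    exact hle
  · have hR2M' : (R : ℝ) ≤ 2 * M := by exact_mod_cast hR2M
    have h5 := Real.exp_pos 1000
    calc 2 * Real.exp 1000 * R * decay D F ^ 2 ≤ 2 * Real.exp 1000 * (2 * M) * decay D F ^ 2 := by
          gcongr
      _ = _ := by ring

lemma typeII_block {D D' M : ℕ} {F : ℝ} (hD : 2 ≤ D) (hM : D ≤ M ^ 4) (hD' : D' ≤ 2 * D)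
    (hF : (2 * (M : ℝ)) ^ (1.22 : ℝ) ≤ |F| * M ^ 2 / (4 * D ^ 2)) (a α : ℕ → ℝ) {A : ℝ}
    (ha : ∀ c ∈ Ioc M (2 * M), |a c| ≤ A) :
    ‖∑ c ∈ Ioc M (2 * M), (a c : ℂ) * ∑ b ∈ Ioc (D / c) (D' / c), (α b : ℂ) * ee (F / ((c * b : ℕ) : ℝ))‖ ^ 2
      ≤ M * A ^ 2 * ((∑ b ∈ Ioc 0 (D' / M), |α b|) ^ 2 * (4 * Real.exp 1000 * M * decay D F ^ 2)
        + M * ∑ b ∈ Ioc 0 (D' / M), α b ^ 2) := by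
  classical
  have hM0 : 0 < M := Nat.pos_of_ne_zero fun h => by simp [h] at hM; omega
  refine (norm_sq_sum_mul_le _ _ _ ha).trans ?_
  have hcard : ((Ioc M (2 * M)).card : ℝ) = M := by
    rw [Nat.card_Ioc]; congr 1; omega
  rw [hcard]
  refine mul_le_mul_of_nonneg_left ?_ (by positivity)
  set B := Ioc 0 (D' / M) with hB
  set P : ℕ → ℕ → Prop := fun c b => D / c < b ∧ b ≤ D' / c with hP
  have hin : ∀ c ∈ Ioc M (2 * M), ∑ b ∈ Ioc (D / c) (D' / c), (α b : ℂ) * ee (F / ((c * b : ℕ) : ℝ)) =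
      ∑ b ∈ B, if P c b then (α b : ℂ) * ee (F / b / c) else 0 := by
    intro c hc
    rw [mem_Ioc] at hc
    rw [← sum_filter]
    have : B.filter (P c) = Ioc (D / c) (D' / c) := by
      ext b
      rw [mem_filter, hB, mem_Ioc, mem_Ioc, hP]
      simp only
      have : D' / c ≤ D' / M := Nat.div_le_div_left hc.1.le hM0
      constructor
      · rintro ⟨_, h⟩; exact h
      · rintro h; exact ⟨⟨Nat.lt_of_le_of_lt (Nat.zero_le _) h.1, h.2.trans this⟩, h⟩
    rw [this]
    refine sum_congr rfl fun b _ => ?_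
    congr 2; push_cast; rw [div_div, mul_comm (c : ℝ)]
  have hsq : ((∑ c ∈ Ioc M (2 * M), ‖∑ b ∈ Ioc (D / c) (D' / c), (α b : ℂ) * ee (F / ((c * b : ℕ) : ℝ))‖ ^ 2 : ℝ) : ℂ)
      = ∑ b ∈ B, ∑ b' ∈ B, ((α b * α b' : ℝ) : ℂ) *
        ∑ c ∈ (Ioc M (2 * M)).filter (fun c => P c b ∧ P c b'), ee ((F / b - F / b') / c) := by
    have step : ∀ c ∈ Ioc M (2 * M),
        ((‖∑ b ∈ Ioc (D / c) (D' / c), (α b : ℂ) * ee (F / ((c * b : ℕ) : ℝ))‖ ^ 2 : ℝ) : ℂ) =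
        ∑ b ∈ B, ∑ b' ∈ B, ((α b * α b' : ℝ) : ℂ) *
          (if P c b ∧ P c b' then ee ((F / b - F / b') / c) else 0) := by
      intro c hc
      rw [hin c hc]
      push_cast
      rw [← Complex.mul_conj', map_sum, sum_mul_sum]
      refine sum_congr rfl fun b _ => sum_congr rfl fun b' _ => ?_
      by_cases h1 : P c b <;> by_cases h2 : P c b' <;> simp only [h1, h2, if_true, if_false,
        and_true, and_false, mul_zero, zero_mul, map_zero]
      rw [map_mul, Complex.conj_ofReal, ← ee_neg, sub_div, sub_eq_add_neg, ee_add]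
      ring
    rw [Complex.ofReal_sum, sum_congr rfl step, sum_comm]
    refine sum_congr rfl fun b _ => ?_
    rw [sum_comm]
    refine sum_congr rfl fun b' _ => ?_
    rw [← mul_sum, sum_filter]
  set S := ∑ c ∈ Ioc M (2 * M), ‖∑ b ∈ Ioc (D / c) (D' / c), (α b : ℂ) * ee (F / ((c * b : ℕ) : ℝ))‖ ^ 2
    with hS
  set Q := 4 * Real.exp 1000 * M * decay D F ^ 2 with hQ
  have hQ0 : 0 ≤ Q := by positivity
  have hS0 : 0 ≤ S := sum_nonneg fun _ _ => by positivity
  calc S = ‖(S : ℂ)‖ := by rw [Complex.norm_real, Real.norm_of_nonneg hS0]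
    _ ≤ ∑ b ∈ B, ∑ b' ∈ B, (|α b| * |α b'| * Q + if b = b' then M * α b ^ 2 else 0) := by
        rw [hsq]
        refine (norm_sum_le _ _).trans (sum_le_sum fun b hb => ?_)
        refine (norm_sum_le _ _).trans (sum_le_sum fun b' hb' => ?_)
        rw [norm_mul, Complex.norm_real, Real.norm_eq_abs, abs_mul]
        split_ifs with h
        · subst h
          have h1 : ‖∑ c ∈ (Ioc M (2 * M)).filter (fun c => P c b ∧ P c b), ee ((F / b - F / b) / c)‖
              ≤ M := by
            refine (norm_sum_le _ _).trans ?_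
            simp only [norm_ee, sum_const, nsmul_eq_mul, mul_one]
            rw [← hcard]
            exact_mod_cast card_filter_le _ _
          have h2 : |α b| * |α b| = α b ^ 2 := by rw [← sq, sq_abs]
          rw [h2]
          have := mul_le_mul_of_nonneg_left h1 (sq_nonneg (α b))
          have h3 : 0 ≤ α b ^ 2 * Q := by positivity
          linarith
        · rw [add_zero]
          gcongr
          exact typeII_inner hD hM hD' hF hb hb' h
    _ = _ := by
        simp only [sum_add_distrib]
        congr 1
        · rw [sq, sum_mul_sum, sum_mul]
          refine sum_congr rfl fun b _ => ?_
          rw [sum_mul]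
        · rw [mul_sum]
          refine sum_congr rfl fun b hb => ?_
          rw [sum_ite_eq, if_pos hb]

end PowerSums

namespace PowerSums

open Finset

open ArithmeticFunction
open scoped ArithmeticFunction.Moebius ArithmeticFunction.zeta

lemma exists_cube_root {D : ℕ} (hD : 2 ≤ D) : ∃ z : ℕ, D ≤ z ^ 3 ∧ z ^ 3 ≤ 8 * D := by
  classical
  have hex : ∃ z : ℕ, D ≤ z ^ 3 := ⟨D, Nat.le_self_pow (by norm_num) D⟩
  refine ⟨Nat.find hex, Nat.find_spec hex, ?_⟩
  set z := Nat.find hex with hz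
  have hz2 : 2 ≤ z := by
    by_contra h
    have h1 : z ^ 3 ≤ 1 ^ 3 := Nat.pow_le_pow_left (by omega) 3
    have h2 : D ≤ z ^ 3 := Nat.find_spec hex
    omega
  have h1 : (z - 1) ^ 3 < D := not_le.1 (Nat.find_min hex (by omega))
  have h2 : z ^ 3 ≤ (2 * (z - 1)) ^ 3 := Nat.pow_le_pow_left (by omega) 3
  rw [mul_pow] at h2
  omega

lemma le_div_pow_four {D z b : ℕ} (hD : 2 ^ 36 ≤ D) (hz : z ^ 3 ≤ 8 * D) (hb : 1 ≤ b)
    (hbz : b ≤ z * z) : D ≤ (D / b) ^ 4 := by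
  set q := D / b with hq
  have h1 : D < b * (q + 1) := Nat.lt_mul_div_succ D hb
  have h2 : b ^ 3 ≤ (8 * D) ^ 2 := by
    calc b ^ 3 ≤ (z * z) ^ 3 := Nat.pow_le_pow_left hbz 3
      _ = (z ^ 3) ^ 2 := by ring
      _ ≤ _ := Nat.pow_le_pow_left hz 2
  have h3 : D < 64 * (q + 1) ^ 3 := by
    have h4 : D ^ 3 < (b * (q + 1)) ^ 3 := Nat.pow_lt_pow_left h1 (by norm_num)
    have h5 : (b * (q + 1)) ^ 3 ≤ (8 * D) ^ 2 * (q + 1) ^ 3 := by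
      rw [mul_pow]; exact Nat.mul_le_mul_right _ h2
    have h6 : D ^ 2 * D < D ^ 2 * (64 * (q + 1) ^ 3) := by
      calc D ^ 2 * D = D ^ 3 := by ring
        _ < _ := h4.trans_le h5
        _ = _ := by ring
    exact lt_of_mul_lt_mul_left h6 (Nat.zero_le _)
  have hq : 512 ≤ q := by
    by_contra h
    have : (q + 1) ^ 3 ≤ 512 ^ 3 := Nat.pow_le_pow_left (by omega) 3
    omega
  have h4 : (q + 1) ^ 3 ≤ (2 * q) ^ 3 := Nat.pow_le_pow_left (by omega) 3
  calc D ≤ 64 * (2 * q) ^ 3 := h3.le.trans (Nat.mul_le_mul_left _ h4)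
    _ = 512 * q ^ 3 := by ring
    _ ≤ q * q ^ 3 := Nat.mul_le_mul_right _ hq
    _ = q ^ 4 := by ring

lemma typeI_sum_le {D D' z : ℕ} {F : ℝ} (hD : 2 ^ 36 ≤ D) (hz : z ^ 3 ≤ 8 * D) (hDD' : D ≤ D')
    (hD' : D' ≤ 2 * D) (hF : (D : ℝ) ^ (1.85 : ℝ) ≤ |F|) {f w : ℕ → ℝ} {E W : ℝ}
    (hf : ∀ b ∈ Ioc 0 D', |f b| ≤ E) (hfz : ∀ b, z * z < b → f b = 0) (hw0 : ∀ c, 0 ≤ w c)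
    (hw : ∀ c, 0 < c → w c ≤ w (c + 1)) (hW : ∀ c ≤ D', w c ≤ W) :
    ‖∑ b ∈ Ioc 0 D', (f b : ℂ) * ∑ c ∈ Ioc (D / b) (D' / b), (w c : ℂ) * ee (F / ((b * c : ℕ) : ℝ))‖
      ≤ 4 * Real.exp 1000 * E * W * D * (1 + Real.log (2 * D)) * decay D F ^ 2 := by
  have hdec := decay_pos D F
  have hDpos : (0 : ℝ) < D := by
    have : 0 < D := by omega
    exact_mod_cast this
  have hD'1 : 1 ≤ D' := by omega
  have hE : 0 ≤ E := (abs_nonneg _).trans (hf 1 (by simp; omega))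
  have hWn : 0 ≤ W := (hw0 0).trans (hW 0 (Nat.zero_le _))
  calc _ ≤ ∑ b ∈ Ioc 0 D', E * (2 * W * (2 * Real.exp 1000 * (D * (1 / b)) * decay D F ^ 2)) := by
        refine (norm_sum_le _ _).trans (sum_le_sum fun b hb => ?_)
        have hb1 : 1 ≤ b := (mem_Ioc.1 hb).1
        rcases Nat.lt_or_ge (z * z) b with h | h
        · rw [hfz b h, Complex.ofReal_zero, zero_mul, norm_zero]; positivity
        rw [norm_mul, Complex.norm_real, Real.norm_eq_abs]
        refine mul_le_mul (hf b hb) ?_ (norm_nonneg _) hE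
        refine (abel_bound w _ (Nat.div_le_div_right hDD') hw0 (fun c hc => hw c (Nat.lt_of_le_of_lt (Nat.zero_le _) hc))
          (fun r hr hr' => typeI_inner (by omega) hb1 (le_div_pow_four hD hz hb1 h) hD' hF hr hr')).trans ?_
        have := hW (D' / b) (Nat.div_le_self _ _)
        gcongr
    _ = 4 * Real.exp 1000 * E * W * D * (∑ b ∈ Ioc 0 D', 1 / (b : ℝ)) * decay D F ^ 2 := by
        rw [mul_sum, sum_mul]
        refine sum_congr rfl fun b _ => ?_
        ring
    _ ≤ _ := by
        gcongr
        refine (sum_inv_le D').trans ?_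
        have : (0 : ℝ) < D' := by exact_mod_cast hD'1
        gcongr
        exact_mod_cast hD'

lemma sum_abs_alpha_le (z B : ℕ) : ∑ b ∈ Ioc 0 B, |alpha z b| ≤ B * (1 + Real.log B) :=
  (sum_le_sum fun b _ => abs_alpha_le z b).trans (sum_card_divisors_le B)

lemma sum_sq_alpha_le (z B : ℕ) :
    ∑ b ∈ Ioc 0 B, alpha z b ^ 2 ≤ 2 * B.sqrt * (B * (1 + Real.log B)) := by
  calc ∑ b ∈ Ioc 0 B, alpha z b ^ 2 ≤ ∑ b ∈ Ioc 0 B, 2 * (B.sqrt : ℝ) * b.divisors.card := by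
        refine sum_le_sum fun b hb => ?_
        have h1 := abs_alpha_le z b
        have h2 : (b.divisors.card : ℝ) ≤ 2 * B.sqrt := by
          have h3 := card_divisors_le_two_mul_sqrt b
          have h4 : b.sqrt ≤ B.sqrt := Nat.sqrt_le_sqrt (mem_Ioc.1 hb).2
          exact_mod_cast h3.trans (by omega)
        rw [← sq_abs, sq]
        exact mul_le_mul (h1.trans h2) h1 (abs_nonneg _) (by positivity)
    _ ≤ _ := by
        rw [← mul_sum]
        exact mul_le_mul_of_nonneg_left (sum_card_divisors_le B) (by positivity)

lemma abs_vonMangoldt_sub_trunc_le (z c : ℕ) : |(Λ - trunc z Λ) c| ≤ Real.log c := by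
  rw [show (Λ - trunc z Λ) c = Λ c - trunc z Λ c from rfl, trunc_apply]
  split_ifs
  · rw [sub_self, abs_zero]; exact Real.log_natCast_nonneg c
  · rw [sub_zero, abs_of_nonneg vonMangoldt_nonneg]; exact vonMangoldt_le_log

lemma typeII_freq {D M : ℕ} {F : ℝ} (hD : 2 ^ 36 ≤ D) (hM : D ≤ M ^ 3)
    (hF : (D : ℝ) ^ (1.85 : ℝ) ≤ |F|) :
    (2 * (M : ℝ)) ^ (1.22 : ℝ) ≤ |F| * M ^ 2 / (4 * D ^ 2) := by
  have hM0 : 0 < M := Nat.pos_of_ne_zero fun h => by simp [h] at hM; omega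
  have hMpos : (0 : ℝ) < M := by exact_mod_cast hM0
  have hDpos : (0 : ℝ) < D := by
    have : 0 < D := by omega
    exact_mod_cast this
  have hFpos : 0 < |F| := lt_of_lt_of_le (by positivity) hF
  have hlD : 36 * Real.log 2 ≤ Real.log D := by
    have h : Real.log ((2 : ℝ) ^ 36) ≤ Real.log D := Real.log_le_log (by positivity) (by exact_mod_cast hD)
    rw [Real.log_pow] at h; exact_mod_cast h
  have hlM : Real.log D ≤ 3 * Real.log M := by
    have h : Real.log D ≤ Real.log ((M : ℝ) ^ 3) := Real.log_le_log hDpos (by exact_mod_cast hM)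
    rw [Real.log_pow] at h; exact_mod_cast h
  have hlF : 1.85 * Real.log D ≤ Real.log |F| := by
    have := Real.log_le_log (by positivity) hF
    rwa [Real.log_rpow hDpos] at this
  rw [← Real.log_le_log_iff (by positivity) (by positivity), Real.log_rpow (by positivity),
    Real.log_mul (by norm_num) hMpos.ne', Real.log_div (by positivity) (by positivity),
    Real.log_mul hFpos.ne' (by positivity), Real.log_mul (by norm_num) (by positivity),
    Real.log_pow, Real.log_pow, show (4 : ℝ) = 2 ^ 2 by norm_num, Real.log_pow]
  have := Real.log_two_gt_d9
  push_cast
  linarith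

lemma typeII_block_le {D D' z M : ℕ} {F : ℝ} (hD : 2 ^ 36 ≤ D) (hz : D ≤ z ^ 3) (hzM : z ≤ M)
    (hM : 2 * M ≤ 2 * D) (hD' : D' ≤ 2 * D) (hMz : z * M ≤ D') (hF : (D : ℝ) ^ (1.85 : ℝ) ≤ |F|) :
    ‖∑ c ∈ Ioc M (2 * M), ((Λ - trunc z Λ) c : ℂ) *
      ∑ b ∈ Ioc (D / c) (D' / c), (alpha z b : ℂ) * ee (F / ((c * b : ℕ) : ℝ))‖ ≤
      5 * Real.exp 500 * D * (1 + Real.log (2 * D)) ^ 2 * decay D F := by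
  have hz0 : 0 < z := Nat.pos_of_ne_zero fun h => by simp [h] at hz; omega
  have hM0 : 0 < M := by omega
  have hDpos : (0 : ℝ) < D := by
    have : 0 < D := by omega
    exact_mod_cast this
  have hMpos : (0 : ℝ) < M := by exact_mod_cast hM0
  have hzpos : (0 : ℝ) < z := by exact_mod_cast hz0
  have hDM3 : D ≤ M ^ 3 := hz.trans (Nat.pow_le_pow_left hzM 3)
  have hDM : D ≤ M ^ 4 := hDM3.trans (Nat.pow_le_pow_right hM0 (by norm_num))
  have hD1 : (1 : ℝ) ≤ D := by exact_mod_cast (by omega : 1 ≤ D)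
  have hlD : 0 ≤ Real.log D := Real.log_nonneg hD1
  set ℓ := 1 + Real.log (2 * D) with hℓ
  have hℓ1 : 1 ≤ ℓ := by
    have : 0 ≤ Real.log (2 * (D : ℝ)) := Real.log_nonneg (by linarith)
    linarith
  set δ := decay D F with hδ
  have hδ0 : 0 < δ := decay_pos D F
  set B := D' / M with hB
  have hBM : (B : ℝ) * M ≤ 2 * D := by
    have h := Nat.div_mul_le_self D' M
    exact_mod_cast h.trans hD'
  have hlB : 1 + Real.log B ≤ ℓ := by
    have hBD : B ≤ 2 * D := (Nat.div_le_self _ _).trans hD'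
    have hB1 : 0 < B := Nat.div_pos (by nlinarith) hM0
    have : Real.log B ≤ Real.log (2 * D) := Real.log_le_log (by exact_mod_cast hB1) (by exact_mod_cast hBD)
    linarith
  have hzδ : 1 ≤ z * δ ^ 4 := by
    have hlF : 1.85 * Real.log D ≤ Real.log |F| := by
      have := Real.log_le_log (by positivity) hF
      rwa [Real.log_rpow hDpos] at this
    have h3 := decay_ge (F := F) (by omega : 2 ≤ D) (by linarith)
    have hlz : Real.log D ≤ 3 * Real.log z := by
      have h : Real.log D ≤ Real.log ((z : ℝ) ^ 3) := Real.log_le_log hDpos (by exact_mod_cast hz)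
      rw [Real.log_pow] at h; exact_mod_cast h
    calc (1 : ℝ) ≤ Real.exp (Real.log z) * Real.exp (-(Real.log D / 10 ^ 10)) ^ 4 := by
          rw [← Real.exp_nat_mul, ← Real.exp_add]
          apply Real.one_le_exp
          push_cast; linarith
      _ ≤ _ := by rw [Real.exp_log hzpos]; gcongr
  have hMs : (M : ℝ) * B.sqrt ≤ 2 * D * δ ^ 2 := by
    refine le_of_pow_le_pow_left₀ two_ne_zero (by positivity) ?_
    have h1 : ((B.sqrt : ℕ) : ℝ) ^ 2 ≤ B := by exact_mod_cast Nat.sqrt_le' B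
    have h2 : (z : ℝ) * M ≤ 2 * D := by exact_mod_cast hMz.trans hD'
    calc ((M : ℝ) * (B.sqrt : ℝ)) ^ 2 = (M : ℝ) ^ 2 * (B.sqrt : ℝ) ^ 2 := by ring
      _ ≤ (M : ℝ) ^ 2 * (B : ℝ) := by gcongr
      _ = ((B : ℝ) * M) * M := by ring
      _ ≤ 2 * D * M := by gcongr
      _ ≤ 2 * D * M * (z * δ ^ 4) := le_mul_of_one_le_right (by positivity) hzδ
      _ = 2 * D * (z * M) * δ ^ 4 := by ring
      _ ≤ 2 * D * (2 * D) * δ ^ 4 := by gcongr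
      _ = _ := by ring
  have hblock := typeII_block (D := D) (D' := D') (M := M) (F := F) (by omega) hDM hD'
    (typeII_freq hD hDM3 hF) (fun c => (Λ - trunc z Λ) c) (fun b => alpha z b) (A := ℓ) (by
      intro c hc
      rw [mem_Ioc] at hc
      have hc0 : 0 < c := by omega
      have : Real.log c ≤ Real.log (2 * D) :=
        Real.log_le_log (by exact_mod_cast hc0) (by exact_mod_cast hc.2.trans hM)
      have := abs_vonMangoldt_sub_trunc_le z c
      linarith)
  refine le_of_pow_le_pow_left₀ two_ne_zero (by positivity) (hblock.trans ?_)
  have hα1 : ∑ b ∈ Ioc 0 B, |alpha z b| ≤ B * ℓ :=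
    (sum_abs_alpha_le z B).trans (by gcongr)
  have hα2 : ∑ b ∈ Ioc 0 B, alpha z b ^ 2 ≤ 2 * B.sqrt * (B * ℓ) :=
    (sum_sq_alpha_le z B).trans (by gcongr)
  have hα0 : 0 ≤ ∑ b ∈ Ioc 0 B, |alpha z b| := sum_nonneg fun _ _ => abs_nonneg _
  have he : Real.exp 1000 = Real.exp 500 ^ 2 := by rw [← Real.exp_nat_mul]; norm_num
  have he1 : 1 ≤ Real.exp 1000 := Real.one_le_exp (by norm_num)
  calc (M : ℝ) * ℓ ^ 2 * ((∑ b ∈ Ioc 0 B, |alpha z b|) ^ 2 * (4 * Real.exp 1000 * M * δ ^ 2)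
        + M * ∑ b ∈ Ioc 0 B, alpha z b ^ 2)
      ≤ M * ℓ ^ 2 * ((B * ℓ) ^ 2 * (4 * Real.exp 1000 * M * δ ^ 2)
        + M * (2 * B.sqrt * (B * ℓ))) := by gcongr
    _ = 4 * Real.exp 1000 * ℓ ^ 4 * δ ^ 2 * (B * M) ^ 2 + 2 * ℓ ^ 3 * ((M * B.sqrt) * (B * M)) := by ring
    _ ≤ 4 * Real.exp 1000 * ℓ ^ 4 * δ ^ 2 * (2 * D) ^ 2 + 2 * ℓ ^ 3 * ((2 * D * δ ^ 2) * (2 * D)) := by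
        gcongr
    _ = 16 * Real.exp 1000 * (D ^ 2 * ℓ ^ 4 * δ ^ 2) + 8 * (1 * 1) * (D ^ 2 * ℓ ^ 3 * δ ^ 2) := by ring
    _ ≤ 16 * Real.exp 1000 * (D ^ 2 * ℓ ^ 4 * δ ^ 2) + 8 * (Real.exp 1000 * ℓ) * (D ^ 2 * ℓ ^ 3 * δ ^ 2) := by
        gcongr
    _ = 24 * (Real.exp 1000 * D ^ 2 * ℓ ^ 4 * δ ^ 2) := by ring
    _ ≤ 25 * (Real.exp 1000 * D ^ 2 * ℓ ^ 4 * δ ^ 2) := by gcongr; norm_num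
    _ = _ := by rw [he]; ring

lemma sum_Ioc_dyadic {G : Type*} [AddCommMonoid G] (T : ℕ → G) (z I : ℕ) :
    ∑ c ∈ Ioc z (2 ^ I * z), T c = ∑ i ∈ range I, ∑ c ∈ Ioc (2 ^ i * z) (2 * (2 ^ i * z)), T c := by
  induction I with
  | zero => simp
  | succ I ih =>
    rw [sum_range_succ, ← ih, show 2 ^ (I + 1) * z = 2 * (2 ^ I * z) by ring,
      sum_Ioc_consecutive _ (Nat.le_mul_of_pos_left _ (by positivity)) (by omega)]

lemma typeII_sum_le {D D' z : ℕ} {F : ℝ} (hD : 2 ^ 36 ≤ D) (hz : D ≤ z ^ 3)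
    (hD' : D' ≤ 2 * D) (hDD' : D ≤ D') (hF : (D : ℝ) ^ (1.85 : ℝ) ≤ |F|) :
    ‖∑ c ∈ Ioc 0 D', ((Λ - trunc z Λ) c : ℂ) *
      ∑ b ∈ Ioc (D / c) (D' / c), (alpha z b : ℂ) * ee (F / ((c * b : ℕ) : ℝ))‖ ≤
      10 * Real.exp 500 * D * (1 + Real.log (2 * D)) ^ 3 * decay D F := by
  have hz2 : 2 ≤ z := by
    by_contra h
    have : z ^ 3 ≤ 1 ^ 3 := Nat.pow_le_pow_left (by omega) 3
    omega
  have hDpos : (0 : ℝ) < D := by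
    have : 0 < D := by omega
    exact_mod_cast this
  have hδ := decay_pos D F
  set T : ℕ → ℂ := fun c => ((Λ - trunc z Λ) c : ℂ) *
      ∑ b ∈ Ioc (D / c) (D' / c), (alpha z b : ℂ) * ee (F / ((c * b : ℕ) : ℝ)) with hT
  set I := Nat.log 2 D' + 1 with hI
  have hTz : ∀ c ≤ z, T c = 0 := by
    intro c hc
    rw [hT]; simp only
    rw [show (Λ - trunc z Λ) c = Λ c - trunc z Λ c from rfl, trunc_apply, if_pos hc, sub_self,
      Complex.ofReal_zero, zero_mul]
  have hTα : ∀ c, D' / c ≤ z → T c = 0 := by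
    intro c hc
    rw [hT]; simp only
    rw [sum_eq_zero, mul_zero]
    intro b hb
    rw [alpha_eq_zero ((mem_Ioc.1 hb).2.trans hc), Complex.ofReal_zero, zero_mul]
  have hID : D' < 2 ^ I := Nat.lt_pow_succ_log_self (by norm_num) D'
  have hsplit : ∑ c ∈ Ioc 0 D', T c = ∑ c ∈ Ioc z (2 ^ I * z), T c := by
    have e1 : ∑ c ∈ Ioc 0 D', T c = ∑ c ∈ Ioc 0 (2 ^ I * z), T c := by
      refine sum_subset (fun c hc => ?_) (fun c hc hc' => ?_)
      · rw [mem_Ioc] at hc ⊢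
        exact ⟨hc.1, hc.2.trans (hID.le.trans (Nat.le_mul_of_pos_right _ (by omega)))⟩
      · rw [mem_Ioc] at hc hc'
        apply hTα
        rw [Nat.div_eq_of_lt (by omega)]; exact Nat.zero_le _
    rw [e1]
    symm
    refine sum_subset (fun c hc => ?_) (fun c hc hc' => ?_)
    · rw [mem_Ioc] at hc ⊢
      exact ⟨by omega, hc.2⟩
    · rw [mem_Ioc] at hc hc'
      exact hTz c (by omega)
  have hIL : (I : ℝ) ≤ 2 * (1 + Real.log (2 * D)) := by
    have h1 : 2 ^ Nat.log 2 D' ≤ 2 * D := (Nat.pow_log_le_self 2 (by omega)).trans hD'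
    have h2 : Real.log ((2 : ℝ) ^ Nat.log 2 D') ≤ Real.log (2 * D) :=
      Real.log_le_log (by positivity) (by exact_mod_cast h1)
    rw [Real.log_pow] at h2
    have h3 := Real.log_two_gt_d9
    have h4 : (0 : ℝ) ≤ Nat.log 2 D' := Nat.cast_nonneg _
    rw [hI]; push_cast
    nlinarith
  rw [hsplit, sum_Ioc_dyadic]
  calc _ ≤ ∑ i ∈ range I, 5 * Real.exp 500 * D * (1 + Real.log (2 * D)) ^ 2 * decay D F := by
        refine (norm_sum_le _ _).trans (sum_le_sum fun i _ => ?_)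
        set M := 2 ^ i * z with hM
        have hzM : z ≤ M := Nat.le_mul_of_pos_left _ (by positivity)
        rcases Nat.lt_or_ge D' (z * M) with h | h
        · rw [sum_eq_zero, norm_zero]
          · positivity
          intro c hc
          apply hTα
          rw [mem_Ioc] at hc
          have : D' / c < z := by
            rw [Nat.div_lt_iff_lt_mul (by omega)]
            exact h.trans_le (Nat.mul_le_mul_left _ hc.1.le)
          exact this.le
        · refine typeII_block_le hD hz hzM ?_ hD' h hF
          have : 2 * M ≤ z * M := Nat.mul_le_mul_right _ hz2
          omega
    _ = I * (5 * Real.exp 500 * D * (1 + Real.log (2 * D)) ^ 2 * decay D F) := by simp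
    _ ≤ 2 * (1 + Real.log (2 * D)) * (5 * Real.exp 500 * D * (1 + Real.log (2 * D)) ^ 2 * decay D F) := by
        gcongr
    _ = _ := by ring

theorem vonMangoldt_sum_le {D D' : ℕ} {F : ℝ} (hD : 2 ^ 36 ≤ D) (hDD' : D ≤ D')
    (hD' : D' ≤ 2 * D) (hF : (D : ℝ) ^ (1.85 : ℝ) ≤ |F|) :
    ‖∑ d ∈ Ioc D D', (Λ d : ℂ) * ee (F / d)‖ ≤
      18 * Real.exp 1000 * D * (1 + Real.log (2 * D)) ^ 3 * decay D F := by
  obtain ⟨z, hz, hz'⟩ := exists_cube_root (by omega : 2 ≤ D)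
  have hDpos : (0 : ℝ) < D := by
    have : 0 < D := by omega
    exact_mod_cast this
  have hz0 : 1 ≤ z := Nat.pos_of_ne_zero fun h => by simp [h] at hz; omega
  have hδ0 := decay_pos D F
  have hδ1 := decay_le_one (by omega : 1 ≤ D) F
  set ℓ := 1 + Real.log (2 * D) with hℓ
  have hD1 : (1 : ℝ) ≤ D := by exact_mod_cast (by omega : 1 ≤ D)
  have hℓ1 : 1 ≤ ℓ := by
    have : 0 ≤ Real.log (2 * (D : ℝ)) := Real.log_nonneg (by linarith)
    linarith
  have hlog : ∀ c ≤ D', Real.log c ≤ ℓ := by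
    intro c hc
    rcases Nat.eq_zero_or_pos c with h | h
    · rw [h]; simp; linarith
    have : Real.log c ≤ Real.log (2 * D) :=
      Real.log_le_log (by exact_mod_cast h) (by exact_mod_cast hc.trans hD')
    linarith
  set a1 : ArithmeticFunction ℝ := trunc z (μ : ArithmeticFunction ℝ) with ha1
  set a2 : ArithmeticFunction ℝ := a1 * trunc z Λ with ha2
  set a3 : ArithmeticFunction ℝ := Λ - trunc z Λ with ha3
  have hconv : ∀ f g : ArithmeticFunction ℝ, ∑ d ∈ Ioc D D', ((f * g) d : ℂ) * ee (F / d) =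
      ∑ b ∈ Ioc 0 D', (f b : ℂ) * ∑ c ∈ Ioc (D / b) (D' / b), (g c : ℂ) * ee (F / ((b * c : ℕ) : ℝ)) := by
    intro f g
    exact sum_conv (fun b => f b) (fun c => g c) (fun d => ee (F / d)) D D'
  have hdecomp : ∀ d ∈ Ioc D D', (Λ d : ℂ) * ee (F / d) = ((a1 * log) d : ℂ) * ee (F / d)
      - ((a2 * (ζ : ArithmeticFunction ℝ)) d : ℂ) * ee (F / d) + ((a3 * alpha z) d : ℂ) * ee (F / d) := by
    intro d hd
    have hdz : ¬ d ≤ z := by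
      rw [mem_Ioc] at hd
      intro h
      have h1 : D < z := by omega
      have h2 : 9 * z ≤ z * z * z := by
        apply Nat.mul_le_mul_right
        nlinarith
      have h3 : z ^ 3 = z * z * z := by ring
      omega
    have h1 := congrArg (fun f : ArithmeticFunction ℝ => f d) (vaughan z)
    have h2 : Λ d = trunc z Λ d + (a1 * log) d - (a2 * (ζ : ArithmeticFunction ℝ)) d + (alpha z * a3) d := h1
    rw [trunc_apply, if_neg hdz, zero_add, mul_comm (alpha z)] at h2
    rw [h2]; push_cast; ring
  rw [sum_congr rfl hdecomp, sum_add_distrib, sum_sub_distrib, hconv, hconv, hconv]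
  have t1 := typeI_sum_le hD hz' hDD' hD' hF (f := fun b => a1 b) (w := fun c => log c) (E := 1) (W := ℓ)
    (fun b _ => (abs_trunc_le z _ b).trans (abs_moebius_real_le b))
    (fun b hb => by
      have : ¬ b ≤ z := by nlinarith
      simp only [ha1, trunc_apply, if_neg this])
    (fun c => Real.log_natCast_nonneg c)
    (fun c hc => Real.log_le_log (by exact_mod_cast hc) (by push_cast; linarith))
    hlog
  have t2 := typeI_sum_le hD hz' hDD' hD' hF (f := fun b => a2 b)
    (w := fun c => if c = 0 then 0 else 1) (E := ℓ) (W := 1)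
    (fun b hb => (abs_typeI_coeff_le z b).trans (hlog b (mem_Ioc.1 hb).2))
    (fun b hb => typeI_coeff_eq_zero hb)
    (fun c => by split_ifs <;> norm_num)
    (fun c hc => by simp [hc.ne'])
    (fun c _ => by split_ifs <;> norm_num)
  have t3 := typeII_sum_le hD hz hD' hDD' hF
  have e2 : ∀ c : ℕ, (((ζ : ArithmeticFunction ℝ) c : ℝ) : ℂ) = ((if c = 0 then (0 : ℝ) else 1 : ℝ) : ℂ) := by
    intro c; rw [natCoe_apply, zeta_apply]; split_ifs <;> simp
  simp only [e2]
  have he : Real.exp 500 ≤ Real.exp 1000 := Real.exp_le_exp.2 (by norm_num)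
  have hδ2 : decay D F ^ 2 ≤ decay D F := by nlinarith
  have hX : 4 * Real.exp 1000 * D * ℓ ^ 2 * decay D F ^ 2 ≤ 4 * Real.exp 1000 * D * ℓ ^ 3 * decay D F := by
    gcongr; norm_num
  have hY : 10 * Real.exp 500 * D * ℓ ^ 3 * decay D F ≤ 10 * Real.exp 1000 * D * ℓ ^ 3 * decay D F := by
    gcongr
  refine (norm_add_le _ _).trans ?_
  refine (add_le_add_left (norm_sub_le _ _) _).trans ?_
  have t1' := t1
  have t2' := t2
  have r1 : 4 * Real.exp 1000 * 1 * ℓ * D * ℓ * decay D F ^ 2 = 4 * Real.exp 1000 * D * ℓ ^ 2 * decay D F ^ 2 := by ring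
  have r2 : 4 * Real.exp 1000 * ℓ * 1 * D * ℓ * decay D F ^ 2 = 4 * Real.exp 1000 * D * ℓ ^ 2 * decay D F ^ 2 := by ring
  rw [r1] at t1
  rw [r2] at t2
  refine (add_le_add (add_le_add t1 t2) t3).trans ?_
  linarith

end PowerSums

namespace PowerSums

open Finset

lemma cos_two_pi_le {c v : ℝ} (hc : 0 ≤ c) (h1 : c ≤ v) (h2 : v ≤ 1 - c) :
    Real.cos (2 * Real.pi * v) ≤ Real.cos (2 * Real.pi * c) := by
  have hpi := Real.pi_pos
  rcases le_total v (1 / 2) with h | h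
  · exact Real.cos_le_cos_of_nonneg_of_le_pi (by positivity) (by nlinarith) (by nlinarith)
  · have e : Real.cos (2 * Real.pi * v) = Real.cos (2 * Real.pi * (1 - v)) := by
      rw [show 2 * Real.pi * (1 - v) = 2 * Real.pi - 2 * Real.pi * v by ring, Real.cos_two_pi_sub]
    rw [e]
    exact Real.cos_le_cos_of_nonneg_of_le_pi (by positivity) (by nlinarith) (by nlinarith)

/-- A nonnegative trigonometric polynomial concentrated near `1 / 64` modulo `1`. -/
noncomputable def peak (q : ℕ) (x : ℝ) : ℝ := ((1 + Real.cos (2 * Real.pi * (x - 1 / 64))) / 2) ^ q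

/-- A trigonometric polynomial which is nonpositive on `[0, 1 / 8]` modulo `1`. -/
noncomputable def gap (y : ℝ) : ℝ := Real.cos (Real.pi / 8) - Real.cos (2 * Real.pi * (y - 1 / 16))

/-- The maximum of `peak` away from `[0, 1 / 32]`. -/
noncomputable def tail (q : ℕ) : ℝ := ((1 + Real.cos (Real.pi / 32)) / 2) ^ q

lemma peak_nonneg (q : ℕ) (x : ℝ) : 0 ≤ peak q x := by
  have := Real.neg_one_le_cos (2 * Real.pi * (x - 1 / 64))
  exact pow_nonneg (by linarith) q

lemma peak_le_one (q : ℕ) (x : ℝ) : peak q x ≤ 1 := by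
  have := Real.neg_one_le_cos (2 * Real.pi * (x - 1 / 64))
  have := Real.cos_le_one (2 * Real.pi * (x - 1 / 64))
  exact pow_le_one₀ (by linarith) (by linarith)

lemma gap_le_two (y : ℝ) : gap y ≤ 2 := by
  have := Real.neg_one_le_cos (2 * Real.pi * (y - 1 / 16))
  have := Real.cos_le_one (Real.pi / 8)
  rw [gap]; linarith

lemma tail_nonneg (q : ℕ) : 0 ≤ tail q := by
  have := Real.neg_one_le_cos (Real.pi / 32)
  exact pow_nonneg (by linarith) q

lemma cos_nat_div (n d : ℕ) (hd : 0 < d) (u : ℝ) :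
    Real.cos (2 * Real.pi * ((n : ℝ) / d - u)) = Real.cos (2 * Real.pi * (((n % d : ℕ) : ℝ) / d - u)) := by
  have h : (n : ℝ) / d = ((n % d : ℕ) : ℝ) / d + (n / d : ℕ) := by
    have h1 : (n : ℝ) = ((n % d : ℕ) : ℝ) + d * (n / d : ℕ) := by exact_mod_cast (Nat.mod_add_div n d).symm
    have : (d : ℝ) ≠ 0 := by positivity
    field_simp
    linarith
  rw [h, show 2 * Real.pi * (((n % d : ℕ) : ℝ) / d + (n / d : ℕ) - u) =
    2 * Real.pi * (((n % d : ℕ) : ℝ) / d - u) + (n / d : ℕ) * (2 * Real.pi) by ring,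
    Real.cos_add_nat_mul_two_pi]

lemma peak_le_tail {q n d : ℕ} (hd : 0 < d) (h : d ≤ 32 * (n % d)) : peak q (n / d) ≤ tail q := by
  rw [peak, cos_nat_div n d hd, tail]
  have hdpos : (0 : ℝ) < d := by exact_mod_cast hd
  have h1 : (1 : ℝ) / 32 ≤ ((n % d : ℕ) : ℝ) / d := by
    rw [div_le_div_iff₀ (by norm_num) hdpos]
    have : (d : ℝ) ≤ 32 * ((n % d : ℕ) : ℝ) := by exact_mod_cast h
    linarith
  have h2 : ((n % d : ℕ) : ℝ) / d ≤ 1 := by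
    rw [div_le_one hdpos]; exact_mod_cast (Nat.mod_lt n hd).le
  have h3 := cos_two_pi_le (c := 1 / 64) (v := ((n % d : ℕ) : ℝ) / d - 1 / 64) (by norm_num)
    (by linarith) (by linarith)
  rw [show 2 * Real.pi * (1 / 64) = Real.pi / 32 by ring] at h3
  have := Real.neg_one_le_cos (2 * Real.pi * (((n % d : ℕ) : ℝ) / d - 1 / 64))
  gcongr
  linarith

lemma gap_nonpos {n d : ℕ} (hd : 0 < d) (h : 8 * (n % d) ≤ d) : gap (n / d) ≤ 0 := by
  rw [gap, cos_nat_div n d hd, sub_nonpos]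
  have hdpos : (0 : ℝ) < d := by exact_mod_cast hd
  have h1 : ((n % d : ℕ) : ℝ) / d ≤ 1 / 8 := by
    rw [div_le_div_iff₀ hdpos (by norm_num)]
    have : 8 * ((n % d : ℕ) : ℝ) ≤ d := by exact_mod_cast h
    linarith
  have h0 : 0 ≤ ((n % d : ℕ) : ℝ) / d := by positivity
  have hpi := Real.pi_pos
  rw [← Real.cos_abs (2 * Real.pi * _)]
  have h2 : |2 * Real.pi * (((n % d : ℕ) : ℝ) / d - 1 / 16)| ≤ Real.pi / 8 := by
    rw [abs_le]; constructor <;> nlinarith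
  exact Real.cos_le_cos_of_nonneg_of_le_pi (abs_nonneg _) (by linarith) h2

lemma ee_add_ee_neg (x : ℝ) : ee x + ee (-x) = ((2 * Real.cos (2 * Real.pi * x) : ℝ) : ℂ) := by
  rw [ee, ee]
  push_cast
  rw [Complex.two_cos]
  congr 2 
  ring

lemma peak_expansion (q : ℕ) (x : ℝ) :
    (peak q x : ℂ) = ∑ j ∈ range (2 * q + 1), (((2 * q).choose j / 4 ^ q : ℝ) : ℂ) *
      ee (((j : ℝ) - q) * (x - 1 / 64)) := by
  set u := x - 1 / 64 with hu
  have h1 : (((1 + Real.cos (2 * Real.pi * u)) / 2 : ℝ) : ℂ) = ee (-u) * (ee u + 1) ^ 2 / 4 := by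
    have h2 := ee_add_ee_neg u
    have h3 : ee (-u) * ee u = 1 := by rw [← ee_add, neg_add_cancel, ee_zero]
    have h4 : ee (-u) * (ee u + 1) ^ 2 = ee u + 2 + ee (-u) := by linear_combination (ee u + 2) * h3
    rw [h4]
    push_cast at h2 ⊢
    linear_combination (-1 / 4) * h2
  have hnat : ∀ (k : ℕ) (y : ℝ), ee y ^ k = ee (k * y) := by
    intro k y
    rw [ee, ee, ← Complex.exp_nat_mul]; congr 1; push_cast; ring
  rw [peak, Complex.ofReal_pow, h1, div_pow, mul_pow, ← pow_mul, add_pow, mul_sum, sum_div]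
  refine sum_congr rfl fun j _ => ?_
  rw [one_pow, mul_one, hnat, hnat, ← mul_assoc, ← ee_add]
  rw [show (q : ℝ) * -u + j * u = (j - q) * u by ring]
  push_cast
  ring

lemma gap_expansion (y : ℝ) :
    (gap y : ℂ) = (Real.cos (Real.pi / 8) : ℂ) - 1 / 2 * (ee (y - 1 / 16) + ee (-(y - 1 / 16))) := by
  rw [ee_add_ee_neg, gap]
  push_cast; ring

lemma sum_choose_div (q : ℕ) : ∑ j ∈ range (2 * q + 1), ((2 * q).choose j / 4 ^ q : ℝ) = 1 := by
  rw [← sum_div, ← Nat.cast_sum, Nat.sum_range_choose, pow_mul]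
  norm_num

lemma half_le_cos_pi_div_eight : 1 / 2 ≤ Real.cos (Real.pi / 8) := by
  have hpi := Real.pi_pos
  rw [← Real.cos_pi_div_three]
  exact Real.cos_le_cos_of_nonneg_of_le_pi (by linarith) (by linarith) (by linarith)

lemma exists_mean_pos : ∃ q : ℕ, 0 < Real.cos (Real.pi / 8) * ((2 * q).choose q / 4 ^ q) - 2 * tail q := by
  have hpi := Real.pi_pos
  set r := (1 + Real.cos (Real.pi / 32)) / 2 with hr
  have h1 : Real.cos (Real.pi / 32) < 1 := by
    rw [← Real.cos_zero]
    exact Real.cos_lt_cos_of_nonneg_of_le_pi le_rfl (by linarith) (by linarith)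
  have h0 := Real.neg_one_le_cos (Real.pi / 32)
  have ht := tendsto_self_mul_const_pow_of_lt_one (r := r) (by linarith) (by linarith)
  obtain ⟨q, hq1, hq⟩ := ((ht.eventually (gt_mem_nhds (by norm_num : (0 : ℝ) < 1 / 8))).and
    (Filter.eventually_ge_atTop 1)).exists.imp fun q h => And.comm.1 h
  refine ⟨q, ?_⟩
  have hq0 : (0 : ℝ) < q := by exact_mod_cast hq1
  have h2 : (1 : ℝ) / (2 * q) ≤ (2 * q).choose q / 4 ^ q := by
    rw [div_le_div_iff₀ (by positivity) (by positivity)]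
    have := Nat.four_pow_le_two_mul_self_mul_centralBinom q hq1
    rw [Nat.centralBinom] at this
    have h3 : (4 : ℝ) ^ q ≤ 2 * q * (2 * q).choose q := by exact_mod_cast this
    linarith
  have h4 := mul_le_mul half_le_cos_pi_div_eight h2 (by positivity) (by linarith [half_le_cos_pi_div_eight])
  have h5 : tail q < 1 / (8 * q) := by
    rw [tail, ← hr, lt_div_iff₀ (by positivity)]
    linarith
  have h6 : (1 : ℝ) / 2 * (1 / (2 * q)) = 2 * (1 / (8 * q)) := by field_simp; norm_num
  linarith

/-- If `Λ`-weighted exponential sums at the nonzero frequencies are small, the weighted mean of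
`peak * gap` is close to its expected value. -/
lemma weighted_mean_le (S : Finset ℕ) (w : ℕ → ℝ) (q n n' : ℕ) {E : ℝ}
    (hE1 : ∀ a : ℤ, |a| ≤ q → a ≠ 0 → ‖∑ d ∈ S, (w d : ℂ) * ee (((a * n : ℤ) : ℝ) / d)‖ ≤ E)
    (hE2 : ∀ a : ℤ, |a| ≤ q → ‖∑ d ∈ S, (w d : ℂ) * ee (((a * n + n' : ℤ) : ℝ) / d)‖ ≤ E)
    (hE3 : ∀ a : ℤ, |a| ≤ q → ‖∑ d ∈ S, (w d : ℂ) * ee (((a * n - n' : ℤ) : ℝ) / d)‖ ≤ E) :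
    Real.cos (Real.pi / 8) * ((2 * q).choose q / 4 ^ q) * ∑ d ∈ S, w d - 2 * E ≤
      ∑ d ∈ S, w d * (peak q (n / d) * gap (n' / d)) := by
  set c0 := Real.cos (Real.pi / 8) with hc0
  set W : ℤ → ℂ := fun F => ∑ d ∈ S, (w d : ℂ) * ee ((F : ℝ) / d) with hW
  set b : ℕ → ℝ := fun j => (2 * q).choose j / 4 ^ q with hb
  have hb0 : ∀ j, 0 ≤ b j := fun j => by positivity
  have hE0 : 0 ≤ E := (norm_nonneg _).trans (hE2 0 (by simp))
  have hc0' : 0 ≤ c0 := by linarith [half_le_cos_pi_div_eight]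
  have hc1 : c0 ≤ 1 := Real.cos_le_one _
  set Y : ℕ → ℂ := fun j => ee (-(((j : ℝ) - q) / 64)) * (c0 * W (((j : ℤ) - q) * n)
      - 1 / 2 * (ee (-(1 / 16)) * W (((j : ℤ) - q) * n + n') + ee (1 / 16) * W (((j : ℤ) - q) * n - n'))) with hY
  have hexp : ((∑ d ∈ S, w d * (peak q (n / d) * gap (n' / d)) : ℝ) : ℂ) =
      ∑ j ∈ range (2 * q + 1), (b j : ℂ) * Y j := by
    simp only [Complex.ofReal_sum, Complex.ofReal_mul, peak_expansion, gap_expansion, ← hc0, hY, hW,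
      mul_sum, sum_mul]
    rw [sum_comm]
    refine sum_congr rfl fun j _ => ?_
    simp only [← sum_add_distrib, mul_sum, ← sum_sub_distrib]
    refine sum_congr rfl fun d _ => ?_
    have e1 : ee (((j : ℝ) - q) * ((n : ℝ) / d - 1 / 64)) =
        ee (-(((j : ℝ) - q) / 64)) * ee (((((j : ℤ) - q) * n : ℤ) : ℝ) / d) := by
      rw [← ee_add]; congr 1; push_cast; ring
    have e2 : ee (((((j : ℤ) - q) * n + n' : ℤ) : ℝ) / d) =
        ee (((((j : ℤ) - q) * n : ℤ) : ℝ) / d) * ee (1 / 16) * ee ((n' : ℝ) / d - 1 / 16) := by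
      rw [← ee_add, ← ee_add]; congr 1; push_cast; ring
    have e3 : ee (((((j : ℤ) - q) * n - n' : ℤ) : ℝ) / d) =
        ee (((((j : ℤ) - q) * n : ℤ) : ℝ) / d) * ee (-(1 / 16)) * ee (-((n' : ℝ) / d - 1 / 16)) := by
      rw [← ee_add, ← ee_add]; congr 1; push_cast; ring
    have e4 : ee (-(1 / 16)) * ee (1 / 16) = 1 := by rw [← ee_add, neg_add_cancel, ee_zero]
    rw [e1, e2, e3]
    simp only [hb]
    linear_combination (1 / 2 * w d * (((2 * q).choose j / 4 ^ q : ℝ) : ℂ) * ee (-(((j : ℝ) - q) / 64)) *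
      ee (((((j : ℤ) - q) * n : ℤ) : ℝ) / d) * (ee ((n' : ℝ) / d - 1 / 16) + ee (-((n' : ℝ) / d - 1 / 16)))) * e4
  have hYb : ∀ j ∈ range (2 * q + 1), ‖Y j - (if j = q then ((c0 * ∑ d ∈ S, w d : ℝ) : ℂ) else 0)‖ ≤ 2 * E := by
    intro j hj
    rw [mem_range] at hj
    have ha : |(j : ℤ) - q| ≤ q := by rw [abs_le]; constructor <;> omega
    have h2 := hE2 _ ha
    have h3 := hE3 _ ha
    have hrest : ‖1 / 2 * (ee (-(1 / 16)) * W (((j : ℤ) - q) * n + n') + ee (1 / 16) * W (((j : ℤ) - q) * n - n'))‖ ≤ E := by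
      rw [norm_mul]
      have := norm_add_le (ee (-(1 / 16)) * W (((j : ℤ) - q) * n + n')) (ee (1 / 16) * W (((j : ℤ) - q) * n - n'))
      rw [norm_mul, norm_mul, norm_ee, norm_ee, one_mul, one_mul] at this
      have e : ‖(1 / 2 : ℂ)‖ = 1 / 2 := by norm_num
      rw [e]
      linarith
    split_ifs with h
    · have hY' : Y j - ((c0 * ∑ d ∈ S, w d : ℝ) : ℂ) = -(1 / 2 * (ee (-(1 / 16)) * W (((j : ℤ) - q) * n + n') + ee (1 / 16) * W (((j : ℤ) - q) * n - n'))) := by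
        simp only [hY, hW, h, sub_self, zero_div, neg_zero, ee_zero, zero_mul, Int.cast_zero]
        push_cast
        simp only [mul_one]
        ring
      rw [hY', norm_neg]; linarith
    · rw [sub_zero]
      simp only [hY]
      rw [norm_mul, norm_ee, one_mul]
      refine (norm_sub_le _ _).trans ?_
      rw [norm_mul, Complex.norm_real, Real.norm_of_nonneg hc0']
      have h1 := hE1 _ ha (by omega)
      have := mul_le_mul hc1 h1 (norm_nonneg _) zero_le_one
      linarith
  have hmain : ‖((∑ d ∈ S, w d * (peak q (n / d) * gap (n' / d)) - c0 * b q * ∑ d ∈ S, w d : ℝ) : ℂ)‖ ≤ 2 * E := by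
    have e : ((∑ d ∈ S, w d * (peak q (n / d) * gap (n' / d)) - c0 * b q * ∑ d ∈ S, w d : ℝ) : ℂ) =
        ∑ j ∈ range (2 * q + 1), (b j : ℂ) * (Y j - (if j = q then ((c0 * ∑ d ∈ S, w d : ℝ) : ℂ) else 0)) := by
      rw [Complex.ofReal_sub, hexp]
      simp only [mul_sub, sum_sub_distrib, mul_ite, mul_zero]
      rw [sum_ite_eq' , if_pos (mem_range.2 (by omega))]
      push_cast; ring
    rw [e]
    calc _ ≤ ∑ j ∈ range (2 * q + 1), b j * (2 * E) := by
          refine (norm_sum_le _ _).trans (sum_le_sum fun j hj => ?_)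
          rw [norm_mul, Complex.norm_real, Real.norm_of_nonneg (hb0 j)]
          exact mul_le_mul_of_nonneg_left (hYb j hj) (hb0 j)
      _ = 2 * E := by rw [← sum_mul, sum_choose_div, one_mul]
  rw [Complex.norm_real, Real.norm_eq_abs, abs_le] at hmain
  linarith [hmain.1]

end PowerSums

namespace PowerSums

open Finset

open ArithmeticFunction Filter Chebyshev
open scoped ArithmeticFunction.Moebius ArithmeticFunction.zeta

lemma eventually_pow_mul_exp_le {ε c η : ℝ} (hε : 0 < ε) (hc : 0 < c) (hη : 0 < η) :
    ∀ᶠ L : ℝ in atTop, (1 + L) ^ 3 * Real.exp (-(c * L ^ (3 * ε))) ≤ η := by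
  have h1 := (isLittleO_exp_neg_mul_rpow_atTop hc (-(1 / ε))).def (by positivity : 0 < η / 8)
  have h2 := (tendsto_rpow_atTop (by positivity : 0 < 3 * ε)).eventually h1
  filter_upwards [h2, eventually_ge_atTop 1] with L hL hL1
  have hL0 : 0 < L := by linarith
  have e : (L ^ (3 * ε)) ^ (-(1 / ε)) = (L ^ 3)⁻¹ := by
    rw [← Real.rpow_mul hL0.le, show 3 * ε * -(1 / ε) = -((3 : ℕ) : ℝ) by field_simp; norm_num,
      Real.rpow_neg hL0.le, Real.rpow_natCast]
  rw [e, Real.norm_of_nonneg (Real.exp_pos _).le, Real.norm_of_nonneg (by positivity), neg_mul] at hL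
  calc (1 + L) ^ 3 * Real.exp (-(c * L ^ (3 * ε))) ≤ (2 * L) ^ 3 * (η / 8 * (L ^ 3)⁻¹) := by
        gcongr; linarith
    _ = η := by field_simp; norm_num

lemma eventually_sqrt_mul_log_le {η : ℝ} (hη : 0 < η) :
    ∀ᶠ m : ℕ in atTop, √(32 * (m : ℝ)) * Real.log (32 * m) ≤ η * m := by
  have h1 := (isLittleO_log_rpow_atTop (by norm_num : (0 : ℝ) < 1 / 2)).def (by positivity : 0 < η / 32)
  have h2 : Tendsto (fun m : ℕ => 32 * (m : ℝ)) atTop atTop :=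
    tendsto_natCast_atTop_atTop.const_mul_atTop (by norm_num)
  filter_upwards [h2.eventually h1, eventually_ge_atTop 1] with m hm hm1
  have hm1' : (1 : ℝ) ≤ m := by exact_mod_cast hm1
  rw [Real.norm_of_nonneg (Real.log_nonneg (by linarith)), Real.norm_of_nonneg (by positivity),
    ← Real.sqrt_eq_rpow] at hm
  calc _ ≤ √(32 * (m : ℝ)) * (η / 32 * √(32 * (m : ℝ))) := by gcongr
    _ = η / 32 * (√(32 * (m : ℝ)) * √(32 * (m : ℝ))) := by ring
    _ = η * m := by rw [Real.mul_self_sqrt (by positivity)]; ring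

lemma psi_natCast (N : ℕ) : ψ (N : ℝ) = ∑ d ∈ Ioc 0 N, Λ d := by
  rw [psi, Nat.floor_natCast]

lemma sum_vonMangoldt_ge {m : ℕ} (hm : 1 ≤ m) (h : √(32 * (m : ℝ)) * Real.log (32 * m) ≤ m) :
    (m : ℝ) ≤ ∑ d ∈ Ioc (8 * m) (32 * m), Λ d := by
  have hm1 : (1 : ℝ) ≤ m := by exact_mod_cast hm
  have e : ∑ d ∈ Ioc (8 * m) (32 * m), Λ d = ψ ((32 * m : ℕ) : ℝ) - ψ ((8 * m : ℕ) : ℝ) := by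
    rw [psi_natCast, psi_natCast, ← sum_Ioc_consecutive _ (Nat.zero_le (8 * m)) (by omega)]
    ring
  have h1 := psi_ge (32 * m)
  have h2 := psi_le (x := ((8 * m : ℕ) : ℝ)) (by push_cast; linarith)
  have h3 : Real.log (((32 * m : ℕ) : ℝ) + 1) ≤ 2 * (√(32 * (m : ℝ)) * Real.log (32 * m)) := by
    have h4 : Real.log (((32 * m : ℕ) : ℝ) + 1) ≤ Real.log ((32 * (m : ℝ)) ^ 2) := by
      apply Real.log_le_log (by positivity)
      push_cast; nlinarith
    rw [Real.log_pow] at h4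
    have h5 : 1 ≤ √(32 * (m : ℝ)) := Real.one_le_sqrt.2 (by linarith)
    have h6 : 0 ≤ Real.log (32 * (m : ℝ)) := Real.log_nonneg (by linarith)
    push_cast at h4 ⊢
    nlinarith
  have h4 : √((8 * m : ℕ) : ℝ) * Real.log ((8 * m : ℕ) : ℝ) ≤ √(32 * (m : ℝ)) * Real.log (32 * m) := by
    have h6 : 0 ≤ Real.log (8 * (m : ℝ)) := Real.log_nonneg (by linarith)
    push_cast
    gcongr <;> norm_num
  have h7 : Real.log 4 = 2 * Real.log 2 := by
    rw [show (4 : ℝ) = 2 ^ 2 by norm_num, Real.log_pow]; norm_num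
  have h8 := Real.log_two_gt_d9
  have h9 : 0.6 * (m : ℝ) ≤ Real.log 2 * m := by gcongr; linarith
  rw [e]
  rw [h7] at h2
  push_cast at *
  linarith

lemma sum_not_prime_le {m : ℕ} (hm : 1 ≤ m) :
    ∑ d ∈ Ioc (8 * m) (32 * m) with ¬ d.Prime, Λ d ≤ 2 * (√(32 * (m : ℝ)) * Real.log (32 * m)) := by
  have hm1 : (1 : ℝ) ≤ m := by exact_mod_cast hm
  have h1 := psi_sub_theta_le (x := ((32 * m : ℕ) : ℝ)) (by push_cast; linarith)
  have h2 : ∑ d ∈ Ioc (8 * m) (32 * m) with ¬ d.Prime, Λ d ≤ ψ ((32 * m : ℕ) : ℝ) - θ ((32 * m : ℕ) : ℝ) := by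
    rw [psi_natCast, theta, Nat.floor_natCast,
      ← sum_filter_add_sum_filter_not (Ioc 0 (32 * m)) Nat.Prime]
    have e : ∑ d ∈ Ioc 0 (32 * m) with d.Prime, Λ d = ∑ d ∈ Ioc 0 (32 * m) with d.Prime, Real.log d :=
      sum_congr rfl fun d hd => vonMangoldt_apply_prime (mem_filter.1 hd).2
    rw [e, add_sub_cancel_left]
    refine sum_le_sum_of_subset_of_nonneg (filter_subset_filter _ (Ioc_subset_Ioc_left (Nat.zero_le _)))
      fun _ _ _ => vonMangoldt_nonneg
  push_cast at *
  linarith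

lemma decay_le {D m : ℕ} {F L : ℝ} (hm : 1 ≤ m) (hD : m ≤ D) (hF : 0 < Real.log |F|)
    (hFL : Real.log |F| ≤ 2 * L) :
    decay D F ≤ Real.exp (-(1 / (4 * 10 ^ 12) * (Real.log m ^ 3 / L ^ 2))) := by
  rw [decay]
  apply Real.exp_le_exp.2
  rw [neg_le_neg_iff]
  have hm0 : (0 : ℝ) < m := by exact_mod_cast hm
  have h0 : 0 ≤ Real.log m := Real.log_natCast_nonneg m
  have h1 : Real.log m ≤ Real.log D := Real.log_le_log hm0 (by exact_mod_cast hD)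
  calc 1 / (4 * 10 ^ 12) * (Real.log m ^ 3 / L ^ 2) = 1 / 10 ^ 12 * Real.log m ^ 3 / (2 * L) ^ 2 := by
        field_simp; ring
    _ ≤ _ := by gcongr

lemma sum_two_blocks_le {m : ℕ} {F L : ℝ} (hm : 2 ^ 36 ≤ m)
    (hF : (16 * (m : ℝ)) ^ (1.85 : ℝ) ≤ |F|) (hFL : Real.log |F| ≤ 2 * L)
    (hmL : Real.log (32 * m) ≤ L) :
    ‖∑ d ∈ Ioc (8 * m) (32 * m), (Λ d : ℂ) * ee (F / d)‖ ≤
      600 * Real.exp 1000 * m * ((1 + L) ^ 3 * Real.exp (-(1 / (4 * 10 ^ 12) * (Real.log m ^ 3 / L ^ 2)))) := by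
  have hm1 : (1 : ℝ) ≤ m := by exact_mod_cast (by omega : 1 ≤ m)
  have hlF : 0 < Real.log |F| := by
    apply Real.log_pos
    refine lt_of_lt_of_le ?_ hF
    exact Real.one_lt_rpow (by linarith) (by norm_num)
  have hF8 : ((8 * m : ℕ) : ℝ) ^ (1.85 : ℝ) ≤ |F| := by
    refine le_trans ?_ hF
    push_cast
    gcongr; norm_num
  have hF16 : ((16 * m : ℕ) : ℝ) ^ (1.85 : ℝ) ≤ |F| := by exact_mod_cast hF
  have h1 := vonMangoldt_sum_le (by omega : 2 ^ 36 ≤ 8 * m) (by omega : 8 * m ≤ 16 * m) (by omega) hF8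
  have h2 := vonMangoldt_sum_le (by omega : 2 ^ 36 ≤ 16 * m) (by omega : 16 * m ≤ 32 * m) (by omega) hF16
  have d1 := decay_le (D := 8 * m) (m := m) (by omega) (by omega) hlF hFL
  have d2 := decay_le (D := 16 * m) (m := m) (by omega) (by omega) hlF hFL
  set X := Real.exp (-(1 / (4 * 10 ^ 12) * (Real.log m ^ 3 / L ^ 2))) with hX
  have hX0 : 0 < X := Real.exp_pos _
  have l1 : Real.log (2 * ((8 * m : ℕ) : ℝ)) ≤ L := by
    refine (Real.log_le_log (by positivity) ?_).trans hmL
    push_cast; linarith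
  have l2 : Real.log (2 * ((16 * m : ℕ) : ℝ)) ≤ L := by
    refine (Real.log_le_log (by positivity) ?_).trans hmL
    push_cast; linarith
  have l1' : 0 ≤ Real.log (2 * ((8 * m : ℕ) : ℝ)) := Real.log_nonneg (by push_cast; linarith)
  have l2' : 0 ≤ Real.log (2 * ((16 * m : ℕ) : ℝ)) := Real.log_nonneg (by push_cast; linarith)
  have hL0 : 0 ≤ L := by linarith
  have h1' : ‖∑ d ∈ Ioc (8 * m) (16 * m), (Λ d : ℂ) * ee (F / d)‖ ≤
      18 * Real.exp 1000 * (8 * m : ℕ) * (1 + L) ^ 3 * X := by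
    refine h1.trans ?_
    have := decay_pos (8 * m) F
    gcongr
  have h2' : ‖∑ d ∈ Ioc (16 * m) (32 * m), (Λ d : ℂ) * ee (F / d)‖ ≤
      18 * Real.exp 1000 * (16 * m : ℕ) * (1 + L) ^ 3 * X := by
    refine h2.trans ?_
    have := decay_pos (16 * m) F
    gcongr
  rw [← sum_Ioc_consecutive _ (by omega : 8 * m ≤ 16 * m) (by omega : 16 * m ≤ 32 * m)]
  refine (norm_add_le _ _).trans ?_
  have h3 : 0 ≤ Real.exp 1000 * m * (1 + L) ^ 3 * X := by
    have : 0 ≤ L := by linarith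
    positivity
  push_cast at *
  linarith

lemma dvd_descFactorial_of_mod_lt {n m p : ℕ} (h : n % p < m) : p ∣ n.descFactorial m := by
  rw [Nat.descFactorial_eq_prod_range]
  exact (Nat.dvd_sub_mod n).trans (dvd_prod_of_mem _ (mem_range.2 h))

lemma not_dvd_descFactorial_of_le_mod {n m p : ℕ} (hp : p.Prime) (h : m ≤ n % p) :
    ¬ p ∣ n.descFactorial m := by
  rw [Nat.descFactorial_eq_prod_range, hp.prime.dvd_finsetProd_iff]
  rintro ⟨i, hi, hd⟩
  rw [mem_range] at hi
  have h1 : n % p ≤ n := Nat.mod_le _ _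
  have h2 : n ≡ i [MOD p] := ((Nat.modEq_iff_dvd' (by omega)).2 hd).symm
  have h3 : i < p := by have := Nat.mod_lt n hp.pos; omega
  have h4 : n % p = i % p := h2
  rw [Nat.mod_eq_of_lt h3] at h4
  omega

set_option maxHeartbeats 1000000 in
theorem exists_prime_split {ε : ℝ} (hε : 0 < ε) : ∃ L₀ : ℝ, ∀ n m n' m' : ℕ,
    L₀ ≤ Real.log ((n : ℝ) + n') → n < n' → 2 * n' ≤ 3 * n →
    Real.exp (Real.log ((n : ℝ) + n') ^ (2 / 3 + ε)) ≤ m → m' ≤ m →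
    (16 * (m : ℝ)) ^ (1.85 : ℝ) ≤ (n' : ℝ) - n →
    ∃ p : ℕ, p.Prime ∧ p ∣ n.descFactorial m ∧ ¬ p ∣ n'.descFactorial m' := by
  obtain ⟨q, hq⟩ := exists_mean_pos
  set η := Real.cos (Real.pi / 8) * ((2 * q).choose q / 4 ^ q) - 2 * tail q with hη
  set η' := min 1 (η / 16) with hη'
  have hη'0 : 0 < η' := lt_min one_pos (by positivity)
  have ev1 := eventually_pow_mul_exp_le hε (by norm_num : (0 : ℝ) < 1 / (4 * 10 ^ 12))
    (by positivity : 0 < η / (8 * (600 * Real.exp 1000)))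
  obtain ⟨M₀, hM₀⟩ := eventually_atTop.1 (eventually_sqrt_mul_log_le hη'0)
  have ev2 : ∀ᶠ L : ℝ in atTop, max (M₀ : ℝ) (2 ^ 36) ≤ Real.exp (L ^ (2 / 3 + ε)) :=
    (Real.tendsto_exp_atTop.comp (tendsto_rpow_atTop (by positivity))).eventually_ge_atTop _
  obtain ⟨L₀, hL₀⟩ := eventually_atTop.1 ((ev1.and ev2).and
    (eventually_ge_atTop (max 1 (Real.log (q + 1)))))
  refine ⟨L₀, fun n m n' m' hL hnn' hn' hm hm'm hH => ?_⟩
  set L := Real.log ((n : ℝ) + n') with hLdef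
  obtain ⟨⟨hexp, hM⟩, hL1⟩ := hL₀ L hL
  have hLone : 1 ≤ L := (le_max_left _ _).trans hL1
  have hLq : Real.log (q + 1) ≤ L := (le_max_right _ _).trans hL1
  have hM0m : M₀ ≤ m := by exact_mod_cast (le_max_left _ _).trans (hM.trans hm)
  have hm36 : 2 ^ 36 ≤ m := by
    have : (2 : ℝ) ^ 36 ≤ m := (le_max_right _ _).trans (hM.trans hm)
    exact_mod_cast this
  have hm1 : (1 : ℝ) ≤ m := by exact_mod_cast (by omega : 1 ≤ m)
  have hmpos : (0 : ℝ) < m := by linarith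
  have hnr : 2 * (n' : ℝ) ≤ 3 * n := by exact_mod_cast hn'
  have hnr' : (n : ℝ) < n' := by exact_mod_cast hnn'
  have hn0 : (0 : ℝ) ≤ n := Nat.cast_nonneg n
  have hcheb := hM₀ m hM0m
  have hcheb1 : √(32 * (m : ℝ)) * Real.log (32 * m) ≤ m := by
    refine hcheb.trans ?_
    have := mul_le_mul_of_nonneg_right (min_le_left 1 (η / 16)) hmpos.le
    linarith
  have hcheb2 : √(32 * (m : ℝ)) * Real.log (32 * m) ≤ η / 16 * m :=
    hcheb.trans (mul_le_mul_of_nonneg_right (min_le_right 1 (η / 16)) hmpos.le)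
  have h16 : 16 * (m : ℝ) ≤ (n' : ℝ) - n := by
    refine le_trans ?_ hH
    calc 16 * (m : ℝ) = (16 * (m : ℝ)) ^ (1 : ℝ) := (Real.rpow_one _).symm
      _ ≤ _ := Real.rpow_le_rpow_of_exponent_le (by linarith) (by norm_num)
  have hmL : Real.log (32 * m) ≤ L := Real.log_le_log (by positivity) (by linarith)
  have hlogm : L ^ (2 / 3 + ε) ≤ Real.log m := by
    rw [← Real.log_exp (L ^ (2 / 3 + ε))]
    exact Real.log_le_log (Real.exp_pos _) hm
  have hratio : L ^ (3 * ε) ≤ Real.log m ^ 3 / L ^ 2 := by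
    rw [le_div_iff₀ (by positivity)]
    have : (L ^ (2 / 3 + ε)) ^ 3 ≤ Real.log m ^ 3 := pow_le_pow_left₀ (by positivity) hlogm 3
    refine le_trans (le_of_eq ?_) this
    rw [← Real.rpow_natCast L 2, ← Real.rpow_natCast (L ^ (2 / 3 + ε)) 3, ← Real.rpow_mul (by linarith),
      ← Real.rpow_add (by linarith)]
    congr 1; push_cast; ring
  have hE : ∀ F : ℤ, ((n' : ℤ) - n ≤ |F|) → |F| ≤ (q + 1) * n' →
      ‖∑ d ∈ Ioc (8 * m) (32 * m), (Λ d : ℂ) * ee ((F : ℝ) / d)‖ ≤ η / 8 * m := by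
    intro F hF1 hF2
    have hF1' : (n' : ℝ) - n ≤ |(F : ℝ)| := by exact_mod_cast hF1
    have hF2' : |(F : ℝ)| ≤ (q + 1) * n' := by exact_mod_cast hF2
    have hlF : Real.log |(F : ℝ)| ≤ 2 * L := by
      have hn'pos : (0 : ℝ) < n' := by linarith
      calc Real.log |(F : ℝ)| ≤ Real.log ((q + 1) * n') := Real.log_le_log (by linarith) hF2'
        _ = Real.log (q + 1) + Real.log n' := Real.log_mul (by positivity) hn'pos.ne'
        _ ≤ L + L := by
          gcongr
          exact Real.log_le_log hn'pos (by linarith)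
        _ = _ := by ring
    refine (sum_two_blocks_le hm36 (hH.trans hF1') hlF hmL).trans ?_
    calc 600 * Real.exp 1000 * m * ((1 + L) ^ 3 * Real.exp (-(1 / (4 * 10 ^ 12) * (Real.log m ^ 3 / L ^ 2))))
        ≤ 600 * Real.exp 1000 * m * ((1 + L) ^ 3 * Real.exp (-(1 / (4 * 10 ^ 12) * L ^ (3 * ε)))) := by
          gcongr
      _ ≤ 600 * Real.exp 1000 * m * (η / (8 * (600 * Real.exp 1000))) := by gcongr
      _ = _ := by
        have := Real.exp_pos 1000
        field_simp
  have hbase : ∀ a : ℤ, |a| ≤ q → (n' : ℤ) - n ≤ |a * n + n'| ∧ |a * n + n'| ≤ (q + 1) * n' := by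
    intro a ha
    have hnn : (0 : ℤ) ≤ n := Int.natCast_nonneg n
    have hnlt : (n : ℤ) < n' := by exact_mod_cast hnn'
    have hn3 : 2 * (n' : ℤ) ≤ 3 * n := by exact_mod_cast hn'
    constructor
    · rcases lt_trichotomy a (-1) with h | h | h
      · rw [le_abs]; right
        nlinarith
      · rw [le_abs]; left; rw [h]; linarith
      · rw [le_abs]; left
        have : 0 ≤ a := by omega
        nlinarith
    · calc |a * n + n'| ≤ |a * n| + |(n' : ℤ)| := abs_add_le _ _
        _ = |a| * n + n' := by rw [abs_mul, Int.abs_natCast, Int.abs_natCast]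
        _ ≤ q * n' + n' := by gcongr
        _ = _ := by ring
  by_contra hcon
  push Not at hcon
  have hmean := weighted_mean_le (Ioc (8 * m) (32 * m)) (fun d => Λ d) q n n' (E := η / 8 * m)
    (fun a ha ha0 => by
      have hnn : (0 : ℤ) ≤ n := Int.natCast_nonneg n
      have hn3 : 2 * (n' : ℤ) ≤ 3 * n := by exact_mod_cast hn'
      have hnlt : (n : ℤ) < n' := by exact_mod_cast hnn'
      apply hE
      · rw [abs_mul, Int.abs_natCast]
        have : 1 ≤ |a| := Int.one_le_abs ha0
        nlinarith
      · rw [abs_mul, Int.abs_natCast]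
        have : |a| * (n : ℤ) ≤ q * n' := by gcongr
        linarith)
    (fun a ha => hE _ (hbase a ha).1 (hbase a ha).2)
    (fun a ha => by
      have := hbase (-a) (by rwa [abs_neg])
      rw [show -a * (n : ℤ) + n' = -(a * n - n') by ring, abs_neg] at this
      exact hE _ this.1 this.2)
  have htail := tail_nonneg q
  have hsum : ∑ d ∈ Ioc (8 * m) (32 * m), Λ d * (peak q (n / d) * gap (n' / d)) ≤
      2 * tail q * ∑ d ∈ Ioc (8 * m) (32 * m), Λ d + 2 * ∑ d ∈ Ioc (8 * m) (32 * m) with ¬ d.Prime, Λ d := by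
    rw [sum_filter, mul_sum, mul_sum, ← sum_add_distrib]
    refine sum_le_sum fun d hd => ?_
    rw [mem_Ioc] at hd
    have hΛ : 0 ≤ Λ d := vonMangoldt_nonneg
    have hp0 := peak_nonneg q (n / d)
    have hp1 := peak_le_one q (n / d)
    have hg2 := gap_le_two (n' / d)
    split_ifs with hprime
    · have hbound : peak q (n / d) * gap (n' / d) ≤ 2 * tail q := by
        by_cases h1 : d ≤ 32 * (n % d)
        · have := peak_le_tail (q := q) hprime.pos h1
          have := mul_le_mul_of_nonneg_left hg2 hp0
          linarith
        · have h2 := hcon d hprime (dvd_descFactorial_of_mod_lt (by omega))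
          have h3 : 8 * (n' % d) ≤ d := by
            by_contra h4
            exact not_dvd_descFactorial_of_le_mod hprime (by omega) h2
          have := mul_nonpos_of_nonneg_of_nonpos hp0 (gap_nonpos hprime.pos h3)
          linarith
      have := mul_le_mul_of_nonneg_left hbound hΛ
      linarith
    · have hbound : peak q (n / d) * gap (n' / d) ≤ 2 := by
        have := mul_le_mul_of_nonneg_left hg2 hp0
        linarith
      have := mul_le_mul_of_nonneg_left hbound hΛ
      have : 0 ≤ 2 * tail q * Λ d := by positivity
      linarith
  have hnp := sum_not_prime_le (by omega : 1 ≤ m)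
  have hψ := sum_vonMangoldt_ge (by omega : 1 ≤ m) hcheb1
  have hfin := mul_le_mul_of_nonneg_left hψ hq.le
  have e : η * ∑ d ∈ Ioc (8 * m) (32 * m), Λ d = Real.cos (Real.pi / 8) * ((2 * q).choose q / 4 ^ q) *
      ∑ d ∈ Ioc (8 * m) (32 * m), Λ d - 2 * tail q * ∑ d ∈ Ioc (8 * m) (32 * m), Λ d := by
    rw [hη]; ring
  have : 0 < η * m := by positivity
  linarith

end PowerSums

namespace PowerSums

open Finset

lemma exists_pow_dvd_sub {p v a h : ℕ} (hp : p.Prime) (hv : v ≠ 0) (hh : h ≤ p) (ha : h ≤ a)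
    (hd : p ^ v ∣ a.descFactorial h) : ∃ i < h, p ^ v ∣ a - i := by
  rw [Nat.descFactorial_eq_prod_range] at hd
  obtain ⟨i, hi, hpi⟩ := (hp.prime.dvd_finsetProd_iff _).1 ((dvd_pow_self p hv).trans hd)
  refine ⟨i, mem_range.1 hi, ?_⟩
  rw [← mul_prod_erase _ _ hi] at hd
  refine Nat.Coprime.dvd_of_dvd_mul_right ?_ hd
  refine Nat.Coprime.prod_right fun j hj => Nat.Coprime.pow_left _ ?_
  rw [hp.coprime_iff_not_dvd]
  intro hpj
  rw [mem_erase, mem_range] at hj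
  rw [mem_range] at hi
  rcases lt_or_gt_of_ne hj.1 with h1 | h1
  · have h2 := Nat.dvd_sub hpj hpi
    have h3 := Nat.le_of_dvd (by omega) h2
    omega
  · have h2 := Nat.dvd_sub hpi hpj
    have h3 := Nat.le_of_dvd (by omega) h2
    omega

lemma factorization_choose_le {p a h G k : ℕ} (hp : p.Prime) (hpl : 2 * h + k < p) (hhG : h ≤ G)
    (hGa : G ≤ a) (heq : a.descFactorial h = (a - G).descFactorial (h + k)) :
    (a.choose h).factorization p ≤ ((G + h + k).choose (2 * h + k)).factorization p := by
  set v := (a.choose h).factorization p with hv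
  have hah : h ≤ a := hhG.trans hGa
  rcases Nat.eq_zero_or_pos v with h0 | h0
  · rw [h0]; exact Nat.zero_le _
  have hd : p ^ v ∣ a.descFactorial h := by
    rw [Nat.descFactorial_eq_factorial_mul_choose]
    exact (Nat.ordProj_dvd _ _).mul_left _
  have hb : h + k ≤ a - G := by
    by_contra hlt
    rw [Nat.descFactorial_of_lt (by omega : a - G < h + k), Nat.descFactorial_eq_zero_iff_lt] at heq
    omega
  obtain ⟨i, hi, hdi⟩ := exists_pow_dvd_sub hp h0.ne' (by omega) hah hd
  rw [heq] at hd
  obtain ⟨j, hj, hdj⟩ := exists_pow_dvd_sub hp h0.ne' (by omega) hb hd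
  have hdw : p ^ v ∣ (G + h + k).descFactorial (2 * h + k) := by
    have h1 := Nat.dvd_sub hdi hdj
    rw [Nat.descFactorial_eq_prod_range]
    refine h1.trans ?_
    rw [show a - i - (a - G - j) = G + h + k - (h + k + i - j) by omega]
    exact dvd_prod_of_mem (fun s => G + h + k - s) (mem_range.2 (by omega))
  rw [Nat.descFactorial_eq_factorial_mul_choose] at hdw
  have hcop : Nat.Coprime (p ^ v) (2 * h + k).factorial :=
    Nat.Coprime.pow_left v ((hp.coprime_iff_not_dvd).2 fun h => by
      have := hp.dvd_factorial.1 h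
      omega)
  have := hcop.dvd_of_dvd_mul_left hdw
  exact (hp.pow_dvd_iff_le_factorization (Nat.choose_pos (by omega)).ne').1 this

theorem choose_le_of_descFactorial_eq {a h G k : ℕ} (ha : 1 ≤ a) (hhG : h ≤ G)
    (hGa : G ≤ a) (heq : a.descFactorial h = (a - G).descFactorial (h + k)) :
    a.choose h ≤ a ^ (Nat.primeCounting (2 * h + k)) * (G + h + k).choose (2 * h + k) := by
  have hne : a.choose h ≠ 0 := (Nat.choose_pos (hhG.trans hGa)).ne'
  have hne' : (G + h + k).choose (2 * h + k) ≠ 0 := (Nat.choose_pos (by omega)).ne'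
  have e : a.choose h = ∏ p ∈ (a.choose h).primeFactors, p ^ (a.choose h).factorization p :=
    (Nat.prod_factorization_pow_eq_self hne).symm
  rw [e, ← prod_filter_mul_prod_filter_not _ (fun p => p ≤ 2 * h + k)]
  gcongr ?_ * ?_
  · calc ∏ p ∈ (a.choose h).primeFactors with p ≤ 2 * h + k, p ^ (a.choose h).factorization p
        ≤ ∏ p ∈ (a.choose h).primeFactors with p ≤ 2 * h + k, a :=
          prod_le_prod' fun p _ => Nat.pow_factorization_choose_le ha
      _ = a ^ ({p ∈ (a.choose h).primeFactors | p ≤ 2 * h + k} : Finset ℕ).card := by rw [prod_const]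
      _ ≤ _ := by
        refine Nat.pow_le_pow_right ha ?_
        rw [Nat.primeCounting, Nat.primeCounting', Nat.count_eq_card_filter_range]
        refine card_le_card fun p hp => ?_
        simp only [mem_filter, Nat.mem_primeFactors, mem_range] at hp ⊢
        exact ⟨by omega, hp.1.1⟩
  · refine Nat.le_of_dvd (Nat.pos_of_ne_zero hne') ?_
    refine Finset.prod_dvd_of_isRelPrime ?_ ?_
    · intro p hp q hq hpq
      simp only [coe_filter, Nat.mem_primeFactors] at hp hq
      exact Nat.coprime_iff_isRelPrime.1 (Nat.coprime_pow_primes _ _ hp.1.1 hq.1.1 hpq)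
    · intro p hp
      simp only [mem_filter, Nat.mem_primeFactors] at hp
      exact (pow_dvd_pow p (factorization_choose_le hp.1.1 (by omega) hhG hGa heq)).trans
        (Nat.ordProj_dvd _ _)

lemma pow_div_le_choose {a h : ℕ} (hha : h ≤ a) : ((a : ℝ) / h) ^ h ≤ a.choose h := by
  induction h generalizing a with
  | zero => simp
  | succ h ih =>
    obtain ⟨b, rfl⟩ : ∃ b, a = b + 1 := ⟨a - 1, by omega⟩
    have hb : h ≤ b := by omega
    have e : ((b + 1).choose (h + 1) : ℝ) = ((b + 1 : ℕ) : ℝ) / ((h + 1 : ℕ) : ℝ) * b.choose h := by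
      have : ((b + 1 : ℕ) : ℝ) * b.choose h = (b + 1).choose (h + 1) * ((h + 1 : ℕ) : ℝ) := by
        exact_mod_cast Nat.add_one_mul_choose_eq b h
      field_simp
      linarith
    rw [pow_succ', e]
    gcongr
    refine le_trans ?_ (ih hb)
    rcases Nat.eq_zero_or_pos h with rfl | h0
    · simp
    gcongr ?_ ^ h
    have hb' : (h : ℝ) ≤ b := by exact_mod_cast hb
    have h0' : (0 : ℝ) < h := by exact_mod_cast h0
    rw [div_le_div_iff₀ (by positivity) h0']
    push_cast; linarith

lemma choose_le_exp_mul_div_pow (N k : ℕ) :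
    (N.choose k : ℝ) ≤ (Real.exp 1 * N / k) ^ k := by
  rcases Nat.eq_zero_or_pos k with rfl | hk
  · simp
  have hk' : (0 : ℝ) < k := by exact_mod_cast hk
  have h1 : (N.choose k : ℝ) ≤ (N : ℝ) ^ k / k.factorial := Nat.choose_le_pow_div k N
  have h2 := Real.pow_div_factorial_le_exp (k : ℝ) hk'.le k
  have h3 : (0 : ℝ) < k.factorial := by exact_mod_cast k.factorial_pos
  refine h1.trans ?_
  rw [div_le_iff₀ h3] at h2
  rw [div_pow, mul_pow, ← Real.exp_nat_mul, mul_one, div_le_div_iff₀ h3 (by positivity)]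
  calc (N : ℝ) ^ k * (k : ℝ) ^ k ≤ N ^ k * (Real.exp k * k.factorial) := by gcongr
    _ = _ := by ring

lemma primeCounting_le {l : ℕ} (hl : 2 ≤ l) : (Nat.primeCounting l : ℝ) ≤ 5 * l / Real.log l := by
  have hl' : (2 : ℝ) ≤ l := by exact_mod_cast hl
  have h1 := Chebyshev.pi_le_log4_mul_div (x := (l : ℝ)) (by linarith)
  rw [Nat.floor_natCast] at h1
  have hlog : 0 < Real.log l := Real.log_pos (by linarith)
  have h2 : Real.log √(l : ℝ) = Real.log l / 2 := Real.log_sqrt (by linarith)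
  have hs : 0 < √(l : ℝ) := Real.sqrt_pos.2 (by linarith)
  have h3 : Real.log l ≤ 2 * √(l : ℝ) := by
    have := Real.log_le_sub_one_of_pos hs
    rw [h2] at this; linarith
  have h4 : √(l : ℝ) ≤ 2 * l / Real.log l := by
    rw [le_div_iff₀ hlog]
    nlinarith [Real.mul_self_sqrt (show (0 : ℝ) ≤ l by linarith)]
  have h5 : Real.log 4 ≤ 1.5 := by
    rw [show (4 : ℝ) = 2 ^ 2 by norm_num, Real.log_pow]
    have := Real.log_two_lt_d9
    push_cast; linarith
  rw [h2] at h1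
  calc (Nat.primeCounting l : ℝ) ≤ Real.log 4 * l / (Real.log l / 2) + √(l : ℝ) := h1
    _ ≤ 1.5 * l / (Real.log l / 2) + 2 * l / Real.log l := by gcongr
    _ = 5 * l / Real.log l := by field_simp; norm_num

lemma descFactorial_sub_eq {n m n' m' : ℕ} (hm : m ≤ n) (hm' : m' ≤ n') (hnn' : n < n') (hmm' : m' ≤ m)
    (heq : n.descFactorial m = n'.descFactorial m') :
    n'.descFactorial (min (n' - n) m') =
      (n' - max (n' - n) m').descFactorial (min (n' - n) m' + (m - m')) := by
  rcases le_total m' (n' - n) with h | h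
  · rw [min_eq_right h, max_eq_left h, ← heq]
    congr 1 <;> omega
  · rw [min_eq_left h, max_eq_right h]
    have h1 := Nat.descFactorial_mul_descFactorial (n := n') h
    have h2 := Nat.descFactorial_mul_descFactorial (n := n) (k := m' - (n' - n)) (m := m) (by omega)
    rw [← heq, ← h2, show n' - (n' - n) = n by omega] at h1
    have h3 : 0 < n.descFactorial (m' - (n' - n)) := Nat.descFactorial_pos.2 (by omega)
    have h4 : n'.descFactorial (n' - n) = (n - (m' - (n' - n))).descFactorial (m - (m' - (n' - n))) := by
      apply Nat.eq_of_mul_eq_mul_left h3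
      rw [h1, mul_comm]
    rw [h4]
    congr 1 <;> omega

lemma digits_two_sum_le (n : ℕ) : (Nat.digits 2 n).sum ≤ Nat.log 2 n + 1 := by
  rcases Nat.eq_zero_or_pos n with rfl | hn
  · simp
  rw [← Nat.length_digits 2 n (by norm_num) hn.ne']
  have := List.sum_le_card_nsmul (Nat.digits 2 n) 1 fun d hd => by
    have := Nat.digits_lt_base (by norm_num : 1 < 2) hd
    omega
  simpa using this

lemma le_add_log_of_descFactorial_eq {n m n' m' : ℕ} (hm : m ≤ n) (hm' : m' ≤ n')
    (heq : n.descFactorial m = n'.descFactorial m') :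
    m ≤ m' + (Nat.log 2 n + 1) + (Nat.log 2 (n' - m') + 1) := by
  have key : ∀ {a b : ℕ}, b ≤ a → padicValNat 2 (a.descFactorial b) + (a - b) + (Nat.digits 2 a).sum =
      a + (Nat.digits 2 (a - b)).sum := by
    intro a b hab
    have : Fact (Nat.Prime 2) := ⟨Nat.prime_two⟩
    have h1 := Nat.factorial_mul_descFactorial hab
    have h2 := congrArg (padicValNat 2) h1
    rw [padicValNat.mul (Nat.factorial_ne_zero _) (Nat.descFactorial_pos.2 hab).ne'] at h2
    have h3 := sub_one_mul_padicValNat_factorial (p := 2) a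
    have h4 := sub_one_mul_padicValNat_factorial (p := 2) (a - b)
    have h5 := Nat.digit_sum_le 2 a
    have h6 := Nat.digit_sum_le 2 (a - b)
    omega
  have k1 := key hm
  have k2 := key hm'
  rw [heq] at k1
  have := digits_two_sum_le n
  have := digits_two_sum_le (n' - m')
  omega

lemma pow_mul_descFactorial_le {n n' : ℕ} (h : n ≤ n') (j : ℕ) :
    n' ^ j * n.descFactorial j ≤ n ^ j * n'.descFactorial j := by
  induction j with
  | zero => simp
  | succ j ih =>
    rw [Nat.descFactorial_succ, Nat.descFactorial_succ, pow_succ, pow_succ]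
    have : n' * (n - j) ≤ n * (n' - j) := by
      rw [Nat.mul_sub, Nat.mul_sub, mul_comm n' n]
      have := Nat.mul_le_mul_right j h
      omega
    calc n' ^ j * n' * ((n - j) * n.descFactorial j) = n' ^ j * n.descFactorial j * (n' * (n - j)) := by ring
      _ ≤ n ^ j * n'.descFactorial j * (n * (n' - j)) := Nat.mul_le_mul ih this
      _ = _ := by ring

lemma descFactorial_mul_pow_le {n n' l : ℕ} (h : n ≤ n') (hl : l ≤ n) {j : ℕ} (hj : j ≤ l) :
    n'.descFactorial j * (n - l) ^ j ≤ (n' - l) ^ j * n.descFactorial j := by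
  induction j with
  | zero => simp
  | succ j ih =>
    have ih := ih (by omega)
    rw [Nat.descFactorial_succ, Nat.descFactorial_succ, pow_succ, pow_succ]
    have : (n' - j) * (n - l) ≤ (n' - l) * (n - j) := by
      obtain ⟨a, rfl⟩ := Nat.exists_eq_add_of_le hl
      obtain ⟨b, rfl⟩ := Nat.exists_eq_add_of_le h
      obtain ⟨c, rfl⟩ := Nat.exists_eq_add_of_le (by omega : j ≤ l)
      rw [show j + c + a + b - j = c + a + b by omega, show j + c + a - (j + c) = a by omega,
        show j + c + a + b - (j + c) = a + b by omega, show j + c + a - j = c + a by omega]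
      nlinarith [Nat.zero_le (b * c)]
    calc (n' - j) * n'.descFactorial j * ((n - l) ^ j * (n - l))
        = n'.descFactorial j * (n - l) ^ j * ((n' - j) * (n - l)) := by ring
      _ ≤ (n' - l) ^ j * n.descFactorial j * ((n' - l) * (n - j)) := Nat.mul_le_mul ih this
      _ = _ := by ring

lemma pow_le_of_descFactorial_eq {n m n' m' : ℕ} (hm : m ≤ n) (hnn' : n ≤ n') (hmm' : m' ≤ m)
    (heq : n.descFactorial m = n'.descFactorial m') : n' ^ m' ≤ n ^ m' * n ^ (m - m') := by
  have h1 := pow_mul_descFactorial_le hnn' m'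
  rw [← heq, ← Nat.descFactorial_mul_descFactorial hmm'] at h1
  have h2 : 0 < n.descFactorial m' := Nat.descFactorial_pos.2 (by omega)
  have h3 : (n - m').descFactorial (m - m') ≤ n ^ (m - m') :=
    (Nat.descFactorial_le_pow _ _).trans (Nat.pow_le_pow_left (Nat.sub_le _ _) _)
  refine Nat.le_of_mul_le_mul_right (c := n.descFactorial m') ?_ h2
  calc n' ^ m' * n.descFactorial m' ≤ n ^ m' * ((n - m').descFactorial (m - m') * n.descFactorial m') := h1
    _ ≤ n ^ m' * (n ^ (m - m') * n.descFactorial m') := by gcongr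
    _ = _ := by ring

lemma pow_mul_le_of_descFactorial_eq {n m n' m' : ℕ} (hm : m ≤ n) (hnn' : n ≤ n') (hmm' : m' < m)
    (heq : n.descFactorial m = n'.descFactorial m') : (n - m') ^ m' * (n - m) ≤ (n' - m') ^ m' := by
  have h1 := descFactorial_mul_pow_le hnn' (by omega : m' ≤ n) le_rfl
  rw [← heq, ← Nat.descFactorial_mul_descFactorial hmm'.le] at h1
  have h2 : 0 < n.descFactorial m' := Nat.descFactorial_pos.2 (by omega)
  have h3 : n - m ≤ (n - m').descFactorial (m - m') := by
    refine le_trans ?_ (Nat.pow_sub_le_descFactorial _ _)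
    refine le_trans ?_ (Nat.le_self_pow (by omega) _)
    omega
  refine Nat.le_of_mul_le_mul_right (c := n.descFactorial m') ?_ h2
  calc (n - m') ^ m' * (n - m) * n.descFactorial m'
      ≤ (n - m') ^ m' * (n - m').descFactorial (m - m') * n.descFactorial m' := by gcongr
    _ = (n - m').descFactorial (m - m') * n.descFactorial m' * (n - m') ^ m' := by ring
    _ ≤ _ := h1

lemma lt_of_descFactorial_eq {n m n' m' : ℕ} (hm1 : 1 ≤ m) (hm' : m' ≤ n') (hm : m ≤ n) (hnn' : n < n')
    (heq : n.descFactorial m = n'.descFactorial m') : m' < m := by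
  by_contra hlt
  push Not at hlt
  have h1 : n.descFactorial m < n'.descFactorial m := by
    obtain ⟨j, rfl⟩ : ∃ j, m = j + 1 := ⟨m - 1, by omega⟩
    rw [Nat.descFactorial_succ, Nat.descFactorial_succ]
    exact Nat.mul_lt_mul_of_lt_of_le (by omega) (Nat.descFactorial_le _ hnn'.le)
      (Nat.descFactorial_pos.2 (by omega))
  have h2 := Nat.descFactorial_mul_descFactorial (n := n') hlt
  have h3 : 1 ≤ (n' - m).descFactorial (m' - m) := Nat.descFactorial_pos.2 (by omega)
  have := Nat.mul_le_mul_right (n'.descFactorial m) h3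
  omega

end PowerSums

namespace PowerSums

open Finset

open Filter

lemma log_div_le_of_descFactorial_eq {a h G k : ℕ} {L : ℝ} (hh : 2 ≤ h) (hkh : k ≤ h) (hhG : h ≤ G)
    (hGa : G ≤ a) (haL : Real.log a ≤ L)
    (heq : a.descFactorial h = (a - G).descFactorial (h + k)) :
    Real.log ((a : ℝ) / h) ≤ 15 * L / Real.log h + (2 + (k : ℝ) / h) * (1 + Real.log ((G : ℝ) / h)) := by
  have hh' : (2 : ℝ) ≤ h := by exact_mod_cast hh
  have hh0 : (0 : ℝ) < h := by linarith
  have hkh' : (k : ℝ) ≤ h := by exact_mod_cast hkh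
  have hhG' : (h : ℝ) ≤ G := by exact_mod_cast hhG
  have hGa' : (G : ℝ) ≤ a := by exact_mod_cast hGa
  have hG0 : (0 : ℝ) < G := by linarith
  have ha0 : (0 : ℝ) < a := by linarith
  have hk0 : (0 : ℝ) ≤ k := Nat.cast_nonneg k
  set l := 2 * h + k with hl
  have hlr : (l : ℝ) = 2 * h + k := by rw [hl]; push_cast; ring
  have hl0 : (0 : ℝ) < l := by linarith
  have h1 : (a.choose h : ℝ) ≤ (a : ℝ) ^ (Nat.primeCounting l) * ((G + h + k).choose l : ℝ) := by
    exact_mod_cast choose_le_of_descFactorial_eq (by omega) hhG hGa heq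
  have h2 : ((G + h + k).choose l : ℝ) ≤ (Real.exp 1 * ((G : ℝ) / h)) ^ l := by
    refine (choose_le_exp_mul_div_pow _ _).trans ?_
    rw [mul_div_assoc]
    gcongr ?_ ^ l
    gcongr Real.exp 1 * ?_
    rw [div_le_div_iff₀ hl0 hh0, hlr]
    push_cast
    nlinarith
  have h3 : ((a : ℝ) / h) ^ h ≤ (a : ℝ) ^ (Nat.primeCounting l) * (Real.exp 1 * ((G : ℝ) / h)) ^ l :=
    (pow_div_le_choose (hhG.trans hGa)).trans (h1.trans (by gcongr))
  have h4 := Real.log_le_log (by positivity) h3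
  rw [Real.log_pow, Real.log_mul (by positivity) (by positivity), Real.log_pow, Real.log_pow,
    Real.log_mul (by positivity) (by positivity), Real.log_exp] at h4
  have hlogh : 0 < Real.log h := Real.log_pos (by linarith)
  have hL0 : 0 ≤ Real.log a := Real.log_nonneg (by linarith)
  have h5 : (Nat.primeCounting l : ℝ) ≤ 15 * h / Real.log h := by
    refine (primeCounting_le (by omega)).trans ?_
    have : Real.log h ≤ Real.log l := Real.log_le_log hh0 (by linarith)
    calc 5 * (l : ℝ) / Real.log l ≤ 5 * l / Real.log h := by gcongr
      _ ≤ 15 * h / Real.log h := by gcongr ?_ / _; linarith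
  have h6 : (Nat.primeCounting l : ℝ) * Real.log a ≤ 15 * h / Real.log h * L := by gcongr
  have h7 : (h : ℝ) * (15 * L / Real.log h + (2 + (k : ℝ) / h) * (1 + Real.log ((G : ℝ) / h))) =
      15 * h / Real.log h * L + l * (1 + Real.log ((G : ℝ) / h)) := by
    rw [hlr]; field_simp
  refine le_of_mul_le_mul_left ?_ hh0
  rw [h7]
  linarith

lemma log_div_le_of_exp_le {a h G k : ℕ} {L : ℝ} (hL : 1 ≤ L)
    (hLh : 16 * L ^ 2 ≤ Real.exp (L ^ (2 / 3 : ℝ) / 2)) (hh : Real.exp (L ^ (2 / 3 : ℝ) / 2) ≤ h)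
    (hk : (k : ℝ) ≤ 4 * L) (hhG : h ≤ G) (hGa : G ≤ a) (haL : Real.log a ≤ L)
    (hGL : Real.log ((G : ℝ) / h) ≤ L)
    (heq : a.descFactorial h = (a - G).descFactorial (h + k)) :
    Real.log ((a : ℝ) / h) ≤ 30 * L ^ (1 / 3 : ℝ) + 3 + 2 * Real.log ((G : ℝ) / h) := by
  have hL2 : L ≤ L ^ 2 := by nlinarith
  have hh16 : 16 * L ^ 2 ≤ (h : ℝ) := hLh.trans hh
  have hh0 : (0 : ℝ) < h := by nlinarith
  have hh2 : 2 ≤ h := by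
    have : (2 : ℝ) ≤ h := by linarith
    exact_mod_cast this
  have hkh : k ≤ h := by
    have : (k : ℝ) ≤ h := by linarith
    exact_mod_cast this
  have hmain := log_div_le_of_descFactorial_eq hh2 hkh hhG hGa haL heq
  have hlogh : L ^ (2 / 3 : ℝ) / 2 ≤ Real.log h := by
    rw [← Real.log_exp (L ^ (2 / 3 : ℝ) / 2)]
    exact Real.log_le_log (Real.exp_pos _) hh
  have h1 : 15 * L / Real.log h ≤ 30 * L ^ (1 / 3 : ℝ) := by
    have hp : 0 < L ^ (2 / 3 : ℝ) := by positivity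
    rw [div_le_iff₀ (by linarith)]
    have e : L ^ (1 / 3 : ℝ) * L ^ (2 / 3 : ℝ) = L := by
      rw [← Real.rpow_add (by linarith)]; norm_num
    calc 15 * L = 30 * L ^ (1 / 3 : ℝ) * (L ^ (2 / 3 : ℝ) / 2) := by linear_combination -15 * e
      _ ≤ _ := by gcongr
  have hR0 : 0 ≤ Real.log ((G : ℝ) / h) := by
    apply Real.log_nonneg
    rw [le_div_iff₀ hh0, one_mul]
    exact_mod_cast hhG
  have h2 : (k : ℝ) / h * (1 + Real.log ((G : ℝ) / h)) ≤ 1 := by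
    rw [div_mul_eq_mul_div, div_le_one hh0]
    have hk0 : (0 : ℝ) ≤ k := Nat.cast_nonneg k
    calc (k : ℝ) * (1 + Real.log ((G : ℝ) / h)) ≤ 4 * L * (1 + L) := by gcongr
      _ ≤ _ := by nlinarith
  linarith

lemma sub_le_four_mul_log {n m n' m' : ℕ} (hm1 : 1 ≤ m) (hm : m ≤ n) (hm' : m' ≤ n') (hmm' : m' ≤ m)
    (heq : n.descFactorial m = n'.descFactorial m') (hL : 2 ≤ Real.log ((n : ℝ) + n')) :
    ((m - m' : ℕ) : ℝ) ≤ 4 * Real.log ((n : ℝ) + n') := by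
  set L := Real.log ((n : ℝ) + n') with hLdef
  have hn0 : (1 : ℝ) ≤ n := by exact_mod_cast (by omega : 1 ≤ n)
  have hb : ∀ x : ℕ, x ≤ n + n' → (Nat.log 2 x : ℝ) ≤ 1.5 * L := by
    intro x hx
    rcases Nat.eq_zero_or_pos x with rfl | hx0
    · simp; linarith
    have h1 : ((2 : ℝ)) ^ (Nat.log 2 x) ≤ (n : ℝ) + n' := by
      exact_mod_cast (Nat.pow_log_le_self 2 hx0.ne').trans hx
    have h2 := Real.log_le_log (by positivity) h1
    rw [Real.log_pow] at h2
    have := Real.log_two_gt_d9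
    have h3 : (0 : ℝ) ≤ Nat.log 2 x := Nat.cast_nonneg _
    nlinarith
  have h1 := hb n (by omega)
  have h2 := hb (n' - m') (by omega)
  have h3 := le_add_log_of_descFactorial_eq hm hm' heq
  have h4 : (m : ℝ) ≤ m' + (Nat.log 2 n + 1) + (Nat.log 2 (n' - m') + 1) := by exact_mod_cast h3
  rw [Nat.cast_sub hmm']
  linarith

lemma sub_mul_le {n m n' m' : ℕ} (hm : m ≤ n) (hnn' : n < n') (hmm' : m' ≤ m) (hn : 1 ≤ n)
    (heq : n.descFactorial m = n'.descFactorial m') :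
    ((n' : ℝ) - n) * m' ≤ n' * ((m - m' : ℕ) * Real.log n) := by
  have hn' : (1 : ℝ) ≤ n := by exact_mod_cast hn
  have hnn : (n : ℝ) < n' := by exact_mod_cast hnn'
  have hn'0 : (0 : ℝ) < n' := by linarith
  have h1 : (n' : ℝ) ^ m' ≤ (n : ℝ) ^ m' * (n : ℝ) ^ (m - m') := by
    exact_mod_cast pow_le_of_descFactorial_eq hm hnn'.le hmm' heq
  have h2 := Real.log_le_log (by positivity) h1
  rw [Real.log_mul (by positivity) (by positivity), Real.log_pow, Real.log_pow, Real.log_pow] at h2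
  have h3 := Real.one_sub_inv_le_log_of_pos (show (0 : ℝ) < n' / n by positivity)
  rw [Real.log_div hn'0.ne' (by positivity), inv_div] at h3
  have h4 : (m' : ℝ) * (1 - n / n') ≤ (m - m' : ℕ) * Real.log n := by
    calc (m' : ℝ) * (1 - n / n') ≤ m' * (Real.log n' - Real.log n) := by gcongr
      _ ≤ _ := by linarith
  calc ((n' : ℝ) - n) * m' = n' * (m' * (1 - n / n')) := by field_simp
    _ ≤ _ := by gcongr

lemma sub_mul_log_le {n m n' m' : ℕ} (hm : m < n) (hnn' : n < n') (hmm' : m' < m)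
    (heq : n.descFactorial m = n'.descFactorial m') :
    ((n : ℝ) - m') * Real.log ((n : ℝ) - m) ≤ ((n' : ℝ) - n) * m' := by
  have h1 := pow_mul_le_of_descFactorial_eq hm.le hnn'.le hmm' heq
  have h2 : ((n : ℝ) - m') ^ m' * ((n : ℝ) - m) ≤ ((n' : ℝ) - m') ^ m' := by
    rw [← Nat.cast_sub hm.le, ← Nat.cast_sub (by omega : m' ≤ n), ← Nat.cast_sub (by omega : m' ≤ n')]
    exact_mod_cast h1
  have hm_r : (m : ℝ) < n := by exact_mod_cast hm
  have hmm_r : (m' : ℝ) < m := by exact_mod_cast hmm'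
  have hnn_r : (n : ℝ) < n' := by exact_mod_cast hnn'
  have hp : 0 < (n : ℝ) - m' := by linarith
  have h3 : (n : ℝ) - m ≤ Real.exp (((n' : ℝ) - n) * m' / (n - m')) := by
    calc (n : ℝ) - m ≤ (((n' : ℝ) - m') / (n - m')) ^ m' := by
          rw [div_pow, le_div_iff₀ (by positivity)]
          linarith
      _ ≤ (Real.exp (((n' : ℝ) - n) / (n - m'))) ^ m' := by
          have : 0 < (n' : ℝ) - m' := by linarith
          gcongr ?_ ^ m'
          have := Real.add_one_le_exp (((n' : ℝ) - n) / (n - m'))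
          refine le_trans (le_of_eq ?_) this
          field_simp
          ring
      _ = _ := by
          rw [← Real.exp_nat_mul]
          congr 1
          ring
  have h4 := Real.log_le_log (by linarith) h3
  rw [Real.log_exp, le_div_iff₀ hp] at h4
  linarith

lemma eventually_large (A : ℝ) : ∀ᶠ L : ℝ in atTop, 1000 ≤ L ∧
    16 * L ^ 2 ≤ Real.exp (L ^ (2 / 3 : ℝ) / 2) ∧ A * Real.log L ≤ L ^ (2 / 3 : ℝ) / 2 ∧
    30 * L ^ (1 / 3 : ℝ) + 2 * (A * Real.log L) + 6 < L / 3 ∧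
    30 * L ^ (1 / 3 : ℝ) + 4 * Real.log L + 15 < 0.035 * L := by
  have h1 := (isLittleO_log_rpow_atTop (by norm_num : (0 : ℝ) < 2 / 3)).def
    (by positivity : 0 < 1 / (1000 * (1 + |A|)))
  have h2 := (tendsto_rpow_atTop (by norm_num : (0 : ℝ) < 2 / 3)).eventually_ge_atTop 6000
  filter_upwards [h1, h2, eventually_ge_atTop 1000] with L hlog hu hL
  have hL0 : 0 < L := by linarith
  have hlog0 : 0 ≤ Real.log L := Real.log_nonneg (by linarith)
  rw [Real.norm_of_nonneg hlog0, Real.norm_of_nonneg (by positivity)] at hlog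
  set u := L ^ (2 / 3 : ℝ) with hudef
  have huL : u ≤ L := by
    calc u ≤ L ^ (1 : ℝ) := Real.rpow_le_rpow_of_exponent_le (by linarith) (by norm_num)
      _ = L := Real.rpow_one L
  have e : L ^ (1 / 3 : ℝ) * u = L := by
    rw [hudef, ← Real.rpow_add hL0]; norm_num
  have hthird : 6000 * L ^ (1 / 3 : ℝ) ≤ L := by
    calc 6000 * L ^ (1 / 3 : ℝ) = L ^ (1 / 3 : ℝ) * 6000 := by ring
      _ ≤ L ^ (1 / 3 : ℝ) * u := by gcongr
      _ = L := e
  have hA : 1000 * ((1 + |A|) * Real.log L) ≤ u := by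
    rw [div_mul_eq_mul_div, one_mul, le_div_iff₀ (by positivity)] at hlog
    linarith
  have hA1 : A * Real.log L ≤ |A| * Real.log L := mul_le_mul_of_nonneg_right (le_abs_self A) hlog0
  have hA2 : 0 ≤ |A| * Real.log L := by positivity
  refine ⟨hL, ?_, by linarith, by linarith, by linarith⟩
  rw [← Real.log_le_iff_le_exp (by positivity), Real.log_mul (by norm_num) (by positivity), Real.log_pow]
  have := Real.log_le_sub_one_of_pos (by norm_num : (0 : ℝ) < 16)
  push_cast
  linarith

set_option maxHeartbeats 1000000 in
theorem exists_sub_le {ε : ℝ} (hε : 0 < ε) (A : ℝ) : ∃ L₀ : ℝ, ∀ n m n' m' : ℕ,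
    L₀ ≤ Real.log ((n : ℝ) + n') → n < n' → 1 ≤ m → m ≤ n → m' ≤ n' →
    n.descFactorial m = n'.descFactorial m' →
    Real.exp (Real.log ((n : ℝ) + n') ^ (2 / 3 + ε)) ≤ m →
    (m : ℝ) ≤ ((n : ℝ) + n') ^ (2 / 3 : ℝ) →
    Real.exp (Real.log ((n : ℝ) + n') ^ (2 / 3 + ε)) ≤ m' →
    (n' : ℝ) - n ≤ m / Real.log ((n : ℝ) + n') ^ A := by
  obtain ⟨L₁, hL₁⟩ := exists_prime_split hε
  obtain ⟨L₂, hL₂⟩ := eventually_atTop.1 (eventually_large A)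
  refine ⟨max L₁ L₂, fun n m n' m' hL hnn' hm1 hmn hmn' heq hm hmN hm' => ?_⟩
  have hsplit := hL₁ n m n' m' ((le_max_left _ _).trans hL) hnn'
  obtain ⟨hL1000, hLexp, hlogu, hcmp1, hcmp2⟩ := hL₂ _ ((le_max_right _ _).trans hL)
  have hmm' := lt_of_descFactorial_eq hm1 hmn' hmn hnn' heq
  have hk := sub_le_four_mul_log hm1 hmn hmn' hmm'.le heq (by linarith)
  set L := Real.log ((n : ℝ) + n') with hLdef
  set k := m - m' with hkdef
  have hn1 : (1 : ℝ) ≤ n := by exact_mod_cast hm1.trans hmn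
  have hnn_r : (n : ℝ) < n' := by exact_mod_cast hnn'
  have hmm_r : (m' : ℝ) < m := by exact_mod_cast hmm'
  have hn'0 : (0 : ℝ) < n' := by linarith
  have hkr : (m : ℝ) = m' + k := by rw [hkdef, Nat.cast_sub hmm'.le]; ring
  have hN : (n : ℝ) + n' = Real.exp L := (Real.exp_log (by linarith)).symm
  have hupow : L ^ (2 / 3 : ℝ) ≤ L ^ (2 / 3 + ε) :=
    Real.rpow_le_rpow_of_exponent_le (by linarith) (by linarith)
  have hu0 : 0 < L ^ (2 / 3 : ℝ) := by positivity
  have hm'exp : Real.exp (L ^ (2 / 3 : ℝ)) ≤ m' := (Real.exp_le_exp.2 hupow).trans hm'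
  have hm'16 : 16 * L ^ 2 ≤ (m' : ℝ) := hLexp.trans ((Real.exp_le_exp.2 (by linarith)).trans hm'exp)
  have hm'0 : (0 : ℝ) < m' := by nlinarith
  have hlogn : Real.log n ≤ L := Real.log_le_log (by linarith) (by linarith)
  have hlogn' : Real.log n' ≤ L := Real.log_le_log (by linarith) (by linarith)
  have hlogn0 : 0 ≤ Real.log n := Real.log_nonneg hn1
  have hupper : ((n' : ℝ) - n) * m' ≤ 4 * n' * L ^ 2 := by
    refine (sub_mul_le hmn hnn' hmm'.le (hm1.trans hmn) heq).trans ?_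
    calc (n' : ℝ) * (k * Real.log n) ≤ n' * (4 * L * L) := by gcongr
      _ = _ := by ring
  have hn43 : 3 * (n' : ℝ) ≤ 4 * n := by
    have h1 : ((n' : ℝ) - n) * (16 * L ^ 2) ≤ ((n' : ℝ) - n) * m' := by gcongr
    have h2 : ((n' : ℝ) - n) * 4 * (4 * L ^ 2) ≤ n' * (4 * L ^ 2) := by linarith
    have := le_of_mul_le_mul_right h2 (by positivity)
    linarith
  have hn32 : 2 * n' ≤ 3 * n := by
    have : 2 * (n' : ℝ) ≤ 3 * n := by linarith
    exact_mod_cast this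
  have hmexp : (m : ℝ) ≤ Real.exp (2 / 3 * L) := by
    rw [hN, ← Real.exp_mul] at hmN
    rwa [mul_comm] at hmN
  have hm10 : 10 * (m : ℝ) ≤ n + n' := by
    rw [hN]
    calc 10 * (m : ℝ) ≤ Real.exp (1 / 3 * L) * Real.exp (2 / 3 * L) := by
          have := Real.add_one_le_exp (1 / 3 * L)
          gcongr
          linarith
      _ = _ := by rw [← Real.exp_add]; congr 1; ring
  have hlog3 : Real.log ((n + n') / 4) ≥ L - 3 := by
    rw [Real.log_div (by linarith) (by norm_num)]
    have := Real.log_le_sub_one_of_pos (by norm_num : (0 : ℝ) < 4)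
    linarith
  have hmn4 : 4 * (m : ℝ) ≤ n := by linarith
  have hlower : (n : ℝ) ≤ ((n' : ℝ) - n) * m' := by
    have hmn_lt : m < n := by
      have : (m : ℝ) < n := by linarith
      exact_mod_cast this
    refine le_trans ?_ (sub_mul_log_le hmn_lt hnn' hmm' heq)
    have h1 : 2 ≤ Real.log ((n : ℝ) - m) := by
      have : Real.log ((n + n') / 4) ≤ Real.log ((n : ℝ) - m) :=
        Real.log_le_log (by linarith) (by linarith)
      linarith
    calc (n : ℝ) ≤ (n - m') * 2 := by linarith
      _ ≤ _ := by gcongr; linarith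
  have hm_half : (m : ℝ) ≤ 2 * m' := by
    have : 4 * L ≤ 16 * L ^ 2 := by nlinarith
    linarith
  have hm0 : (0 : ℝ) < m := by linarith
  have hlog2 : Real.log 2 ≤ 1 := by have := Real.log_two_lt_d9; linarith
  have hH0 : 0 < (n' : ℝ) - n := by linarith
  have hHcast : ((n' - n : ℕ) : ℝ) = n' - n := Nat.cast_sub hnn'.le
  have hlogm' : Real.log m' ≥ Real.log m - 1 := by
    have := Real.log_le_log hm0 hm_half
    rw [Real.log_mul (by norm_num) hm'0.ne'] at this
    linarith
  have hlognge : L - 3 ≤ Real.log n := hlog3.le.trans (Real.log_le_log (by linarith) (by linarith))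
  have hlognge' : L - 3 ≤ Real.log n' := hlognge.trans (Real.log_le_log (by linarith) hnn_r.le)
  have hlogmlarge : 0.345 * L < Real.log m := by
    by_contra hsmall
    push Not at hsmall
    obtain ⟨p, -, hp1, hp2⟩ := hsplit hn32 hm hmm'.le (by
      rw [← Real.log_le_log_iff (by positivity) hH0, Real.log_rpow (by positivity),
        Real.log_mul (by norm_num) hm0.ne', show (16 : ℝ) = 2 ^ 4 by norm_num, Real.log_pow]
      have h1 := Real.log_le_log (by linarith) hlower
      rw [Real.log_mul hH0.ne' hm'0.ne'] at h1
      have h2 := Real.log_le_log hm'0 hmm_r.le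
      push_cast
      linarith)
    exact hp2 (heq ▸ hp1)
  have hred := descFactorial_sub_eq hmn hmn' hnn' hmm'.le heq
  rcases le_total m' (n' - n) with hcase | hcase
  · exfalso
    rw [min_eq_right hcase, max_eq_left hcase] at hred
    have hHm : (m' : ℝ) ≤ n' - n := by rw [← hHcast]; exact_mod_cast hcase
    have hR : Real.log (((n' - n : ℕ) : ℝ) / m') ≤ 2 + L + 2 * Real.log L - 2 * Real.log m' := by
      rw [hHcast, Real.log_div hH0.ne' hm'0.ne']
      have h1 := Real.log_le_log (by positivity) hupper
      rw [Real.log_mul hH0.ne' hm'0.ne', Real.log_mul (by positivity) (by positivity),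
        Real.log_mul (by norm_num) (by linarith), show (4 : ℝ) = 2 ^ 2 by norm_num, Real.log_pow,
        Real.log_pow] at h1
      push_cast at h1
      linarith
    have hRL : Real.log (((n' - n : ℕ) : ℝ) / m') ≤ L := by
      refine (Real.log_le_log ?_ ?_).trans hlogn'
      · rw [hHcast]; positivity
      · rw [hHcast, div_le_iff₀ hm'0]
        nlinarith
    have hmain := log_div_le_of_exp_le (by linarith) hLexp
      ((Real.exp_le_exp.2 (by linarith)).trans hm'exp) hk hcase (Nat.sub_le _ _) hlogn' hRL hred
    rw [Real.log_div hn'0.ne' hm'0.ne'] at hmain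
    linarith
  · rw [min_eq_left hcase, max_eq_right hcase] at hred
    by_contra hlt
    push Not at hlt
    have hLA : 0 < L ^ A := by positivity
    have hlt' : (m : ℝ) < (n' - n) * L ^ A := by rwa [div_lt_iff₀ hLA] at hlt
    have h1 := Real.log_le_log hm0 hlt'.le
    rw [Real.log_mul hH0.ne' hLA.ne', Real.log_rpow (by linarith)] at h1
    have hmu : L ^ (2 / 3 : ℝ) ≤ Real.log m := by
      rw [Real.le_log_iff_exp_le hm0]; linarith
    have hh : Real.exp (L ^ (2 / 3 : ℝ) / 2) ≤ ((n' - n : ℕ) : ℝ) := by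
      rw [hHcast, ← Real.le_log_iff_exp_le hH0]
      linarith
    have hHm : (n' : ℝ) - n ≤ m' := by rw [← hHcast]; exact_mod_cast hcase
    have hR : Real.log ((m' : ℝ) / ((n' - n : ℕ) : ℝ)) ≤ A * Real.log L := by
      rw [hHcast, ← Real.log_rpow (by linarith)]
      apply Real.log_le_log (by positivity)
      rw [div_le_iff₀ hH0]
      linarith
    have hRL : Real.log ((m' : ℝ) / ((n' - n : ℕ) : ℝ)) ≤ L := by
      have : L ^ (2 / 3 : ℝ) ≤ L ^ (1 : ℝ) :=
        Real.rpow_le_rpow_of_exponent_le (by linarith) (by norm_num)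
      rw [Real.rpow_one] at this
      linarith
    have hmain := log_div_le_of_exp_le (by linarith) hLexp hh hk hcase hmn' hlogn' hRL hred
    rw [hHcast] at hmain hR
    rw [Real.log_div hn'0.ne' hH0.ne'] at hmain
    have h2 : Real.log ((n' : ℝ) - n) ≤ 2 / 3 * L := by
      rw [Real.log_le_iff_le_exp hH0]; linarith
    linarith

end PowerSums

namespace PowerSums

open Finset

theorem exists_sub_le_mul {ε : ℝ} (hε : 0 < ε) {A : ℝ} (hA : 0 < A) : ∃ C : ℝ, 1 ≤ C ∧ ∀ n m n' m' : ℕ,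
    n < n' → 1 ≤ m → m ≤ n → 1 ≤ m' → m' ≤ n' →
    n.descFactorial m = n'.descFactorial m' →
    Real.exp (Real.log ((n : ℝ) + n') ^ (2 / 3 + ε)) ≤ m →
    (m : ℝ) ≤ ((n : ℝ) + n') ^ (2 / 3 : ℝ) →
    Real.exp (Real.log ((n : ℝ) + n') ^ (2 / 3 + ε)) ≤ m' →
    (n' : ℝ) - n ≤ C * ((m : ℝ) + m') / Real.log ((m : ℝ) + m') ^ A := by
  obtain ⟨L₀, hL₀⟩ := exists_sub_le hε A
  refine ⟨max 1 (Real.exp L₀ * |L₀| ^ A), le_max_left _ _, fun n m n' m' hnn' hm1 hmn hm1' hmn' heq hm hmN hm' => ?_⟩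
  have hm_r : (1 : ℝ) ≤ m := by exact_mod_cast hm1
  have hm_r' : (1 : ℝ) ≤ m' := by exact_mod_cast hm1'
  have hmn_r : (m : ℝ) ≤ n := by exact_mod_cast hmn
  have hmn_r' : (m' : ℝ) ≤ n' := by exact_mod_cast hmn'
  have hlog : 0 < Real.log ((m : ℝ) + m') := Real.log_pos (by linarith)
  have hlogL : Real.log ((m : ℝ) + m') ≤ Real.log ((n : ℝ) + n') :=
    Real.log_le_log (by linarith) (by linarith)
  rw [le_div_iff₀ (by positivity)]
  have hpow : Real.log ((m : ℝ) + m') ^ A ≤ Real.log ((n : ℝ) + n') ^ A :=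
    Real.rpow_le_rpow hlog.le hlogL hA.le
  have hL : 0 < Real.log ((n : ℝ) + n') := hlog.trans_le hlogL
  rcases le_or_gt L₀ (Real.log ((n : ℝ) + n')) with h | h
  · have h1 := hL₀ n m n' m' h hnn' hm1 hmn hmn' heq hm hmN hm'
    have h0 : 0 < Real.log ((n : ℝ) + n') ^ A := by positivity
    have hnn_r : (n : ℝ) < n' := by exact_mod_cast hnn'
    calc ((n' : ℝ) - n) * Real.log ((m : ℝ) + m') ^ A
        ≤ ((n' : ℝ) - n) * Real.log ((n : ℝ) + n') ^ A :=
          mul_le_mul_of_nonneg_left hpow (by linarith)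
      _ ≤ m := by rwa [le_div_iff₀ h0] at h1
      _ ≤ 1 * ((m : ℝ) + m') := by linarith
      _ ≤ _ := mul_le_mul_of_nonneg_right (le_max_left _ _) (by linarith)
  · have h1 : (n' : ℝ) - n ≤ Real.exp L₀ := by
      have := (Real.log_lt_iff_lt_exp (by linarith)).1 h
      linarith
    have h2 : Real.log ((m : ℝ) + m') ^ A ≤ |L₀| ^ A :=
      Real.rpow_le_rpow hlog.le (hlogL.trans (h.le.trans (le_abs_self _))) hA.le
    calc ((n' : ℝ) - n) * Real.log ((m : ℝ) + m') ^ A ≤ Real.exp L₀ * |L₀| ^ A := by gcongr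
      _ ≤ max 1 (Real.exp L₀ * |L₀| ^ A) * 1 := by rw [mul_one]; exact le_max_right _ _
      _ ≤ _ := by
        gcongr
        linarith

end PowerSums

/-- Distance estimate for falling factorials, second part: for every `ε > 0` and `A > 0`
there is a constant `C(ε,A)` such that any two solutions `(n,m)`, `(n',m')` of
`(n)_m = (n')_{m'} = t` with `exp((log(n+n'))^(2/3+ε)) ≤ m, m' ≤ (n+n')^(2/3)` satisfy
`|n - n'| ≤ C(ε,A) (m+m') / (log(m+m'))^A`. -/
theorem stmt_17 (ε A : ℝ) (hε : 0 < ε) (hA : 0 < A) :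
    ∃ C : ℝ, ∀ t n m n' m' : ℕ, 2 ≤ t →
      1 ≤ m → m ≤ n → 1 ≤ m' → m' ≤ n' →
      Nat.descFactorial n m = t → Nat.descFactorial n' m' = t →
      Real.exp ((Real.log ((n : ℝ) + (n' : ℝ))) ^ ((2 : ℝ) / 3 + ε)) ≤ (m : ℝ) →
      (m : ℝ) ≤ ((n : ℝ) + (n' : ℝ)) ^ ((2 : ℝ) / 3) →
      Real.exp ((Real.log ((n : ℝ) + (n' : ℝ))) ^ ((2 : ℝ) / 3 + ε)) ≤ (m' : ℝ) →
      (m' : ℝ) ≤ ((n : ℝ) + (n' : ℝ)) ^ ((2 : ℝ) / 3) →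
      |(n : ℝ) - (n' : ℝ)| ≤
        C * ((m : ℝ) + (m' : ℝ)) / (Real.log ((m : ℝ) + (m' : ℝ))) ^ A := by
  obtain ⟨C, hC1, hC⟩ := PowerSums.exists_sub_le_mul hε hA
  refine ⟨C, fun t n m n' m' _ hm1 hmn hm1' hmn' ht ht' hm hmN hm' hmN' => ?_⟩
  rcases lt_trichotomy n n' with h | h | h
  · have h_lt : (n : ℝ) < n' := by exact_mod_cast h
    rw [abs_sub_comm, abs_of_pos (by linarith)]
    exact hC n m n' m' h hm1 hmn hm1' hmn' (ht.trans ht'.symm) hm hmN hm'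
  · have hm_r : (1 : ℝ) ≤ m := by exact_mod_cast hm1
    have hm_r' : (1 : ℝ) ≤ m' := by exact_mod_cast hm1'
    have : 0 < Real.log ((m : ℝ) + m') := Real.log_pos (by linarith)
    rw [h, sub_self, abs_zero]
    positivity
  · have h_lt : (n' : ℝ) < n := by exact_mod_cast h
    rw [abs_of_pos (by linarith), add_comm (m : ℝ)]
    rw [add_comm (n : ℝ)] at hm hm' hmN'
    exact hC n' m' n m h hm1' hmn' hm1 hmn (ht'.trans ht.symm) hm' hmN' hm
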